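/- arXiv:2108.06211 — 3 statements merged into one kernel-verified Lean document; each statement's English description precedes it below -/
import Mathlib

section
/- Consider the functional-coefficient autoregressive model Y_t = Σ_{j=1}^p a_j(X_{t-1}, Y_{t-1}, …, Y_{t-p}) Y_{t-j} + ε_t. Assume 𝔼|ε_0| < ∞, the distribution of ε_0 has a positive density f which is bounded below away from 0 on every compact subset of ℝ, the envelope functions b_j(x) = sup_{y_1,…,y_p ∈ ℝ} |a_j(x, y_1, …, y_p)| are finite, the top Lyapunov exponent γ(X) = inf_{n ≥ 1} (1/n) 𝔼[log ‖A(X_{-1})⋯A(X_{-n})‖] is strictly negative (where A(x) is the p×p companion matrix with first row (b_1(x),…,b_p(x))), and the process X is mixing. Then there exists a unique stationary and ergodic solution ((Y_t, X_t))_{t∈ℤ} to these equations. -/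
open MeasureTheory ProbabilityTheory Filter
open scoped ENNReal

noncomputable section

/-- The shift operator on two-sided paths. -/
def zshift {α : Type*} (x : ℤ → α) : ℤ → α := fun t => x (t + 1)

/-- The σ-algebra on the path space `(E × F)^ℤ` generated by the whole `F`-coordinate path
(environment) and the `E`-coordinates (chain) strictly before time `t`. -/
def histSigma (E F : Type*) [MeasurableSpace E] [MeasurableSpace F] (t : ℤ) :
    MeasurableSpace (ℤ → E × F) :=
  MeasurableSpace.comap
    (fun z => ((fun s => (z s).2, fun s : {s : ℤ // s < t} => (z s.1).1) :
      (ℤ → F) × ({s : ℤ // s < t} → E))) inferInstance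

/-- `μ` is the law of a process `((Y_t, X_t))_{t∈ℤ}` solving the functional-coefficient
autoregressive model: the conditional distribution of `Y_t` given `X` and the past `Y`'s has
density `v ↦ f(v − Σ_{j=1}^p a_j(X_{t-1}, Y_{t-1}, …, Y_{t-p}) Y_{t-j})`. -/
def IsFCARSolution {d p : ℕ} (a : Fin p → (Fin d → ℝ) → (Fin p → ℝ) → ℝ) (f : ℝ → ℝ)
    (μ : Measure (ℤ → ℝ × (Fin d → ℝ))) : Prop :=
  ∀ (t : ℤ) (A : Set ℝ), MeasurableSet A →
    μ[({z : ℤ → ℝ × (Fin d → ℝ) | (z t).1 ∈ A}).indicator (fun _ => (1 : ℝ)) |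
        histSigma ℝ (Fin d → ℝ) t]
      =ᵐ[μ] fun z => (∫⁻ v in A, ENNReal.ofReal (f (v - ∑ j : Fin p,
        a j ((z (t - 1)).2) (fun i : Fin p => (z (t - 1 - (i : ℕ))).1) *
          (z (t - 1 - (j : ℕ))).1))).toReal

/-- The companion matrix with first row `(b₁(x), …, b_p(x))`, identity lower-left block and
zero last column below the first row. -/
def companionMat {d p : ℕ} (bfun : Fin p → (Fin d → ℝ) → ℝ) (x : Fin d → ℝ) :
    Matrix (Fin p) (Fin p) ℝ :=
  fun i j => if (i : ℕ) = 0 then bfun j x else if (j : ℕ) + 1 = (i : ℕ) then 1 else 0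

/-- A norm on `p × p` real matrices (the entrywise `ℓ¹` norm). -/
def matNorm {p : ℕ} (M : Matrix (Fin p) (Fin p) ℝ) : ℝ := ∑ i : Fin p, ∑ j : Fin p, |M i j|

/-! ### The abstract skew-product chain -/

/-- The noise law. -/
def noiseM (f : ℝ → ℝ) : Measure ℝ := volume.withDensity (fun u => ENNReal.ofReal (f u))

/-- Push a new value `v` in front of the state, drop the oldest one, and shift the environment. -/
def putFn {q : ℕ} {X : Type*} (θ : X → X) (w : (Fin (q + 1) → ℝ) × X) (v : ℝ) :
    (Fin (q + 1) → ℝ) × X :=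
  (fun i => Fin.cases (motive := fun _ => ℝ) v (fun k : Fin q => w.1 k.castSucc) i, θ w.2)

/-- One step of the chain driven by noise `e`. -/
def stepFn {q : ℕ} {X : Type*} (θ : X → X) (ψ : (Fin (q + 1) → ℝ) × X → ℝ)
    (w : (Fin (q + 1) → ℝ) × X) (e : ℝ) : (Fin (q + 1) → ℝ) × X :=
  putFn θ w (ψ w + e)

/-- The transition operator on measures. -/
def Qop {q : ℕ} {X : Type*} [MeasurableSpace X] (θ : X → X) (ψ : (Fin (q + 1) → ℝ) × X → ℝ)
    (γ : Measure ℝ) (ν : Measure ((Fin (q + 1) → ℝ) × X)) : Measure ((Fin (q + 1) → ℝ) × X) :=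
  (ν.prod γ).map (fun we => stepFn θ ψ we.1 we.2)

section chain

set_option linter.unusedSectionVars false

variable {q : ℕ} {X : Type*} [MeasurableSpace X] {θ : X → X} {ψ : (Fin (q + 1) → ℝ) × X → ℝ}

lemma putFn_zero (w : (Fin (q + 1) → ℝ) × X) (v : ℝ) : (putFn θ w v).1 0 = v := rfl

lemma putFn_succ (w : (Fin (q + 1) → ℝ) × X) (v : ℝ) (i : Fin q) :
    (putFn θ w v).1 i.succ = w.1 i.castSucc := rfl

lemma measurable_putFn (hθ : Measurable θ) :
    Measurable (fun wv : ((Fin (q + 1) → ℝ) × X) × ℝ => putFn θ wv.1 wv.2) := by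
  unfold putFn
  refine Measurable.prodMk (measurable_pi_lambda _ fun i => ?_) (by fun_prop)
  refine Fin.cases ?_ (fun k => ?_) i
  · exact measurable_snd
  · simp only [Fin.cases_succ]; fun_prop

lemma measurable_stepFn (hθ : Measurable θ) (hψ : Measurable ψ) :
    Measurable (fun we : ((Fin (q + 1) → ℝ) × X) × ℝ => stepFn θ ψ we.1 we.2) := by
  have h2 : Measurable (fun we : ((Fin (q + 1) → ℝ) × X) × ℝ => (we.1, ψ we.1 + we.2)) := by
    fun_prop
  exact (measurable_putFn hθ).comp h2

instance isFiniteMeasure_Qop (γ : Measure ℝ) [IsFiniteMeasure γ]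
    (ν : Measure ((Fin (q + 1) → ℝ) × X)) [IsFiniteMeasure ν] : IsFiniteMeasure (Qop θ ψ γ ν) := by
  unfold Qop; infer_instance

lemma lintegral_Qop (hθ : Measurable θ) (hψ : Measurable ψ) (γ : Measure ℝ) [SFinite γ]
    (ν : Measure ((Fin (q + 1) → ℝ) × X)) [SFinite ν] {g : (Fin (q + 1) → ℝ) × X → ℝ≥0∞}
    (hg : Measurable g) :
    ∫⁻ w, g w ∂(Qop θ ψ γ ν) = ∫⁻ w, ∫⁻ e, g (stepFn θ ψ w e) ∂γ ∂ν := by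
  unfold Qop
  rw [lintegral_map hg (measurable_stepFn hθ hψ), lintegral_prod]
  exact (hg.comp (measurable_stepFn hθ hψ)).aemeasurable

lemma Qop_univ (hθ : Measurable θ) (hψ : Measurable ψ) (γ : Measure ℝ) [IsProbabilityMeasure γ]
    (ν : Measure ((Fin (q + 1) → ℝ) × X)) [SFinite ν] :
    Qop θ ψ γ ν Set.univ = ν Set.univ := by
  rw [← lintegral_one, lintegral_Qop hθ hψ _ _ measurable_const]
  simp

lemma Qop_add (hθ : Measurable θ) (hψ : Measurable ψ) (γ : Measure ℝ) [SFinite γ]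
    (ν ν' : Measure ((Fin (q + 1) → ℝ) × X)) [SFinite ν] [SFinite ν'] :
    Qop θ ψ γ (ν + ν') = Qop θ ψ γ ν + Qop θ ψ γ ν' := by
  unfold Qop
  rw [Measure.add_prod, Measure.map_add _ _ (measurable_stepFn hθ hψ)]

lemma Qop_mono (hθ : Measurable θ) (hψ : Measurable ψ) (γ : Measure ℝ) [SFinite γ]
    {ν ν' : Measure ((Fin (q + 1) → ℝ) × X)} [SFinite ν] [SFinite ν'] (h : ν ≤ ν') :
    Qop θ ψ γ ν ≤ Qop θ ψ γ ν' := by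
  refine Measure.le_iff.2 fun s hs => ?_
  rw [← lintegral_indicator_one hs, ← lintegral_indicator_one hs,
    lintegral_Qop hθ hψ _ _ (measurable_one.indicator hs),
    lintegral_Qop hθ hψ _ _ (measurable_one.indicator hs)]
  exact lintegral_mono' h le_rfl

end chain

/-! ### Uniqueness of the invariant measure with given environment marginal -/

section uniq

set_option linter.unusedSectionVars false
set_option linter.style.haveILetI false

variable {q : ℕ} {X : Type*} [MeasurableSpace X] {θ : X → X} {ψ : (Fin (q + 1) → ℝ) × X → ℝ}

/-- Iterated almost every new value lands in `S`. -/
def aeIter (θ : X → X) (S : Set ((Fin (q + 1) → ℝ) × X)) : ℕ → Set ((Fin (q + 1) → ℝ) × X)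
  | 0 => S
  | j + 1 => {w | ∀ᵐ v : ℝ, putFn θ w v ∈ aeIter θ S j}

lemma measurableSet_aeIter (hθ : Measurable θ) {S : Set ((Fin (q + 1) → ℝ) × X)}
    (hS : MeasurableSet S) (j : ℕ) : MeasurableSet (aeIter θ S j) := by
  induction j with
  | zero => exact hS
  | succ j ih =>
    have h1 : MeasurableSet ((fun wv : ((Fin (q + 1) → ℝ) × X) × ℝ => putFn θ wv.1 wv.2) ⁻¹'
        (aeIter θ S j)ᶜ) := measurable_putFn hθ ih.compl
    have h2 := measurable_measure_prodMk_left (ν := (volume : Measure ℝ)) h1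
    exact h2 (measurableSet_singleton 0)

lemma aeIter_congr (S : Set ((Fin (q + 1) → ℝ) × X)) (j : ℕ) (hj : j ≤ q + 1) :
    ∀ w w' : (Fin (q + 1) → ℝ) × X, w.2 = w'.2 →
      (∀ i : Fin (q + 1), (i : ℕ) + j < q + 1 → w.1 i = w'.1 i) →
      w ∈ aeIter θ S j → w' ∈ aeIter θ S j := by
  induction j with
  | zero =>
    intro w w' h2 h1 hw
    have : w = w' := Prod.ext (funext fun i => h1 i (by omega)) h2
    exact this ▸ hw
  | succ j ih =>
    intro w w' h2 h1 hw
    have hw : ∀ᵐ v : ℝ, putFn θ w v ∈ aeIter θ S j := hw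
    change ∀ᵐ v : ℝ, putFn θ w' v ∈ aeIter θ S j
    filter_upwards [hw] with v hv
    refine ih (by omega) _ _ (by simp [putFn, h2]) (fun i => ?_) hv
    refine Fin.cases (fun _ => rfl) (fun k hk => ?_) i
    rw [putFn_succ, putFn_succ]
    exact h1 _ (by simp at hk ⊢; omega)

lemma aeIter_disjoint (S : Set ((Fin (q + 1) → ℝ) × X)) (j : ℕ) :
    ∀ w, w ∈ aeIter θ S j → w ∉ aeIter θ Sᶜ j := by
  induction j with
  | zero => intro w h h'; exact h' h
  | succ j ih =>
    intro w h h'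
    have h : ∀ᵐ v : ℝ, putFn θ w v ∈ aeIter θ S j := h
    have h' : ∀ᵐ v : ℝ, putFn θ w v ∈ aeIter θ Sᶜ j := h'
    obtain ⟨v, hv, hv'⟩ := (h.and h').exists
    exact ih _ hv hv'

lemma ae_of_ae_noise {f : ℝ → ℝ} (hf : Measurable f) (hfpos : ∀ u, 0 < f u) {P : ℝ → Prop} (c : ℝ)
    (h : ∀ᵐ e ∂(noiseM f), P (c + e)) : ∀ᵐ v : ℝ, P v := by
  have h1 : (volume : Measure ℝ) ≪ noiseM f := by
    refine withDensity_absolutelyContinuous' (by fun_prop) (ae_of_all _ fun u => ?_)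
    simpa using hfpos u
  have h2 := h1.ae_le h
  have h3 := (measurePreserving_add_left (volume : Measure ℝ) (-c)).quasiMeasurePreserving.ae h2
  filter_upwards [h3] with v hv
  simpa using hv

lemma ae_aeIter {f : ℝ → ℝ} (hf : Measurable f) (hfpos : ∀ u, 0 < f u)
    [IsProbabilityMeasure (noiseM f)]
    (hθ : Measurable θ) (hψ : Measurable ψ)
    {κ : Measure ((Fin (q + 1) → ℝ) × X)} [IsFiniteMeasure κ] (hκ : Qop θ ψ (noiseM f) κ = κ)
    {S : Set ((Fin (q + 1) → ℝ) × X)} (h : ∀ᵐ w ∂κ, w ∈ S) (j : ℕ) :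
    ∀ᵐ w ∂κ, w ∈ aeIter θ S j := by
  induction j with
  | zero => exact h
  | succ j ih =>
    rw [← hκ] at ih
    have h1 := ae_of_ae_map (measurable_stepFn hθ hψ).aemeasurable ih
    have h2 := Measure.ae_ae_of_ae_prod h1
    filter_upwards [h2] with w hw
    exact ae_of_ae_noise hf hfpos (ψ w) hw

lemma eq_zero_of_mutuallySingular {f : ℝ → ℝ} (hf : Measurable f) (hfpos : ∀ u, 0 < f u)
    [IsProbabilityMeasure (noiseM f)]
    (hθ : Measurable θ) (hψ : Measurable ψ)
    {κ κ' : Measure ((Fin (q + 1) → ℝ) × X)} [IsFiniteMeasure κ] [IsFiniteMeasure κ']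
    (hκ : Qop θ ψ (noiseM f) κ = κ) (hκ' : Qop θ ψ (noiseM f) κ' = κ')
    (hsnd : κ.map Prod.snd = κ'.map Prod.snd) (hs : κ ⟂ₘ κ') : κ' = 0 := by
  obtain ⟨S, hS, h1, h2⟩ := hs
  have hB := ae_aeIter hf hfpos hθ hψ hκ (S := Sᶜ) (by rw [ae_iff]; simpa using h1) (q + 1)
  have hA := ae_aeIter hf hfpos hθ hψ hκ' (S := S) (by rw [ae_iff]; exact h2) (q + 1)
  set T : Set X := {x | ((fun _ => 0 : Fin (q + 1) → ℝ), x) ∈ aeIter θ Sᶜ (q + 1)} with hT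
  have hTm : MeasurableSet T := by
    have : Measurable (fun x : X => ((fun _ => 0 : Fin (q + 1) → ℝ), x)) := by fun_prop
    exact this (measurableSet_aeIter hθ hS.compl _)
  have hmem : ∀ w, w ∈ aeIter θ Sᶜ (q + 1) ↔ w.2 ∈ T := by
    intro w
    constructor
    · exact aeIter_congr _ _ le_rfl _ _ rfl (fun i hi => by omega)
    · exact aeIter_congr _ _ le_rfl _ _ rfl (fun i hi => by omega)
  have hT1 : κ.map Prod.snd Tᶜ = 0 := by
    rw [Measure.map_apply measurable_snd hTm.compl]
    rw [ae_iff] at hB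
    refine measure_mono_null (fun w hw => ?_) hB
    intro hw'
    exact hw ((hmem w).1 hw')
  rw [hsnd, Measure.map_apply measurable_snd hTm.compl] at hT1
  have hB' : ∀ᵐ w ∂κ', w ∈ aeIter θ Sᶜ (q + 1) := by
    rw [ae_iff]
    refine measure_mono_null (fun w hw => ?_) hT1
    intro hw'
    exact hw ((hmem w).2 hw')
  have : ∀ᵐ w ∂κ', False := by
    filter_upwards [hA, hB'] with w h h'
    exact aeIter_disjoint S _ w h h'
  rw [← ae_eq_bot]
  exact eventually_false_iff_eq_bot.1 this

theorem Qop_invariant_unique {f : ℝ → ℝ} (hf : Measurable f) (hfpos : ∀ u, 0 < f u)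
    [IsProbabilityMeasure (noiseM f)]
    (hθ : Measurable θ) (hψ : Measurable ψ)
    {ν ν' : Measure ((Fin (q + 1) → ℝ) × X)} [IsFiniteMeasure ν] [IsFiniteMeasure ν']
    (hν : Qop θ ψ (noiseM f) ν = ν) (hν' : Qop θ ψ (noiseM f) ν' = ν')
    (hsnd : ν.map Prod.snd = ν'.map Prod.snd) : ν = ν' := by
  set l := ν ⊓ ν' with hl
  have hlν : l ≤ ν := inf_le_left
  have hlν' : l ≤ ν' := inf_le_right
  haveI : IsFiniteMeasure l := isFiniteMeasure_of_le ν hlν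
  have hlQ : Qop θ ψ (noiseM f) l = l := by
    have h1 : Qop θ ψ (noiseM f) l ≤ l := by
      refine le_inf ?_ ?_
      · exact (Qop_mono hθ hψ _ hlν).trans hν.le
      · exact (Qop_mono hθ hψ _ hlν').trans hν'.le
    exact Measure.eq_of_le_of_measure_univ_eq h1 (Qop_univ hθ hψ _ _)
  have key : ∀ {ρ : Measure ((Fin (q + 1) → ℝ) × X)} [IsFiniteMeasure ρ], l ≤ ρ →
      Qop θ ψ (noiseM f) ρ = ρ → (ρ - l) + l = ρ ∧ Qop θ ψ (noiseM f) (ρ - l) = ρ - l := by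
    intro ρ _ hle hQ
    have h0 : (ρ - l) + l = ρ := Measure.sub_add_cancel_of_le hle
    refine ⟨h0, ?_⟩
    have h1 := Qop_add hθ hψ (noiseM f) (ρ - l) l
    rw [h0, hQ, hlQ] at h1
    nth_rewrite 1 [← h0] at h1
    ext s hs
    have h2 := congrArg (fun m : Measure _ => m s) h1
    simp only [Measure.add_apply] at h2
    exact ((ENNReal.add_left_inj (measure_ne_top l s)).1 h2).symm
  obtain ⟨ha, ha'⟩ := key hlν hν
  obtain ⟨hb, hb'⟩ := key hlν' hν'
  have hs : (ν - l).map Prod.snd = (ν' - l).map Prod.snd := by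
    rw [← ha, ← hb, Measure.map_add _ _ measurable_snd, Measure.map_add _ _ measurable_snd] at hsnd
    ext s hs
    have h2 := congrArg (fun m : Measure _ => m s) hsnd
    simp only [Measure.add_apply] at h2
    exact (ENNReal.add_left_inj (measure_ne_top _ s)).1 h2
  have hd : Disjoint (ν - l) (ν' - l) := by
    rw [disjoint_iff]
    set k := (ν - l) ⊓ (ν' - l) with hk
    have h1 : k + l ≤ l := by
      refine le_inf ?_ ?_
      · calc k + l ≤ (ν - l) + l := by gcongr; exact inf_le_left
          _ = ν := ha
      · calc k + l ≤ (ν' - l) + l := by gcongr; exact inf_le_right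
          _ = ν' := hb
    have h2 : k Set.univ + l Set.univ ≤ l Set.univ := by
      have := h1 Set.univ
      simpa using this
    have h3 : k Set.univ = 0 := by
      by_contra h
      exact absurd h2 (not_le.2 (by
        rw [add_comm (k Set.univ)]
        exact ENNReal.lt_add_right (measure_ne_top _ _) h))
    exact Measure.measure_univ_eq_zero.1 h3
  have hms := Measure.mutuallySingular_of_disjoint hd
  have e1 := eq_zero_of_mutuallySingular hf hfpos hθ hψ ha' hb' hs hms
  have e2 := eq_zero_of_mutuallySingular hf hfpos hθ hψ hb' ha' hs.symm hms.symm
  rw [e1] at hb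
  rw [e2] at ha
  rw [← ha, ← hb]

end uniq

/-! ### Existence of an invariant measure from tightness -/

section exist

set_option linter.unusedSectionVars false
set_option linter.style.haveILetI false

variable {q : ℕ} {X : Type*} [MeasurableSpace X] {θ : X → X} {ψ : (Fin (q + 1) → ℝ) × X → ℝ}

lemma exists_trunc {f : ℝ → ℝ} (hf : Measurable f) (hfdens : ∫⁻ u, ENNReal.ofReal (f u) = 1)
    {ε : ℝ≥0∞} (hε : 0 < ε) :
    ∃ n : ℕ, ∫⁻ u, (ENNReal.ofReal (f u) - n) ≤ ε := by
  have h : Tendsto (fun n : ℕ => ∫⁻ u, (ENNReal.ofReal (f u) - n)) atTop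
      (nhds (∫⁻ _u : ℝ, 0)) := by
    refine tendsto_lintegral_of_dominated_convergence (fun u => ENNReal.ofReal (f u))
      (fun n => by fun_prop) (fun n => ae_of_all _ fun u => tsub_le_self) (by simp [hfdens])
      (ae_of_all _ fun u => ?_)
    obtain ⟨N, hN⟩ := ENNReal.exists_nat_gt (ENNReal.ofReal_ne_top (r := f u))
    refine tendsto_const_nhds.congr' ?_
    filter_upwards [eventually_ge_atTop N] with n hn
    refine (tsub_eq_zero_of_le ?_).symm
    exact hN.le.trans (by exact_mod_cast hn)
  rw [lintegral_zero] at h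
  obtain ⟨n, hn⟩ := ((tendsto_order.1 h).2 ε hε).exists
  exact ⟨n, hn.le⟩

lemma noise_bound {f : ℝ → ℝ} (hf : Measurable f) {C : ℕ} {ε : ℝ≥0∞}
    (hC : ∫⁻ u, (ENNReal.ofReal (f u) - C) ≤ ε) {k : ℝ → ℝ≥0∞} (hk : Measurable k)
    (hk1 : ∀ v, k v ≤ 1) (c R : ℝ) :
    ∫⁻ e, k (c + e) ∂(noiseM f) ≤ C * (∫⁻ v in Set.Icc (-R) R, k v) + ε +
      ∫⁻ e, ({v : ℝ | R < |v|}).indicator 1 (c + e) ∂(noiseM f) := by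
  have hS : MeasurableSet {v : ℝ | R < |v|} := measurableSet_lt (by fun_prop) (by fun_prop)
  have h1 : ∀ v, k v ≤ (Set.Icc (-R) R).indicator k v + ({v : ℝ | R < |v|}).indicator 1 v := by
    intro v
    by_cases h : v ∈ Set.Icc (-R) R
    · simp [h]
    · have : R < |v| := by
        by_contra h'
        exact h (abs_le.1 (not_lt.1 h'))
      simp [h, this, hk1]
  have hmi : Measurable ((Set.Icc (-R) R).indicator k) := hk.indicator measurableSet_Icc
  calc ∫⁻ e, k (c + e) ∂(noiseM f)
      ≤ ∫⁻ e, ((Set.Icc (-R) R).indicator k (c + e) +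
          ({v : ℝ | R < |v|}).indicator 1 (c + e)) ∂(noiseM f) := lintegral_mono fun e => h1 _
    _ = ∫⁻ e, (Set.Icc (-R) R).indicator k (c + e) ∂(noiseM f) +
        ∫⁻ e, ({v : ℝ | R < |v|}).indicator 1 (c + e) ∂(noiseM f) := by
        rw [lintegral_add_left (by fun_prop)]
    _ ≤ _ := by
        gcongr
        unfold noiseM
        rw [lintegral_withDensity_eq_lintegral_mul _ (by fun_prop) (by fun_prop)]
        calc ∫⁻ e, ((fun u => ENNReal.ofReal (f u)) *
                fun e => (Set.Icc (-R) R).indicator k (c + e)) e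
            ≤ ∫⁻ e, ((C : ℝ≥0∞) * (Set.Icc (-R) R).indicator k (c + e) +
                (ENNReal.ofReal (f e) - C)) := by
              refine lintegral_mono fun e => ?_
              simp only [Pi.mul_apply]
              have h2 : ENNReal.ofReal (f e) ≤ C + (ENNReal.ofReal (f e) - C) := le_add_tsub
              have h3 : (Set.Icc (-R) R).indicator k (c + e) ≤ 1 :=
                (Set.indicator_le_self _ _ _).trans (hk1 _)
              calc _ ≤ (C + (ENNReal.ofReal (f e) - C)) * (Set.Icc (-R) R).indicator k (c + e) := by
                    gcongr
                _ = C * (Set.Icc (-R) R).indicator k (c + e) +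
                    (ENNReal.ofReal (f e) - C) * (Set.Icc (-R) R).indicator k (c + e) := by ring
                _ ≤ C * (Set.Icc (-R) R).indicator k (c + e) +
                    (ENNReal.ofReal (f e) - C) * 1 := by gcongr
                _ = _ := by rw [mul_one]
          _ = C * (∫⁻ e, (Set.Icc (-R) R).indicator k (c + e)) +
                ∫⁻ e, (ENNReal.ofReal (f e) - C) := by
              rw [lintegral_add_left (by fun_prop), lintegral_const_mul _ (by fun_prop)]
          _ ≤ _ := by
              rw [lintegral_add_left_eq_self (fun v => (Set.Icc (-R) R).indicator k v) c,
                lintegral_indicator measurableSet_Icc]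
              gcongr

lemma isProbabilityMeasure_Qop_iter {γ : Measure ℝ} [IsProbabilityMeasure γ] (hθ : Measurable θ)
    (hψ : Measurable ψ) (ν₀ : Measure ((Fin (q + 1) → ℝ) × X)) [IsProbabilityMeasure ν₀] (n : ℕ) :
    IsProbabilityMeasure ((Qop θ ψ γ)^[n] ν₀) := by
  induction n with
  | zero => simpa
  | succ n ih =>
    rw [Function.iterate_succ_apply']
    exact ⟨by rw [Qop_univ hθ hψ, measure_univ]⟩

lemma Qop_snd {γ : Measure ℝ} [IsProbabilityMeasure γ] (hθ : Measurable θ)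
    (hψ : Measurable ψ) (ν : Measure ((Fin (q + 1) → ℝ) × X)) [IsFiniteMeasure ν] {m : Measure X}
    (hm : m.map θ = m) (h : ν.map Prod.snd = m) : (Qop θ ψ γ ν).map Prod.snd = m := by
  unfold Qop
  rw [Measure.map_map measurable_snd (measurable_stepFn hθ hψ)]
  have : (Prod.snd ∘ fun we : ((Fin (q + 1) → ℝ) × X) × ℝ => stepFn θ ψ we.1 we.2)
      = θ ∘ Prod.snd ∘ Prod.fst := rfl
  rw [this, ← Measure.map_map hθ (by fun_prop), ← Measure.map_map measurable_snd measurable_fst]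
  have h2 : (ν.prod γ).map Prod.fst = ν := by
    rw [Measure.map_fst_prod]; simp
  rw [h2, h, hm]

lemma Qop_iter_snd {γ : Measure ℝ} [IsProbabilityMeasure γ] (hθ : Measurable θ)
    (hψ : Measurable ψ) (ν₀ : Measure ((Fin (q + 1) → ℝ) × X)) [IsProbabilityMeasure ν₀]
    {m : Measure X} (hm : m.map θ = m) (h : ν₀.map Prod.snd = m) (n : ℕ) :
    ((Qop θ ψ γ)^[n] ν₀).map Prod.snd = m := by
  induction n with
  | zero => simpa
  | succ n ih =>
    rw [Function.iterate_succ_apply']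
    haveI := isProbabilityMeasure_Qop_iter (γ := γ) hθ hψ ν₀ n
    exact Qop_snd hθ hψ _ hm ih

lemma equi_small {f : ℝ → ℝ} (hf : Measurable f) (hfdens : ∫⁻ u, ENNReal.ofReal (f u) = 1)
    [IsProbabilityMeasure (noiseM f)] (hθ : Measurable θ) (hψ : Measurable ψ)
    (ν₀ : Measure ((Fin (q + 1) → ℝ) × X)) [IsProbabilityMeasure ν₀]
    {m : Measure X} (hm : m.map θ = m) (h0 : ν₀.map Prod.snd = m)
    (htight : ∀ ε : ℝ≥0∞, 0 < ε → ∃ R : ℝ, ∀ n : ℕ,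
      ((Qop θ ψ (noiseM f))^[n] ν₀) {w | R < |w.1 0|} ≤ ε) (j : ℕ) :
    ∀ g : ℕ → (Fin (q + 1) → ℝ) × X → ℝ≥0∞, (∀ k, Measurable (g k)) → (∀ k w, g k w ≤ 1) →
      (∀ w, Tendsto (fun k => g k w) atTop (nhds 0)) →
      (∀ k w w', w.2 = w'.2 → (∀ i : Fin (q + 1), (i : ℕ) < j → w.1 i = w'.1 i) →
        g k w = g k w') →
      ∀ ε : ℝ≥0∞, 0 < ε → ∀ᶠ k in atTop, ∀ n, j ≤ n →
        ∫⁻ w, g k w ∂((Qop θ ψ (noiseM f))^[n] ν₀) ≤ ε := by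
  induction j with
  | zero =>
    intro g hgm hg1 hg0 hdep ε hε
    haveI : IsProbabilityMeasure m := by
      rw [← h0]; exact Measure.isProbabilityMeasure_map measurable_snd.aemeasurable
    have hmk : Measurable (fun x : X => ((fun _ => 0 : Fin (q + 1) → ℝ), x)) := by fun_prop
    have h : Tendsto (fun k : ℕ => ∫⁻ x, g k ((fun _ => 0 : Fin (q + 1) → ℝ), x) ∂m) atTop
        (nhds (∫⁻ _x : X, 0 ∂m)) := by
      refine tendsto_lintegral_of_dominated_convergence (fun _ => 1)
        (fun n => (hgm n).comp hmk) (fun n => ae_of_all _ fun u => hg1 _ _) (by simp)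
        (ae_of_all _ fun u => hg0 _)
    rw [lintegral_zero] at h
    filter_upwards [(tendsto_order.1 h).2 ε hε] with k hk n _
    refine le_trans (le_of_eq ?_) hk.le
    rw [← Qop_iter_snd (γ := noiseM f) hθ hψ ν₀ hm h0 n,
      lintegral_map (f := fun x => g k ((fun _ => 0 : Fin (q + 1) → ℝ), x))
        ((hgm k).comp hmk) measurable_snd]
    exact lintegral_congr fun w => hdep k _ _ rfl (fun i hi => by omega)
  | succ j ih =>
    intro g hgm hg1 hg0 hdep ε hε
    have hε3 : 0 < ε / 3 := ENNReal.div_pos hε.ne' (by norm_num)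
    obtain ⟨R, hR⟩ := htight (ε / 3) hε3
    obtain ⟨C, hC⟩ := exists_trunc hf hfdens hε3
    set V : ℝ≥0∞ := volume (Set.Icc (-R) R) with hV
    have hVt : V ≠ ∞ := by rw [hV]; exact isCompact_Icc.measure_lt_top.ne
    have hV1 : V + 1 ≠ ∞ := by simp [hVt]
    set D : ℝ≥0∞ := C * (V + 1) with hD
    have hDt : D ≠ ∞ := ENNReal.mul_ne_top (by simp) hV1
    set G : ℕ → (Fin (q + 1) → ℝ) × X → ℝ≥0∞ := fun k w =>
      (V + 1)⁻¹ * ∫⁻ v in Set.Icc (-R) R, g k (putFn θ w v) with hG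
    have hgp : ∀ k, Measurable (fun wv : ((Fin (q + 1) → ℝ) × X) × ℝ => g k (putFn θ wv.1 wv.2)) :=
      fun k => (hgm k).comp (measurable_putFn hθ)
    have hGm : ∀ k, Measurable (G k) := fun k =>
      (Measurable.lintegral_prod_right' (hgp k)).const_mul _
    have hG1 : ∀ k w, G k w ≤ 1 := by
      intro k w
      calc G k w ≤ (V + 1)⁻¹ * ∫⁻ v in Set.Icc (-R) R, 1 := by
            simp only [hG]; gcongr; exact hg1 _ _
        _ = (V + 1)⁻¹ * V := by simp [hV]
        _ ≤ (V + 1)⁻¹ * (V + 1) := by gcongr; simp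
        _ = 1 := ENNReal.inv_mul_cancel (by simp) hV1
    have hG0 : ∀ w, Tendsto (fun k => G k w) atTop (nhds 0) := by
      intro w
      have h : Tendsto (fun k : ℕ => ∫⁻ v in Set.Icc (-R) R, g k (putFn θ w v)) atTop
          (nhds (∫⁻ _v in Set.Icc (-R) R, 0)) := by
        refine tendsto_lintegral_of_dominated_convergence (fun _ => 1)
          (fun n => (hgp n).comp measurable_prodMk_left)
          (fun n => ae_of_all _ fun u => hg1 _ _) (by simp)
          (ae_of_all _ fun u => hg0 _)
      rw [lintegral_zero] at h
      have := ENNReal.Tendsto.const_mul (a := (V + 1)⁻¹) h (Or.inr (by simp))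
      simpa using this
    have hGd : ∀ k w w', w.2 = w'.2 → (∀ i : Fin (q + 1), (i : ℕ) < j → w.1 i = w'.1 i) →
        G k w = G k w' := by
      intro k w w' h2 h1
      simp only [hG]
      congr 1
      refine lintegral_congr fun v => ?_
      refine hdep k _ _ (by simp [putFn, h2]) (fun i => ?_)
      refine Fin.cases (fun _ => rfl) (fun l hl => ?_) i
      rw [putFn_succ, putFn_succ]
      exact h1 _ (by simp at hl ⊢; omega)
    have hε' : 0 < ε / 3 / (D + 1) := ENNReal.div_pos hε3.ne' (by simp [hDt])
    filter_upwards [ih G hGm hG1 hG0 hGd _ hε'] with k hk n hn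
    obtain ⟨n, rfl⟩ : ∃ n', n = n' + 1 := ⟨n - 1, by omega⟩
    haveI := isProbabilityMeasure_Qop_iter (γ := noiseM f) hθ hψ ν₀ n
    have hRn := hR (n + 1)
    rw [Function.iterate_succ_apply'] at hRn ⊢
    have hS : MeasurableSet {w : (Fin (q + 1) → ℝ) × X | R < |w.1 0|} :=
      measurableSet_lt (by fun_prop) (by fun_prop)
    rw [← lintegral_indicator_one hS, lintegral_Qop hθ hψ _ _ (measurable_one.indicator hS)] at hRn
    rw [lintegral_Qop hθ hψ _ _ (hgm k)]
    set P := (Qop θ ψ (noiseM f))^[n] ν₀ with hP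
    calc ∫⁻ w, ∫⁻ e, g k (stepFn θ ψ w e) ∂(noiseM f) ∂P
        ≤ ∫⁻ w, (D * G k w + ε / 3 + ∫⁻ e, ({w : (Fin (q + 1) → ℝ) × X | R < |w.1 0|}).indicator 1
            (stepFn θ ψ w e) ∂(noiseM f)) ∂P := by
          refine lintegral_mono fun w => ?_
          refine (noise_bound hf hC (k := fun v => g k (putFn θ w v))
            ((hgp k).comp measurable_prodMk_left) (fun v => hg1 _ _) (ψ w) R).trans
            (le_of_eq ?_)
          congr 1
          congr 1
          simp only [hG, hD]
          rw [mul_assoc, ← mul_assoc (V + 1), ENNReal.mul_inv_cancel (by simp) hV1, one_mul]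
      _ = D * ∫⁻ w, G k w ∂P + ε / 3 + ∫⁻ w, ∫⁻ e,
            ({w : (Fin (q + 1) → ℝ) × X | R < |w.1 0|}).indicator 1
            (stepFn θ ψ w e) ∂(noiseM f) ∂P := by
          rw [lintegral_add_left (((hGm k).const_mul _).add_const _),
            lintegral_add_left ((hGm k).const_mul _), lintegral_const_mul _ (hGm k)]
          simp
      _ ≤ ε / 3 + ε / 3 + ε / 3 := by
          gcongr
          calc D * ∫⁻ w, G k w ∂P ≤ (D + 1) * (ε / 3 / (D + 1)) := by
                gcongr
                · simp
                · exact hk n (by omega)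
            _ ≤ ε / 3 := ENNReal.mul_div_le
      _ = ε := ENNReal.add_thirds ε

end exist

/-! ### Setwise limits along an ultrafilter -/

section ultra

set_option linter.unusedSectionVars false
set_option linter.style.haveILetI false

lemma exists_setwise_limit {W : Type*} [MeasurableSpace W] (P : ℕ → Measure W)
    [∀ n, IsProbabilityMeasure (P n)] (U : Ultrafilter ℕ)
    (hequi : ∀ B : ℕ → Set W, (∀ k, MeasurableSet (B k)) →
      (∀ w, ∀ᶠ k in atTop, w ∉ B k) → ∀ ε : ℝ≥0∞, 0 < ε → ∀ᶠ k in atTop, ∀ n, P n (B k) ≤ ε) :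
    ∃ ν : Measure W, ∀ B, MeasurableSet B → Tendsto (fun n => P n B) U (nhds (ν B)) := by
  have hex : ∀ B : Set W, ∃ l, Tendsto (fun n => P n B) U (nhds l) := by
    intro B
    obtain ⟨l, -, hl⟩ := (isCompact_univ (X := ℝ≥0∞)).ultrafilter_le_nhds
      (U.map fun n => P n B) (by simp)
    exact ⟨l, hl⟩
  choose L hL using hex
  have hadd : ∀ A B : Set W, MeasurableSet B → Disjoint A B → L (A ∪ B) = L A + L B := by
    intro A B hB hd
    refine tendsto_nhds_unique (hL (A ∪ B)) ?_
    have := (hL A).add (hL B)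
    refine this.congr fun n => ?_
    rw [measure_union hd hB]
  have h0 : L ∅ = 0 := tendsto_nhds_unique (hL ∅) (by simp)
  refine ⟨Measure.ofMeasurable (fun B _ => L B) h0 ?_, ?_⟩
  · intro F hF hd
    set T : ℕ → Set W := fun k => ⋃ i, F (k + i) with hT
    have hTm : ∀ k, MeasurableSet (T k) := fun k => MeasurableSet.iUnion fun i => hF _
    have hTs : ∀ k, T k = F k ∪ T (k + 1) := by
      intro k
      ext w
      simp only [hT, Set.mem_iUnion, Set.mem_union]
      constructor
      · rintro ⟨i, hi⟩
        rcases i with _ | i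
        · left; simpa using hi
        · right; exact ⟨i, by convert hi using 2; omega⟩
      · rintro (h | ⟨i, hi⟩)
        · exact ⟨0, by simpa using h⟩
        · exact ⟨i + 1, by convert hi using 2; omega⟩
    have hTd : ∀ k, Disjoint (F k) (T (k + 1)) := by
      intro k
      refine Set.disjoint_iUnion_right.2 fun i => hd (by omega)
    have hsum : ∀ k, L (T 0) = ∑ i ∈ Finset.range k, L (F i) + L (T k) := by
      intro k
      induction k with
      | zero => simp
      | succ k ih =>
        rw [ih, Finset.sum_range_succ, hTs k, hadd _ _ (hTm _) (hTd k), add_assoc]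
    have hT0 : (⋃ i, F i) = T 0 := by simp [hT]
    have hlim : Tendsto (fun k => L (T k)) atTop (nhds 0) := by
      rw [ENNReal.tendsto_nhds_zero]
      intro ε hε
      have := hequi T hTm (fun w => ?_) ε hε
      · filter_upwards [this] with k hk
        exact le_of_tendsto' (hL (T k)) hk
      · by_cases h : ∃ i, w ∈ F i
        · obtain ⟨i, hi⟩ := h
          filter_upwards [eventually_gt_atTop i] with k hk hw
          obtain ⟨j, hj⟩ := Set.mem_iUnion.1 hw
          exact Set.disjoint_left.1 (hd (show i ≠ k + j by omega)) hi hj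
        · refine Eventually.of_forall fun k hw => ?_
          obtain ⟨j, hj⟩ := Set.mem_iUnion.1 hw
          exact h ⟨_, hj⟩
    change L (⋃ i, F i) = ∑' i, L (F i)
    rw [hT0]
    have h1 := (ENNReal.tendsto_nat_tsum (fun i => L (F i))).add hlim
    rw [add_zero] at h1
    refine tendsto_nhds_unique (tendsto_const_nhds.congr fun k => hsum k) h1
  · intro B hB
    rw [Measure.ofMeasurable_apply B hB]
    exact hL B

lemma lintegral_le_of_setwise {W : Type*} [MeasurableSpace W] (P : ℕ → Measure W)
    (U : Ultrafilter ℕ) (ν : Measure W)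
    (h : ∀ B, MeasurableSet B → Tendsto (fun n => P n B) U (nhds (ν B))) (g : W → ℝ≥0∞)
    {l : ℝ≥0∞} (hl : Tendsto (fun n => ∫⁻ w, g w ∂(P n)) U (nhds l)) : ∫⁻ w, g w ∂ν ≤ l := by
  rw [lintegral_eq_nnreal]
  refine iSup₂_le fun φ hφ => ?_
  have h1 : Tendsto (fun n => (φ.map ((↑) : NNReal → ℝ≥0∞)).lintegral (P n)) U
      (nhds ((φ.map ((↑) : NNReal → ℝ≥0∞)).lintegral ν)) := by
    simp only [SimpleFunc.map_lintegral]
    refine tendsto_finsetSum _ fun x _ => ?_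
    exact ENNReal.Tendsto.const_mul (h _ (φ.measurableSet_preimage _)) (Or.inr (by simp))
  refine le_of_tendsto_of_tendsto' h1 hl fun n => ?_
  rw [← SimpleFunc.lintegral_eq_lintegral]
  exact lintegral_mono fun w => hφ w

variable {q : ℕ} {X : Type*} [MeasurableSpace X] {θ : X → X} {ψ : (Fin (q + 1) → ℝ) × X → ℝ}

theorem exists_Qop_invariant {f : ℝ → ℝ} (hf : Measurable f)
    (hfdens : ∫⁻ u, ENNReal.ofReal (f u) = 1)
    [IsProbabilityMeasure (noiseM f)] (hθ : Measurable θ) (hψ : Measurable ψ)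
    (ν₀ : Measure ((Fin (q + 1) → ℝ) × X)) [IsProbabilityMeasure ν₀]
    {m : Measure X} (hm : m.map θ = m) (h0 : ν₀.map Prod.snd = m)
    (htight : ∀ ε : ℝ≥0∞, 0 < ε → ∃ R : ℝ, ∀ n : ℕ,
      ((Qop θ ψ (noiseM f))^[n] ν₀) {w | R < |w.1 0|} ≤ ε) :
    ∃ ν : Measure ((Fin (q + 1) → ℝ) × X), IsProbabilityMeasure ν ∧
      Qop θ ψ (noiseM f) ν = ν ∧ ν.map Prod.snd = m := by
  set N : ℕ → Measure ((Fin (q + 1) → ℝ) × X) := fun n => (Qop θ ψ (noiseM f))^[n] ν₀ with hN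
  haveI hNp : ∀ n, IsProbabilityMeasure (N n) := fun n => isProbabilityMeasure_Qop_iter hθ hψ ν₀ n
  have hNs : ∀ n, N (n + 1) = Qop θ ψ (noiseM f) (N n) := fun n =>
    Function.iterate_succ_apply' _ _ _
  set P : ℕ → Measure ((Fin (q + 1) → ℝ) × X) := fun K =>
    ((K + 1 : ℕ) : ℝ≥0∞)⁻¹ • ∑ n ∈ Finset.range (K + 1), N (n + (q + 1)) with hP
  have hK : ∀ K : ℕ, ((K + 1 : ℕ) : ℝ≥0∞) ≠ 0 := fun K => by simp
  have hK' : ∀ K : ℕ, ((K + 1 : ℕ) : ℝ≥0∞) ≠ ∞ := fun K => ENNReal.natCast_ne_top _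
  have hPint : ∀ K (g : (Fin (q + 1) → ℝ) × X → ℝ≥0∞), ∫⁻ w, g w ∂(P K) =
      ((K + 1 : ℕ) : ℝ≥0∞)⁻¹ * ∑ n ∈ Finset.range (K + 1), ∫⁻ w, g w ∂(N (n + (q + 1))) := by
    intro K g
    simp only [hP]
    rw [lintegral_smul_measure, lintegral_finsetSum_measure, smul_eq_mul]
  have hPset : ∀ K B, MeasurableSet B → P K B =
      ((K + 1 : ℕ) : ℝ≥0∞)⁻¹ * ∑ n ∈ Finset.range (K + 1), N (n + (q + 1)) B := by
    intro K B hB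
    simp [hP]
  have hPle : ∀ K B (ε : ℝ≥0∞), MeasurableSet B → (∀ n, N (n + (q + 1)) B ≤ ε) → P K B ≤ ε := by
    intro K B ε hB h
    rw [hPset K B hB]
    calc _ ≤ ((K + 1 : ℕ) : ℝ≥0∞)⁻¹ * ∑ n ∈ Finset.range (K + 1), ε := by
          gcongr; exact h _
      _ = ε := by
          rw [Finset.sum_const, Finset.card_range, nsmul_eq_mul, ← mul_assoc,
            ENNReal.inv_mul_cancel (hK K) (hK' K), one_mul]
  haveI : ∀ K, IsProbabilityMeasure (P K) := by
    intro K
    refine ⟨?_⟩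
    rw [hPset K _ MeasurableSet.univ]
    simp only [measure_univ, Finset.sum_const, Finset.card_range, nsmul_eq_mul, mul_one]
    exact ENNReal.inv_mul_cancel (hK K) (hK' K)
  set U : Ultrafilter ℕ := hyperfilter ℕ with hU
  have hUle : (U : Filter ℕ) ≤ atTop := Nat.hyperfilter_le_atTop
  obtain ⟨ν, hν⟩ := exists_setwise_limit P U (by
    intro B hB hB0 ε hε
    have := equi_small hf hfdens hθ hψ ν₀ hm h0 htight (q + 1)
      (fun k => (B k).indicator 1) (fun k => measurable_one.indicator (hB k))
      (fun k w => Set.indicator_le_self' (by simp) w |>.trans (by simp))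
      (fun w => by
        refine tendsto_const_nhds.congr' ?_
        filter_upwards [hB0 w] with k hk
        simp [hk])
      (fun k w w' h2 h1 => by
        have : w = w' := Prod.ext (funext fun i => h1 i (by omega)) h2
        rw [this]) ε hε
    filter_upwards [this] with k hk K
    refine hPle K _ _ (hB k) fun n => ?_
    have := hk (n + (q + 1)) (by omega)
    rwa [lintegral_indicator_one (hB k)] at this)
  have hνp : IsProbabilityMeasure ν := by
    refine ⟨tendsto_nhds_unique (hν _ MeasurableSet.univ) ?_⟩
    simp
  refine ⟨ν, hνp, ?_, ?_⟩
  · have hle : Qop θ ψ (noiseM f) ν ≤ ν := by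
      refine Measure.le_iff.2 fun B hB => ?_
      have hgm : Measurable (B.indicator (1 : (Fin (q + 1) → ℝ) × X → ℝ≥0∞)) := measurable_one.indicator hB
      rw [← lintegral_indicator_one hB, lintegral_Qop hθ hψ _ _ hgm]
      set g : (Fin (q + 1) → ℝ) × X → ℝ≥0∞ := fun w =>
        ∫⁻ e, B.indicator 1 (stepFn θ ψ w e) ∂(noiseM f) with hg
      obtain ⟨l, -, hl⟩ := (isCompact_univ (X := ℝ≥0∞)).ultrafilter_le_nhds
        (U.map fun n => ∫⁻ w, g w ∂(P n)) (by simp)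
      refine (lintegral_le_of_setwise P U ν hν g hl).trans ?_
      have h1 : Tendsto (fun K : ℕ => ((K + 1 : ℕ) : ℝ≥0∞)⁻¹) atTop (nhds 0) :=
        (tendsto_add_atTop_iff_nat 1).2 ENNReal.tendsto_inv_nat_nhds_zero
      have h2 := (hν B hB).add (h1.mono_left hUle)
      rw [add_zero] at h2
      refine le_of_tendsto_of_tendsto' hl h2 fun K => ?_
      rw [hPint, hPset K B hB]
      have h3 : ∀ n, ∫⁻ w, g w ∂(N (n + (q + 1))) = N (n + 1 + (q + 1)) B := by
        intro n
        rw [show n + 1 + (q + 1) = (n + (q + 1)) + 1 by omega, hNs,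
          ← lintegral_indicator_one (μ := Qop θ ψ (noiseM f) (N (n + (q + 1)))) hB,
          lintegral_Qop hθ hψ _ _ hgm]
      simp only [h3]
      have h4 : ∑ n ∈ Finset.range (K + 1), N (n + 1 + (q + 1)) B ≤
          ∑ n ∈ Finset.range (K + 1), N (n + (q + 1)) B + 1 := by
        rw [Finset.sum_range_succ (fun n => N (n + 1 + (q + 1)) B), 
          Finset.sum_range_succ' (fun n => N (n + (q + 1)) B)]
        gcongr
        · simp
        · exact prob_le_one
      calc _ ≤ ((K + 1 : ℕ) : ℝ≥0∞)⁻¹ *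
            (∑ n ∈ Finset.range (K + 1), N (n + (q + 1)) B + 1) := by gcongr
        _ = _ := by rw [mul_add, mul_one]
    exact Measure.eq_of_le_of_measure_univ_eq hle (Qop_univ hθ hψ _ _)
  · ext B hB
    rw [Measure.map_apply measurable_snd hB]
    refine tendsto_nhds_unique (hν _ (measurable_snd hB)) ?_
    refine tendsto_const_nhds.congr fun K => ?_
    rw [hPset K _ (measurable_snd hB)]
    have : ∀ n, N n (Prod.snd ⁻¹' B) = m B := by
      intro n
      rw [← Measure.map_apply measurable_snd hB, Qop_iter_snd hθ hψ ν₀ hm h0 n]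
    simp only [this, Finset.sum_const, Finset.card_range, nsmul_eq_mul]
    rw [← mul_assoc, ENNReal.inv_mul_cancel (hK K) (hK' K), one_mul]

end ultra

/-! ### A maximal ergodic lemma -/

section garsia

/-- Running maxima of Birkhoff sums. -/
def runMax {Ω : Type*} (T : Ω → Ω) (h : Ω → ℝ) : ℕ → Ω → ℝ
  | 0, _ => 0
  | N + 1, x => max 0 (h x + runMax T h N (T x))

variable {Ω : Type*} [MeasurableSpace Ω] {T : Ω → Ω} {h : Ω → ℝ}

lemma runMax_nonneg (N : ℕ) (x : Ω) : 0 ≤ runMax T h N x := by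
  cases N with
  | zero => exact le_rfl
  | succ N => exact le_max_left _ _

lemma runMax_mono_succ (N : ℕ) : ∀ x : Ω, runMax T h N x ≤ runMax T h (N + 1) x := by
  induction N with
  | zero => intro x; exact le_max_left _ _
  | succ N ih =>
    intro x
    simp only [runMax]
    gcongr
    exact ih (T x)

lemma runMax_mono (x : Ω) : Monotone (fun N => runMax T h N x) :=
  monotone_nat_of_le_succ fun N => runMax_mono_succ N x

lemma birkhoffSum_le_runMax (N : ℕ) : ∀ x : Ω, birkhoffSum T h N x ≤ runMax T h N x := by
  induction N with
  | zero => intro x; simp [runMax]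
  | succ N ih =>
    intro x
    rw [birkhoffSum_succ']
    refine le_max_of_le_right ?_
    gcongr
    exact ih (T x)

lemma measurable_runMax (hT : Measurable T) (hh : Measurable h) (N : ℕ) :
    Measurable (runMax T h N) := by
  induction N with
  | zero => exact measurable_const
  | succ N ih =>
    exact measurable_const.max (hh.add (ih.comp hT))

lemma integrable_runMax {m : Measure Ω} [IsFiniteMeasure m] (hT : MeasurePreserving T m m)
    (hi : Integrable h m) (N : ℕ) :
    Integrable (runMax T h N) m := by
  induction N with
  | zero => exact integrable_const 0
  | succ N ih =>
    exact (integrable_const (0 : ℝ)).sup (hi.add (hT.integrable_comp_of_integrable ih))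

theorem runMax_bounded {m : Measure Ω} [IsProbabilityMeasure m] (hT : Ergodic T m)
    (hh : Measurable h) (hi : Integrable h m) (hneg : ∫ x, h x ∂m < 0) :
    ∀ᵐ x ∂m, ∃ K : ℕ, ∀ N, runMax T h N x ≤ K := by
  have hTm := hT.toMeasurePreserving.measurable
  set S : Set Ω := {x | ∀ K : ℕ, ∃ N, (K : ℝ) < runMax T h N x} with hS
  have hSm : MeasurableSet S := by
    have : S = ⋂ K : ℕ, ⋃ N : ℕ, {x | (K : ℝ) < runMax T h N x} := by ext; simp [hS]
    rw [this]
    exact MeasurableSet.iInter fun K => MeasurableSet.iUnion fun N =>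
      measurableSet_lt measurable_const (measurable_runMax hTm hh N)
  have hinv : T ⁻¹' S = S := by
    ext x
    constructor
    · intro hx K
      obtain ⟨K', hK'⟩ := exists_nat_gt ((K : ℝ) - h x)
      obtain ⟨N, hN⟩ := hx K'
      refine ⟨N + 1, lt_max_of_lt_right ?_⟩
      linarith
    · intro hx K
      obtain ⟨K', hK'⟩ := exists_nat_gt ((K : ℝ) + |h x|)
      obtain ⟨N, hN⟩ := hx K'
      refine ⟨N, ?_⟩
      have h1 := hN.trans_le (runMax_mono_succ N x)
      have h2 := runMax_nonneg (T := T) (h := h) N (T x)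
      have h3 := le_abs_self (h x)
      have h4 : runMax T h (N + 1) x ≤ |h x| + runMax T h N (T x) :=
        max_le (by positivity) (by linarith)
      linarith
  rcases hT.toPreErgodic.prob_eq_zero_or_one hSm hinv with h0 | h1
  · have : ∀ᵐ x ∂m, x ∉ S := measure_eq_zero_iff_ae_notMem.1 h0
    filter_upwards [this] with x hx
    simpa [hS] using hx
  · exfalso
    have hae : ∀ᵐ x ∂m, x ∈ S := (mem_ae_iff_prob_eq_one hSm).2 h1
    set D : ℕ → Ω → ℝ := fun N x => runMax T h (N + 1) x - runMax T h N (T x) with hD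
    have hintD : ∀ N, 0 ≤ ∫ x, D N x ∂m := by
      intro N
      have i1 := integrable_runMax hT.toMeasurePreserving hi N
      have i2 := integrable_runMax hT.toMeasurePreserving hi (N + 1)
      have i3 := hT.toMeasurePreserving.integrable_comp_of_integrable i1
      have e1 : ∫ x, D N x ∂m = ∫ x, runMax T h (N + 1) x ∂m - ∫ x, runMax T h N (T x) ∂m :=
        integral_sub i2 i3
      have e2 : ∫ x, runMax T h N (T x) ∂m = ∫ x, runMax T h N x ∂m := by
        rw [← integral_map hTm.aemeasurable, hT.toMeasurePreserving.map_eq]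
        rw [hT.toMeasurePreserving.map_eq]
        exact i1.aestronglyMeasurable
      rw [e1, e2, sub_nonneg]
      exact integral_mono i1 i2 fun x => runMax_mono_succ N x
    have hlim : Tendsto (fun N => ∫ x, D N x ∂m) atTop (nhds (∫ x, h x ∂m)) := by
      refine tendsto_integral_of_dominated_convergence (fun x => |h x|) (fun N => ?_) hi.abs
        (fun N => ae_of_all _ fun x => ?_) ?_
      · exact ((measurable_runMax hTm hh _).sub
          ((measurable_runMax hTm hh _).comp hTm)).aestronglyMeasurable
      · have h2 := runMax_nonneg (T := T) (h := h) N (T x)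
        simp only [hD, runMax, Real.norm_eq_abs]
        rcases le_total 0 (h x + runMax T h N (T x)) with h3 | h3
        · rw [max_eq_right h3]; simp
        · rw [max_eq_left h3, zero_sub, abs_neg, abs_of_nonneg h2, abs_of_nonpos (by linarith)]
          linarith
      · filter_upwards [hae] with x hx
        have hx' : T x ∈ S := by rw [← hinv] at hx; exact hx
        obtain ⟨K, hK⟩ := exists_nat_gt (-h x)
        obtain ⟨N, hN⟩ := hx' K
        refine tendsto_const_nhds.congr' ?_
        filter_upwards [eventually_ge_atTop N] with n hn
        have h5 : runMax T h N (T x) ≤ runMax T h n (T x) := runMax_mono (T x) hn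
        simp only [hD, runMax]
        rw [max_eq_right (by linarith)]
        ring
    have := ge_of_tendsto' hlim hintD
    linarith

lemma exists_neg_dominating {m : Measure Ω} [IsProbabilityMeasure m] {L : Ω → ℝ}
    (hL : Measurable L)
    (hlt : ∫⁻ x, ENNReal.ofReal (L x) ∂m < ∫⁻ x, ENNReal.ofReal (-L x) ∂m) :
    ∃ (h : Ω → ℝ) (δ : ℝ), 0 < δ ∧ Measurable h ∧ Integrable h m ∧ ∫ x, h x ∂m < 0 ∧
      ∀ x, L x ≤ h x - δ := by
  have hmono : ∫⁻ x, ENNReal.ofReal (-L x) ∂m =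
      ⨆ K : ℕ, ∫⁻ x, ENNReal.ofReal (min (-L x) K) ∂m := by
    rw [← lintegral_iSup (fun K => by fun_prop)]
    · congr 1; ext x
      refine le_antisymm ?_ (iSup_le fun K => ENNReal.ofReal_le_ofReal (min_le_left _ _))
      obtain ⟨K, hK⟩ := exists_nat_ge (-L x)
      exact le_iSup_of_le K (by rw [min_eq_left hK])
    · intro K K' hKK x
      have : (K : ℝ) ≤ K' := by exact_mod_cast hKK
      dsimp only
      gcongr
  rw [hmono, lt_iSup_iff] at hlt
  obtain ⟨K, hK⟩ := hlt
  set h0 : Ω → ℝ := fun x => max (L x) (-K) with hh0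
  have hm0 : Measurable h0 := hL.max measurable_const
  have e1 : ∀ x, ENNReal.ofReal (h0 x) = ENNReal.ofReal (L x) := by
    intro x
    rcases le_total (L x) (-K) with h | h
    · simp only [hh0, max_eq_right h]
      have : (0 : ℝ) ≤ K := by positivity
      rw [ENNReal.ofReal_of_nonpos (by linarith), ENNReal.ofReal_of_nonpos (by linarith)]
    · simp only [hh0, max_eq_left h]
  have e2 : ∀ x, -h0 x = min (-L x) K := by
    intro x; simp only [hh0]; rw [← min_neg_neg, neg_neg]
  have hKfin : ∫⁻ x, ENNReal.ofReal (min (-L x) K) ∂m ≠ ∞ := by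
    refine ne_top_of_le_ne_top (b := ∫⁻ _x, (K : ℝ≥0∞) ∂m) (by simp) (lintegral_mono fun x => ?_)
    calc _ ≤ ENNReal.ofReal K := ENNReal.ofReal_le_ofReal (min_le_right _ _)
      _ = K := by simp
  have hi0 : Integrable h0 m := by
    refine ⟨hm0.aestronglyMeasurable, ?_⟩
    have : ∀ x, ‖h0 x‖ₑ ≤ ENNReal.ofReal (L x) + ENNReal.ofReal (min (-L x) K) := by
      intro x
      rw [← e1, ← e2, ← ofReal_norm_eq_enorm, Real.norm_eq_abs]
      rcases le_total 0 (h0 x) with h | h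
      · rw [abs_of_nonneg h]; simp
      · rw [abs_of_nonpos h]; simp
    refine (lintegral_mono this).trans_lt ?_
    rw [lintegral_add_left (by fun_prop)]
    exact ENNReal.add_lt_top.2 ⟨hK.trans_le le_top, hKfin.lt_top⟩
  have hneg : ∫ x, h0 x ∂m < 0 := by
    rw [integral_eq_lintegral_pos_part_sub_lintegral_neg_part hi0]
    simp only [e1, e2]
    rw [sub_neg]
    exact (ENNReal.toReal_lt_toReal hK.ne_top hKfin).2 hK
  refine ⟨fun x => h0 x + (-∫ x, h0 x ∂m) / 2, (-∫ x, h0 x ∂m) / 2, by linarith,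
    hm0.add_const _, hi0.add (integrable_const _), ?_, fun x => ?_⟩
  · rw [integral_add hi0 (integrable_const _)]
    simp
    linarith
  · simp [hh0]

end garsia

/-! ### Two-sided shifts and mixing -/

section shifts

/-- The inverse shift. -/
def zback {α : Type*} (x : ℤ → α) : ℤ → α := fun t => x (t - 1)

lemma zback_zshift {α : Type*} (x : ℤ → α) : zback (zshift x) = x := by
  ext t; simp [zback, zshift]

lemma zshift_zback {α : Type*} (x : ℤ → α) : zshift (zback x) = x := by
  ext t; simp [zback, zshift]

lemma zshift_iter {α : Type*} (n : ℕ) (x : ℤ → α) (t : ℤ) : zshift^[n] x t = x (t + n) := by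
  induction n generalizing t with
  | zero => simp
  | succ n ih =>
    rw [Function.iterate_succ_apply']
    simp only [zshift]
    rw [ih]; push_cast; congr 1; ring

lemma zback_iter {α : Type*} (n : ℕ) (x : ℤ → α) (t : ℤ) : zback^[n] x t = x (t - n) := by
  induction n generalizing t with
  | zero => simp
  | succ n ih =>
    rw [Function.iterate_succ_apply']
    simp only [zback]
    rw [ih]; push_cast; congr 1; ring

lemma measurable_zshift {α : Type*} [MeasurableSpace α] :
    Measurable (zshift : (ℤ → α) → (ℤ → α)) :=
  measurable_pi_lambda _ fun t => measurable_pi_apply _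

lemma measurable_zback {α : Type*} [MeasurableSpace α] :
    Measurable (zback : (ℤ → α) → (ℤ → α)) :=
  measurable_pi_lambda _ fun t => measurable_pi_apply _

lemma map_zback_eq {α : Type*} [MeasurableSpace α] {m : Measure (ℤ → α)}
    (hm : m.map zshift = m) : m.map zback = m := by
  conv_lhs => rw [← hm]
  rw [Measure.map_map measurable_zback measurable_zshift]
  have : (zback ∘ zshift : (ℤ → α) → (ℤ → α)) = id := by ext1 x; exact zback_zshift x
  rw [this, Measure.map_id]

lemma zero_or_one_of_mixing {α : Type*} [MeasurableSpace α] {m : Measure (ℤ → α)}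
    [IsProbabilityMeasure m]
    (hmix : ∀ A B : Set (ℤ → α), MeasurableSet A → MeasurableSet B →
      Tendsto (fun n : ℕ => m (A ∩ zshift^[n] ⁻¹' B)) atTop (nhds (m A * m B)))
    {n : ℕ} (hn : 0 < n) {S : Set (ℤ → α)} (hS : MeasurableSet S)
    (hinv : zshift^[n] ⁻¹' S = S) : m S = 0 ∨ m S = 1 := by
  have h1 : ∀ k : ℕ, zshift^[n * k] ⁻¹' S = S := by
    intro k
    induction k with
    | zero => simp
    | succ k ih =>
      rw [Nat.mul_succ, add_comm, Function.iterate_add, Set.preimage_comp, hinv, ih]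
  have h2 : Tendsto (fun k : ℕ => n * k) atTop atTop :=
    tendsto_id.const_mul_atTop' hn
  have h3 := (hmix S S hS hS).comp h2
  have h4 : Tendsto (fun _ : ℕ => m S) atTop (nhds (m S * m S)) := by
    refine h3.congr fun k => ?_
    simp [h1 k]
  have h5 := tendsto_nhds_unique h4 tendsto_const_nhds
  by_cases h0 : m S = 0
  · exact Or.inl h0
  · right
    have := (ENNReal.mul_eq_left h0 (measure_ne_top m S)).1 h5
    exact this

lemma ergodic_zshift_of_mixing {α : Type*} [MeasurableSpace α] {m : Measure (ℤ → α)}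
    [IsProbabilityMeasure m] (hm : m.map zshift = m)
    (hmix : ∀ A B : Set (ℤ → α), MeasurableSet A → MeasurableSet B →
      Tendsto (fun n : ℕ => m (A ∩ zshift^[n] ⁻¹' B)) atTop (nhds (m A * m B))) :
    Ergodic zshift m := by
  refine ⟨⟨measurable_zshift, hm⟩, ⟨fun {S} hS hinv => ?_⟩⟩
  rcases zero_or_one_of_mixing hmix one_pos hS (by simpa using hinv) with h | h
  · exact eventuallyConst_set.2 (Or.inr (measure_eq_zero_iff_ae_notMem.1 h))
  · exact eventuallyConst_set.2 (Or.inl ((mem_ae_iff_prob_eq_one hS).2 h))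

lemma ergodic_zback_iter_of_mixing {α : Type*} [MeasurableSpace α] {m : Measure (ℤ → α)}
    [IsProbabilityMeasure m] (hm : m.map zshift = m)
    (hmix : ∀ A B : Set (ℤ → α), MeasurableSet A → MeasurableSet B →
      Tendsto (fun n : ℕ => m (A ∩ zshift^[n] ⁻¹' B)) atTop (nhds (m A * m B)))
    {n : ℕ} (hn : 0 < n) :
    Ergodic (zback^[n]) m := by
  have h0 : MeasurePreserving zback m m := ⟨measurable_zback, map_zback_eq hm⟩
  refine ⟨h0.iterate n, ⟨fun {S} hS hinv => ?_⟩⟩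
  have hinv' : zshift^[n] ⁻¹' S = S := by
    conv_lhs => rw [← hinv]
    rw [← Set.preimage_comp]
    have : (zback^[n] ∘ zshift^[n] : (ℤ → α) → (ℤ → α)) = id := by
      ext x t
      simp [zback_iter, zshift_iter]
    rw [this, Set.preimage_id]
  rcases zero_or_one_of_mixing hmix hn hS hinv' with h | h
  · exact eventuallyConst_set.2 (Or.inr (measure_eq_zero_iff_ae_notMem.1 h))
  · exact eventuallyConst_set.2 (Or.inl ((mem_ae_iff_prob_eq_one hS).2 h))

end shifts

/-! ### Products of companion matrices -/

section matprod

variable {d p : ℕ}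

lemma matNorm_nonneg (M : Matrix (Fin p) (Fin p) ℝ) : 0 ≤ matNorm M :=
  Finset.sum_nonneg fun _ _ => Finset.sum_nonneg fun _ _ => abs_nonneg _

lemma abs_le_matNorm (M : Matrix (Fin p) (Fin p) ℝ) (i j : Fin p) : |M i j| ≤ matNorm M :=
  (Finset.single_le_sum (f := fun j => |M i j|) (fun _ _ => abs_nonneg _)
    (Finset.mem_univ j)).trans
    (Finset.single_le_sum (f := fun i => ∑ j, |M i j|)
      (fun _ _ => Finset.sum_nonneg fun _ _ => abs_nonneg _) (Finset.mem_univ i))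

lemma matNorm_mul_le (M N : Matrix (Fin p) (Fin p) ℝ) :
    matNorm (M * N) ≤ matNorm M * matNorm N := by
  unfold matNorm
  rw [Finset.sum_mul]
  refine Finset.sum_le_sum fun i _ => ?_
  calc ∑ j, |(M * N) i j| ≤ ∑ j, ∑ k, |M i k| * |N k j| := by
        refine Finset.sum_le_sum fun j _ => ?_
        rw [Matrix.mul_apply]
        refine (Finset.abs_sum_le_sum_abs _ _).trans (le_of_eq ?_)
        simp [abs_mul]
    _ = ∑ k, |M i k| * ∑ j, |N k j| := by
        rw [Finset.sum_comm]; simp [Finset.mul_sum]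
    _ ≤ ∑ k, |M i k| * ∑ k, ∑ j, |N k j| := by
        refine Finset.sum_le_sum fun k _ => ?_
        refine mul_le_mul_of_nonneg_left ?_ (abs_nonneg _)
        exact Finset.single_le_sum (f := fun k => ∑ j, |N k j|)
          (fun _ _ => Finset.sum_nonneg fun _ _ => abs_nonneg _) (Finset.mem_univ k)
    _ = _ := by rw [Finset.sum_mul]

/-- Backward products of companion matrices. -/
def matP (bfun : Fin p → (Fin d → ℝ) → ℝ) (k : ℕ) (x : ℤ → (Fin d → ℝ)) :
    Matrix (Fin p) (Fin p) ℝ :=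
  ((List.range k).map fun i => companionMat bfun (x (-(i : ℤ) - 1))).prod

variable {bfun : Fin p → (Fin d → ℝ) → ℝ}

lemma matP_zero (x : ℤ → (Fin d → ℝ)) : matP bfun 0 x = 1 := by simp [matP]

lemma matP_succ (k : ℕ) (x : ℤ → (Fin d → ℝ)) :
    matP bfun (k + 1) x = matP bfun k x * companionMat bfun (x (-(k : ℤ) - 1)) := by
  simp [matP, List.range_succ]

lemma matP_add (k l : ℕ) (x : ℤ → (Fin d → ℝ)) :
    matP bfun (k + l) x = matP bfun k x * matP bfun l (zback^[k] x) := by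
  induction l with
  | zero => simp [matP_zero]
  | succ l ih =>
    rw [← add_assoc, matP_succ, ih, matP_succ, mul_assoc, zback_iter]
    congr 4; push_cast; ring

lemma matP_zshift (k : ℕ) (x : ℤ → (Fin d → ℝ)) :
    matP bfun (k + 1) (zshift x) = companionMat bfun (x 0) * matP bfun k x := by
  rw [add_comm, matP_add, matP_succ, matP_zero, one_mul]
  congr 2
  simpa using zback_zshift x

lemma measurable_matP (hb : ∀ j, Measurable (bfun j)) (k : ℕ) (i j : Fin p) :
    Measurable (fun x : ℤ → (Fin d → ℝ) => matP bfun k x i j) := by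
  induction k generalizing i j with
  | zero => simp only [matP_zero]; exact measurable_const
  | succ k ih =>
    simp only [matP_succ, Matrix.mul_apply]
    refine Finset.measurable_sum _ fun l _ => (ih i l).mul ?_
    unfold companionMat
    split_ifs
    · exact (hb j).comp (measurable_pi_apply _)
    · exact measurable_const
    · exact measurable_const

lemma companionMat_nonneg (hb0 : ∀ j x, 0 ≤ bfun j x) (x : Fin d → ℝ) (i j : Fin p) :
    0 ≤ companionMat bfun x i j := by
  unfold companionMat
  split_ifs
  · exact hb0 _ _
  · exact zero_le_one
  · exact le_rfl

lemma matP_nonneg (hb0 : ∀ j x, 0 ≤ bfun j x) (k : ℕ) (x : ℤ → (Fin d → ℝ)) (i j : Fin p) :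
    0 ≤ matP bfun k x i j := by
  induction k generalizing i j with
  | zero =>
    rw [matP_zero, Matrix.one_apply]; split_ifs <;> norm_num
  | succ k ih =>
    rw [matP_succ, Matrix.mul_apply]
    exact Finset.sum_nonneg fun l _ => mul_nonneg (ih _ _) (companionMat_nonneg hb0 _ _ _)

lemma matP_mul_le (n : ℕ) (j : ℕ) : ∀ x : ℤ → (Fin d → ℝ),
    matNorm (matP bfun (n * j) x) ≤
      Real.exp (birkhoffSum (zback^[n]) (fun x => Real.log (matNorm (matP bfun n x))) j x) *
        matNorm (1 : Matrix (Fin p) (Fin p) ℝ) := by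
  induction j with
  | zero => intro x; simp [matP_zero]
  | succ j ih =>
    intro x
    rw [Nat.mul_succ, add_comm, matP_add, birkhoffSum_succ', Real.exp_add, mul_assoc]
    refine (matNorm_mul_le _ _).trans ?_
    exact mul_le_mul (Real.le_exp_log _) (ih _) (matNorm_nonneg _) (Real.exp_nonneg _)

theorem summable_matP {m : Measure (ℤ → (Fin d → ℝ))}
    [IsProbabilityMeasure m] (hm : m.map zshift = m)
    (hmix : ∀ A B : Set (ℤ → (Fin d → ℝ)), MeasurableSet A → MeasurableSet B →
      Tendsto (fun n : ℕ => m (A ∩ zshift^[n] ⁻¹' B)) atTop (nhds (m A * m B)))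
    (hb : ∀ j, Measurable (bfun j)) {n : ℕ} (hn : 0 < n)
    (hlt : ∫⁻ x, ENNReal.ofReal (Real.log (matNorm (matP bfun n x))) ∂m <
      ∫⁻ x, ENNReal.ofReal (-Real.log (matNorm (matP bfun n x))) ∂m) :
    ∀ᵐ x ∂m, ∑' k, ENNReal.ofReal (matNorm (matP bfun k x)) ≠ ∞ := by
  have hLm : Measurable (fun x : ℤ → (Fin d → ℝ) => Real.log (matNorm (matP bfun n x))) := by
    refine Real.measurable_log.comp ?_
    unfold matNorm
    exact Finset.measurable_sum _ fun i _ => Finset.measurable_sum _ fun j _ =>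
      (measurable_matP hb n i j).abs
  obtain ⟨h, δ, hδ, hh, hi, hneg, hLh⟩ := exists_neg_dominating hLm hlt
  have hT := ergodic_zback_iter_of_mixing hm hmix hn
  have hbd := runMax_bounded hT hh hi hneg
  have h1 : ∀ᵐ x ∂m, ∑' j, ENNReal.ofReal (matNorm (matP bfun (n * j) x)) ≠ ∞ := by
    filter_upwards [hbd] with x hx
    obtain ⟨K, hK⟩ := hx
    have h2 : ∀ j, matNorm (matP bfun (n * j) x) ≤
        Real.exp K * matNorm (1 : Matrix (Fin p) (Fin p) ℝ) * (Real.exp (-δ)) ^ j := by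
      intro j
      refine (matP_mul_le n j x).trans ?_
      rw [mul_right_comm, ← Real.exp_nat_mul, ← Real.exp_add]
      refine mul_le_mul_of_nonneg_right (Real.exp_le_exp.2 ?_) (matNorm_nonneg _)
      have h3 : birkhoffSum (zback^[n]) (fun x => Real.log (matNorm (matP bfun n x))) j x ≤
          birkhoffSum (zback^[n]) h j x - j * δ := by
        unfold birkhoffSum
        calc _ ≤ ∑ k ∈ Finset.range j, (h ((zback^[n])^[k] x) - δ) :=
              Finset.sum_le_sum fun k _ => hLh _
          _ = _ := by rw [Finset.sum_sub_distrib]; simp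
      have h4 := (birkhoffSum_le_runMax (T := zback^[n]) (h := h) j x).trans (hK j)
      linarith
    have hs : Summable fun j : ℕ =>
        Real.exp K * matNorm (1 : Matrix (Fin p) (Fin p) ℝ) * (Real.exp (-δ)) ^ j :=
      (summable_geometric_of_lt_one (Real.exp_nonneg _) (Real.exp_lt_one_iff.2 (by linarith))).mul_left _
    refine ne_top_of_le_ne_top ?_ (ENNReal.tsum_le_tsum fun j => ENNReal.ofReal_le_ofReal (h2 j))
    exact hs.tsum_ofReal_ne_top
  have h0 : MeasurePreserving zback m m := ⟨measurable_zback, map_zback_eq hm⟩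
  have h2 : ∀ᵐ x ∂m, ∀ r : ℕ,
      ∑' j, ENNReal.ofReal (matNorm (matP bfun (n * j) (zback^[r] x))) ≠ ∞ :=
    ae_all_iff.2 fun r => (h0.iterate r).quasiMeasurePreserving.ae h1
  filter_upwards [h2] with x hx
  haveI : NeZero n := ⟨hn.ne'⟩
  rw [← (Nat.divModEquiv n).symm.tsum_eq, ENNReal.tsum_prod', ENNReal.tsum_comm, tsum_fintype]
  refine (ENNReal.sum_lt_top.2 fun r _ => ?_).ne
  refine lt_of_le_of_lt (b := ∑' j, ENNReal.ofReal (matNorm (matP bfun r x)) *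
    ENNReal.ofReal (matNorm (matP bfun (n * j) (zback^[(r : ℕ)] x)))) ?_ ?_
  · refine ENNReal.tsum_le_tsum fun j => ?_
    rw [← ENNReal.ofReal_mul (matNorm_nonneg _)]
    refine ENNReal.ofReal_le_ofReal ?_
    have : (Nat.divModEquiv n).symm (j, r) = (r : ℕ) + n * j := by
      simp [Nat.divModEquiv]; ring
    rw [this, matP_add]
    exact matNorm_mul_le _ _
  · rw [ENNReal.tsum_mul_left]
    exact ENNReal.mul_lt_top ENNReal.ofReal_lt_top (hx r).lt_top

end matprod

/-! ### Tightness and existence of an invariant measure for the chain -/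

section tight

/-- The regression function as a function of the state. -/
def psiFn {d p : ℕ} (a : Fin p → (Fin d → ℝ) → (Fin p → ℝ) → ℝ)
    (w : (Fin p → ℝ) × (ℤ → (Fin d → ℝ))) : ℝ :=
  ∑ j, a j (w.2 0) w.1 * w.1 j

lemma measurable_psiFn {d p : ℕ} {a : Fin p → (Fin d → ℝ) → (Fin p → ℝ) → ℝ}
    (ha : ∀ j, Measurable fun q : (Fin d → ℝ) × (Fin p → ℝ) => a j q.1 q.2) :
    Measurable (psiFn a) := by
  unfold psiFn
  refine Finset.measurable_sum _ fun j _ => Measurable.mul ?_ (by fun_prop)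
  have h : Measurable (fun w : (Fin p → ℝ) × (ℤ → (Fin d → ℝ)) => (w.2 0, w.1)) := by fun_prop
  exact (ha j).comp h

variable {d q : ℕ} {bfun : Fin (q + 1) → (Fin d → ℝ) → ℝ}

/-- The environment-dependent bound on the state. -/
def envU (bfun : Fin (q + 1) → (Fin d → ℝ) → ℝ) (c : ℝ≥0∞) (i : Fin (q + 1))
    (x : ℤ → (Fin d → ℝ)) : ℝ≥0∞ :=
  c * ∑' k, ENNReal.ofReal (matP bfun k x i 0)

lemma measurable_envU (hb : ∀ j, Measurable (bfun j)) (c : ℝ≥0∞) (i : Fin (q + 1)) :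
    Measurable (envU bfun c i) := by
  unfold envU
  exact measurable_const.mul
    (Measurable.ennreal_tsum fun k => (measurable_matP hb k i 0).ennreal_ofReal)

lemma envU_zero (hb0 : ∀ j x, 0 ≤ bfun j x) (c : ℝ≥0∞) (x : ℤ → (Fin d → ℝ)) :
    envU bfun c 0 (zshift x) = c + ∑ j, ENNReal.ofReal (bfun j (x 0)) * envU bfun c j x := by
  unfold envU
  rw [tsum_eq_zero_add' ENNReal.summable]
  have : ∀ k, ENNReal.ofReal (matP bfun (k + 1) (zshift x) 0 0) =
      ∑ j, ENNReal.ofReal (bfun j (x 0)) * ENNReal.ofReal (matP bfun k x j 0) := by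
    intro k
    rw [matP_zshift, Matrix.mul_apply, ENNReal.ofReal_sum_of_nonneg]
    · refine Finset.sum_congr rfl fun j _ => ?_
      simp only [companionMat, Fin.val_zero, if_true]
      rw [ENNReal.ofReal_mul (hb0 _ _)]
    · intro j _
      exact mul_nonneg (companionMat_nonneg hb0 _ _ _) (matP_nonneg hb0 _ _ _ _)
  simp only [this, matP_zero, Matrix.one_apply_eq, ENNReal.ofReal_one]
  rw [mul_add, mul_one, Summable.tsum_finsetSum (fun _ _ => ENNReal.summable), Finset.mul_sum]
  congr 1
  refine Finset.sum_congr rfl fun j _ => ?_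
  rw [ENNReal.tsum_mul_left]
  ring

lemma envU_succ (c : ℝ≥0∞) (x : ℤ → (Fin d → ℝ)) (i : Fin q) :
    envU bfun c i.succ (zshift x) = envU bfun c i.castSucc x := by
  unfold envU
  rw [tsum_eq_zero_add' ENNReal.summable]
  have : ∀ k, matP bfun (k + 1) (zshift x) i.succ 0 = matP bfun k x i.castSucc 0 := by
    intro k
    rw [matP_zshift, Matrix.mul_apply, Finset.sum_eq_single i.castSucc]
    · simp [companionMat]
    · intro j _ hj
      have : ¬ ((j : ℕ) = (i : ℕ)) := fun h => hj (Fin.ext (by simpa using h))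
      simp [companionMat, this]
    · simp
  simp only [this, matP_zero]
  simp

variable {a : Fin (q + 1) → (Fin d → ℝ) → (Fin (q + 1) → ℝ) → ℝ} {f : ℝ → ℝ}

lemma psiFn_bound (hab : ∀ j x y, |a j x y| ≤ bfun j x) (hb0 : ∀ j x, 0 ≤ bfun j x)
    (w : (Fin (q + 1) → ℝ) × (ℤ → (Fin d → ℝ))) :
    ENNReal.ofReal |psiFn a w| ≤
      ∑ j, ENNReal.ofReal (bfun j (w.2 0)) * ENNReal.ofReal |w.1 j| := by
  have : ∀ j, ENNReal.ofReal (bfun j (w.2 0)) * ENNReal.ofReal |w.1 j| =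
      ENNReal.ofReal (bfun j (w.2 0) * |w.1 j|) := fun j => by rw [ENNReal.ofReal_mul (hb0 _ _)]
  simp only [this]
  rw [← ENNReal.ofReal_sum_of_nonneg (fun j _ => mul_nonneg (hb0 _ _) (abs_nonneg _))]
  refine ENNReal.ofReal_le_ofReal ((Finset.abs_sum_le_sum_abs _ _).trans ?_)
  refine Finset.sum_le_sum fun j _ => ?_
  rw [abs_mul]
  gcongr
  exact hab _ _ _

lemma moment_bound [IsProbabilityMeasure (noiseM f)]
    {m : Measure (ℤ → (Fin d → ℝ))} [IsProbabilityMeasure m] (hm : m.map zshift = m)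
    (ha : ∀ j, Measurable fun q : (Fin d → ℝ) × (Fin (q + 1) → ℝ) => a j q.1 q.2)
    (hb : ∀ j, Measurable (bfun j))
    (hab : ∀ j x y, |a j x y| ≤ bfun j x) (hb0 : ∀ j x, 0 ≤ bfun j x)
    (n : ℕ) : ∀ (i : Fin (q + 1)) (g : (ℤ → (Fin d → ℝ)) → ℝ≥0∞), Measurable g →
      ∫⁻ w, g w.2 * ENNReal.ofReal |w.1 i| ∂((Qop zshift (psiFn a) (noiseM f))^[n]
        ((Measure.dirac 0).prod m)) ≤
      ∫⁻ x, g x * envU bfun (∫⁻ u, ENNReal.ofReal |u| ∂(noiseM f)) i x ∂m := by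
  set c := ∫⁻ u, ENNReal.ofReal |u| ∂(noiseM f) with hc
  have hψ := measurable_psiFn ha
  have hθ : Measurable (zshift : (ℤ → (Fin d → ℝ)) → _) := measurable_zshift
  induction n with
  | zero =>
    intro i g hg
    simp only [Function.iterate_zero, id]
    rw [lintegral_prod _ (by fun_prop), lintegral_dirac' _ (by fun_prop)]
    simp
  | succ n ih =>
    intro i g hg
    rw [Function.iterate_succ_apply']
    haveI := isProbabilityMeasure_Qop_iter (γ := noiseM f) hθ hψ ((Measure.dirac 0).prod m) n
    set N := (Qop zshift (psiFn a) (noiseM f))^[n] ((Measure.dirac 0).prod m) with hN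
    have hNs : N.map Prod.snd = m := by
      refine Qop_iter_snd hθ hψ _ hm ?_ n
      rw [← Measure.snd, Measure.snd_prod]
    rw [lintegral_Qop hθ hψ _ _ (by fun_prop)]
    have hback : ∀ F : (ℤ → (Fin d → ℝ)) → ℝ≥0∞, Measurable F →
        ∫⁻ x, F (zshift x) ∂m = ∫⁻ x, F x ∂m := by
      intro F hF
      rw [← lintegral_map hF hθ, hm]
    refine Fin.cases ?_ (fun k => ?_) i
    · have h1 : ∀ w : (Fin (q + 1) → ℝ) × (ℤ → (Fin d → ℝ)),
          ∫⁻ e, g (stepFn zshift (psiFn a) w e).2 *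
            ENNReal.ofReal |(stepFn zshift (psiFn a) w e).1 0| ∂(noiseM f) ≤
          (∑ j, (g (zshift w.2) * ENNReal.ofReal (bfun j (w.2 0))) * ENNReal.ofReal |w.1 j|) +
            g (zshift w.2) * c := by
        intro w
        have : ∀ e, g (stepFn zshift (psiFn a) w e).2 *
            ENNReal.ofReal |(stepFn zshift (psiFn a) w e).1 0| ≤
            g (zshift w.2) * (∑ j, ENNReal.ofReal (bfun j (w.2 0)) * ENNReal.ofReal |w.1 j|) +
              g (zshift w.2) * ENNReal.ofReal |e| := by
          intro e
          rw [← mul_add]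
          change g (zshift w.2) * ENNReal.ofReal |psiFn a w + e| ≤ _
          gcongr
          refine (ENNReal.ofReal_le_ofReal (abs_add_le _ _)).trans ?_
          rw [ENNReal.ofReal_add (abs_nonneg _) (abs_nonneg _)]
          gcongr
          exact psiFn_bound hab hb0 w
        refine (lintegral_mono this).trans ?_
        rw [lintegral_add_left (by fun_prop), lintegral_const, measure_univ, mul_one,
          lintegral_const_mul _ (by fun_prop), ← hc, Finset.mul_sum]
        simp only [mul_assoc]; exact le_rfl
      refine (lintegral_mono h1).trans ?_
      rw [lintegral_add_left (by
          refine Finset.measurable_sum _ fun j _ => ?_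
          have := hb j
          fun_prop),
        lintegral_finsetSum _ (by intro j _; have := hb j; fun_prop)]
      have h2 : ∫⁻ w, g (zshift w.2) * c ∂N = ∫⁻ x, g (zshift x) * c ∂m := by
        rw [← hNs, lintegral_map (by fun_prop) measurable_snd]
      rw [h2]
      have h3 : ∀ j, ∫⁻ w, (g (zshift w.2) * ENNReal.ofReal (bfun j (w.2 0))) *
          ENNReal.ofReal |w.1 j| ∂N ≤
          ∫⁻ x, (g (zshift x) * ENNReal.ofReal (bfun j (x 0))) * envU bfun c j x ∂m := by
        intro j
        exact ih j (fun x => g (zshift x) * ENNReal.ofReal (bfun j (x 0)))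
          (by have := hb j; fun_prop)
      have hU := measurable_envU hb c
      calc _ ≤ ∑ j, ∫⁻ x, (g (zshift x) * ENNReal.ofReal (bfun j (x 0))) * envU bfun c j x ∂m +
            ∫⁻ x, g (zshift x) * c ∂m := by
              gcongr with j; exact h3 j
        _ = ∫⁻ x, g (zshift x) * envU bfun c 0 (zshift x) ∂m := by
            rw [← lintegral_finsetSum _ (by intro j _; have := hb j; fun_prop),
              ← lintegral_add_right _ (by fun_prop)]
            congr 1; ext x
            rw [envU_zero hb0, mul_add, Finset.mul_sum, add_comm]
            simp only [mul_assoc]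
        _ = _ := hback (fun x => g x * envU bfun c 0 x) (hg.mul (hU 0))
        _ ≤ _ := le_rfl
    · have h1 : ∀ w : (Fin (q + 1) → ℝ) × (ℤ → (Fin d → ℝ)),
          ∫⁻ e, g (stepFn zshift (psiFn a) w e).2 *
            ENNReal.ofReal |(stepFn zshift (psiFn a) w e).1 k.succ| ∂(noiseM f) =
          g (zshift w.2) * ENNReal.ofReal |w.1 k.castSucc| := by
        intro w
        change ∫⁻ e, g (zshift w.2) * ENNReal.ofReal |w.1 k.castSucc| ∂(noiseM f) = _
        simp
      simp only [h1]
      refine (ih k.castSucc (fun x => g (zshift x)) (by fun_prop)).trans (le_of_eq ?_)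
      simp only [← envU_succ]
      exact hback (fun x => g x * envU bfun c k.succ x) (hg.mul (measurable_envU hb c _))

theorem exists_chain_invariant (hf : Measurable f) (hfpos : ∀ u, 0 < f u)
    (hfdens : ∫⁻ u, ENNReal.ofReal (f u) = 1)
    (hmoment : ∫⁻ u, ENNReal.ofReal (|u| * f u) < ∞)
    [IsProbabilityMeasure (noiseM f)]
    {m : Measure (ℤ → (Fin d → ℝ))} [IsProbabilityMeasure m] (hm : m.map zshift = m)
    (hmix : ∀ A B : Set (ℤ → (Fin d → ℝ)), MeasurableSet A → MeasurableSet B →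
      Tendsto (fun n : ℕ => m (A ∩ zshift^[n] ⁻¹' B)) atTop (nhds (m A * m B)))
    (ha : ∀ j, Measurable fun q : (Fin d → ℝ) × (Fin (q + 1) → ℝ) => a j q.1 q.2)
    (hb : ∀ j, Measurable (bfun j))
    (hab : ∀ j x y, |a j x y| ≤ bfun j x) {n : ℕ} (hn : 0 < n)
    (hlt : ∫⁻ x, ENNReal.ofReal (Real.log (matNorm (matP bfun n x))) ∂m <
      ∫⁻ x, ENNReal.ofReal (-Real.log (matNorm (matP bfun n x))) ∂m) :
    ∃ ν : Measure ((Fin (q + 1) → ℝ) × (ℤ → (Fin d → ℝ))), IsProbabilityMeasure ν ∧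
      Qop zshift (psiFn a) (noiseM f) ν = ν ∧ ν.map Prod.snd = m := by
  have hb0 : ∀ j x, 0 ≤ bfun j x := fun j x => (abs_nonneg _).trans (hab j x 0)
  set c := ∫⁻ u, ENNReal.ofReal |u| ∂(noiseM f) with hc
  have hcfin : c ≠ ∞ := by
    rw [hc, noiseM, lintegral_withDensity_eq_lintegral_mul _ (by fun_prop) (by fun_prop)]
    refine ne_of_lt (lt_of_le_of_lt (lintegral_mono fun u => ?_) hmoment)
    simp only [Pi.mul_apply]
    rw [mul_comm, ENNReal.ofReal_mul (abs_nonneg _)]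
  have hUm := measurable_envU hb c 0
  have hUfin : ∀ᵐ x ∂m, envU bfun c 0 x ≠ ∞ := by
    filter_upwards [summable_matP hm hmix hb hn hlt] with x hx
    refine ENNReal.mul_ne_top hcfin (ne_top_of_le_ne_top hx (ENNReal.tsum_le_tsum fun k => ?_))
    exact ENNReal.ofReal_le_ofReal ((le_abs_self _).trans (abs_le_matNorm _ _ _))
  refine exists_Qop_invariant hf hfdens measurable_zshift (measurable_psiFn ha)
    ((Measure.dirac 0).prod m) hm ?_ ?_
  · rw [← Measure.snd, Measure.snd_prod]
  · intro ε hε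
    have hε2 : 0 < ε / 2 := ENNReal.half_pos hε.ne'
    have hlim : Tendsto (fun K : ℕ => m {x | (K : ℝ≥0∞) < envU bfun c 0 x}) atTop
        (nhds (m (⋂ K : ℕ, {x | (K : ℝ≥0∞) < envU bfun c 0 x}))) := by
      refine tendsto_measure_iInter_atTop (fun K =>
        (measurableSet_lt measurable_const hUm).nullMeasurableSet) ?_ ⟨0, measure_ne_top _ _⟩
      intro K K' h x hx
      have h' : (K : ℝ≥0∞) ≤ K' := by exact_mod_cast h
      exact lt_of_le_of_lt h' hx
    have hz : m (⋂ K : ℕ, {x | (K : ℝ≥0∞) < envU bfun c 0 x}) = 0 := by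
      rw [measure_eq_zero_iff_ae_notMem]
      filter_upwards [hUfin] with x hx hx'
      obtain ⟨K, hK⟩ := ENNReal.exists_nat_gt hx
      exact absurd (Set.mem_iInter.1 hx' K) (not_lt.2 hK.le)
    rw [hz] at hlim
    obtain ⟨K, hK⟩ := (hlim.eventually (ge_mem_nhds hε2)).exists
    obtain ⟨R, hR⟩ := ENNReal.exists_nat_mul_gt hε2.ne' (ENNReal.natCast_ne_top K)
    refine ⟨R, fun k => ?_⟩
    set N := (Qop zshift (psiFn a) (noiseM f))^[k] ((Measure.dirac 0).prod m) with hN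
    have hNs : N.map Prod.snd = m := by
      refine Qop_iter_snd measurable_zshift (measurable_psiFn ha) _ hm ?_ k
      rw [← Measure.snd, Measure.snd_prod]
    have hS : MeasurableSet {x | envU bfun c 0 x ≤ (K : ℝ≥0∞)} :=
      measurableSet_le hUm measurable_const
    have hmb := moment_bound (f := f) hm ha hb hab hb0 k 0
      (({x | envU bfun c 0 x ≤ (K : ℝ≥0∞)}).indicator 1) (measurable_one.indicator hS)
    have h2 : ∫⁻ x, ({x | envU bfun c 0 x ≤ (K : ℝ≥0∞)}).indicator 1 x * envU bfun c 0 x ∂m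
        ≤ K := by
      calc _ ≤ ∫⁻ _x, (K : ℝ≥0∞) ∂m := by
            refine lintegral_mono fun x => ?_
            by_cases hx : envU bfun c 0 x ≤ K
            · simpa [Set.indicator, hx] using hx
            · simp [Set.indicator, hx]
        _ = K := by simp
    have hNm := (hmb.trans h2)
    rw [← hN] at hNm
    by_cases hR0 : R = 0
    · subst hR0; simp at hR
    have hsub : {w : (Fin (q + 1) → ℝ) × (ℤ → (Fin d → ℝ)) | (R : ℝ) < |w.1 0|} ⊆
        (Prod.snd ⁻¹' {x | (K : ℝ≥0∞) < envU bfun c 0 x}) ∪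
        {w | (R : ℝ≥0∞) ≤ ({x | envU bfun c 0 x ≤ (K : ℝ≥0∞)}).indicator 1 w.2 *
          ENNReal.ofReal |w.1 0|} := by
      intro w hw
      by_cases hx : envU bfun c 0 w.2 ≤ K
      · right
        simp only [Set.mem_setOf_eq] at hw ⊢
        simp only [Set.indicator, Set.mem_setOf_eq, hx, if_true, Pi.one_apply, one_mul]
        calc (R : ℝ≥0∞) = ENNReal.ofReal R := by simp
          _ ≤ _ := ENNReal.ofReal_le_ofReal hw.le
      · left; exact not_le.1 hx
    refine (measure_mono hsub).trans ((measure_union_le _ _).trans ?_)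
    rw [← ENNReal.add_halves ε]
    refine add_le_add ?_ ?_
    · rw [← Measure.map_apply measurable_snd (measurableSet_lt measurable_const hUm), hNs]
      exact hK
    · refine (meas_ge_le_lintegral_div ?_ (by exact_mod_cast hR0)
        (ENNReal.natCast_ne_top _)).trans ?_
      · refine Measurable.aemeasurable ?_
        exact ((measurable_one.indicator hS).comp measurable_snd).mul (by fun_prop)
      · refine (ENNReal.div_le_div_right hNm _).trans ?_
        refine ENNReal.div_le_of_le_mul ?_
        rw [mul_comm]; exact hR.le

end tight

/-! ### Inverse limits of measures -/

section invlim

theorem exists_inverse_limit {Z : Type*} [MeasurableSpace Z] [StandardBorelSpace Z] [Nonempty Z]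
    (ρ : ℕ → Measure Z) [∀ n, IsProbabilityMeasure (ρ n)] (π : ℕ → Z → Z)
    (hπ : ∀ n, Measurable (π n)) (hρ : ∀ n, (ρ (n + 1)).map (π n) = ρ n) :
    ∃ N : Measure (ℕ → Z), IsProbabilityMeasure N ∧ (∀ n, N.map (fun x => x n) = ρ n) ∧
      ∀ n, ∀ᵐ x ∂N, π n (x (n + 1)) = x n := by
  let κ : (n : ℕ) → Kernel (Π _i : Finset.Iic n, Z) Z := fun n =>
    (condDistrib id (π n) (ρ (n + 1))).comap (fun x => x ⟨n, by simp⟩) (measurable_pi_apply _)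
  have hκ : ∀ n, IsMarkovKernel (κ n) := fun n => by
    simp only [κ]; infer_instance
  let N : Measure (ℕ → Z) := Kernel.trajMeasure (X := fun _ => Z) (ρ 0) κ
  have hN : IsProbabilityMeasure N := by
    simp only [N]; infer_instance
  have hstep : ∀ n, N.map (fun x => x n) = ρ n →
      N.map (fun x => (x n, x (n + 1))) = (ρ (n + 1)).map (fun z => (π n z, z)) := by
    intro n hn
    have h1 := Kernel.map_frestrictLe_trajMeasure_compProd_eq_map_trajMeasure
      (X := fun _ => Z) (κ := κ) (μ₀ := ρ 0) (a := n)
    have h2 : (ρ (n + 1)).map (fun z => (π n z, z)) =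
        (ρ n) ⊗ₘ condDistrib id (π n) (ρ (n + 1)) := by
      have := compProd_map_condDistrib (mβ := inferInstance) (X := π n) (μ := ρ (n + 1)) (Y := id) aemeasurable_id
      rw [hρ n] at this
      rw [this]; rfl
    have h3 : N.map (fun x => (x n, x (n + 1))) =
        (N.map (fun x => (Preorder.frestrictLe (π := fun _ => Z) n x, x (n + 1)))).map
          (fun y => (y.1 ⟨n, by simp⟩, y.2)) := by
      rw [Measure.map_map (by fun_prop) (by fun_prop)]
      rfl
    rw [h3, ← h1, h2]
    have hmar : ((Kernel.trajMeasure (X := fun _ => Z) (ρ 0) κ).map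
        (Preorder.frestrictLe (π := fun _ => Z) n)).map
        (fun y => y ⟨n, by simp⟩) = ρ n := by
      rw [Measure.map_map (by fun_prop) (by fun_prop)]
      exact hn
    have : IsProbabilityMeasure ((Kernel.trajMeasure (X := fun _ => Z) (ρ 0) κ).map
        (Preorder.frestrictLe (π := fun _ => Z) n)) :=
      Measure.isProbabilityMeasure_map (by fun_prop)
    ext s hs
    rw [Measure.map_apply (by fun_prop) hs, Measure.compProd_apply (by
      exact (show Measurable (fun y : (Π _i : Finset.Iic n, Z) × Z => (y.1 ⟨n, by simp⟩, y.2)) by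
        fun_prop) hs), Measure.compProd_apply hs]
    conv_rhs => rw [← hmar]
    rw [lintegral_map (Kernel.measurable_kernel_prodMk_left hs) (by fun_prop)]
    rfl
  have hmarg : ∀ n, N.map (fun x => x n) = ρ n := by
    intro n
    induction n with
    | zero =>
      have h0 : N.map (Preorder.frestrictLe (π := fun _ => Z) 0) =
          (ρ 0).map (MeasurableEquiv.piUnique (fun _ : Finset.Iic 0 => Z)).symm := by
        simp only [N]
        rw [Kernel.trajMeasure, Measure.map_comp _ _ (by fun_prop), Kernel.traj_map_frestrictLe,
          Kernel.partialTraj_self, Measure.id_comp]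
      have h1 : N.map (fun x => x 0) = (N.map (Preorder.frestrictLe (π := fun _ => Z) 0)).map
          (fun y => y ⟨0, by simp⟩) := by
        rw [Measure.map_map (by fun_prop) (by fun_prop)]
        rfl
      rw [h1, h0, Measure.map_map (by fun_prop) (by fun_prop)]
      convert Measure.map_id
      ext z
      rfl
    | succ n ih =>
      have h := hstep n ih
      have h1 : N.map (fun x => x (n + 1)) = (N.map (fun x => (x n, x (n + 1)))).map Prod.snd := by
        rw [Measure.map_map (by fun_prop) (by fun_prop)]; rfl
      have := hπ n
      rw [h1, h, Measure.map_map (by fun_prop) (by fun_prop)]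
      exact Measure.map_id
  refine ⟨N, hN, hmarg, fun n => ?_⟩
  have h := hstep n (hmarg n)
  have hms : MeasurableSet {y : Z × Z | π n y.2 = y.1} :=
    measurableSet_eq_fun ((hπ n).comp measurable_snd) measurable_fst
  have h1 : ∀ᵐ y ∂((ρ (n + 1)).map (fun z => (π n z, z))), π n y.2 = y.1 := by
    have := hπ n
    rw [ae_map_iff (by fun_prop) hms]
    exact ae_of_all _ fun z => rfl
  rw [← h, ae_map_iff (by fun_prop) hms] at h1
  exact h1

end invlim

/-! ### Windows of paths and one-step extensions -/

section windows

set_option linter.unusedSectionVars false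

/-- The path space. -/
abbrev ZP (d : ℕ) := ℤ → ℝ × (Fin d → ℝ)

variable {d q : ℕ}

/-- Keep the chain only on the window `[l, u]`. -/
def trW (l u : ℤ) (z : ZP d) : ZP d := fun s => (if l ≤ s ∧ s ≤ u then (z s).1 else 0, (z s).2)

/-- The regression function at time `t`. -/
def psiT {p : ℕ} (a : Fin p → (Fin d → ℝ) → (Fin p → ℝ) → ℝ) (t : ℤ) (z : ZP d) : ℝ :=
  ∑ j : Fin p, a j ((z (t - 1)).2) (fun i : Fin p => (z (t - 1 - (i : ℕ))).1) *
    (z (t - 1 - (j : ℕ))).1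

/-- Put the value `v` at time `t`. -/
def glueT (t : ℤ) (zv : ZP d × ℝ) : ZP d :=
  fun s => (if s = t then zv.2 else (zv.1 s).1, (zv.1 s).2)

/-- Extend the path at time `t` using the noise `e`. -/
def extT {p : ℕ} (a : Fin p → (Fin d → ℝ) → (Fin p → ℝ) → ℝ) (t : ℤ) (ze : ZP d × ℝ) : ZP d :=
  glueT t (ze.1, psiT a t ze.1 + ze.2)

/-- Extend the law at time `t`. -/
def ExtM {p : ℕ} (a : Fin p → (Fin d → ℝ) → (Fin p → ℝ) → ℝ) (f : ℝ → ℝ) (t : ℤ)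
    (ρ : Measure (ZP d)) : Measure (ZP d) :=
  (ρ.prod (noiseM f)).map (extT a t)

/-- Embed states into paths. -/
def embW (w : (Fin (q + 1) → ℝ) × (ℤ → (Fin d → ℝ))) : ZP d := fun s =>
  (if h : -(q : ℤ) ≤ s ∧ s ≤ 0 then w.1 ⟨(-s).toNat, by omega⟩ else 0, w.2 s)

/-- The laws of the chain started from `ν`. -/
def Gam (a : Fin (q + 1) → (Fin d → ℝ) → (Fin (q + 1) → ℝ) → ℝ) (f : ℝ → ℝ)
    (ν : Measure ((Fin (q + 1) → ℝ) × (ℤ → (Fin d → ℝ)))) : ℕ → Measure (ZP d)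
  | 0 => ν.map embW
  | k + 1 => ExtM a f (k + 1) (Gam a f ν k)

lemma measurable_trW (l u : ℤ) : Measurable (trW l u : ZP d → ZP d) := by
  refine measurable_pi_lambda _ fun s => Measurable.prodMk ?_ (by fun_prop)
  split_ifs <;> fun_prop

lemma measurable_glueT (t : ℤ) : Measurable (glueT t : ZP d × ℝ → ZP d) := by
  refine measurable_pi_lambda _ fun s => Measurable.prodMk ?_ (by fun_prop)
  split_ifs <;> fun_prop

lemma measurable_psiT {p : ℕ} {a : Fin p → (Fin d → ℝ) → (Fin p → ℝ) → ℝ}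
    (ha : ∀ j, Measurable fun q : (Fin d → ℝ) × (Fin p → ℝ) => a j q.1 q.2) (t : ℤ) :
    Measurable (psiT a t) := by
  unfold psiT
  refine Finset.measurable_sum _ fun j _ => Measurable.mul ?_ (by fun_prop)
  have h : Measurable (fun z : ZP d =>
    ((z (t - 1)).2, fun i : Fin p => (z (t - 1 - (i : ℕ))).1)) := by fun_prop
  exact (ha j).comp h

lemma measurable_extT {p : ℕ} {a : Fin p → (Fin d → ℝ) → (Fin p → ℝ) → ℝ}
    (ha : ∀ j, Measurable fun q : (Fin d → ℝ) × (Fin p → ℝ) => a j q.1 q.2) (t : ℤ) :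
    Measurable (extT a t) := by
  have := measurable_psiT ha t
  exact (measurable_glueT t).comp
    (show Measurable (fun ze : ZP d × ℝ => (ze.1, psiT a t ze.1 + ze.2)) by fun_prop)

lemma measurable_embW : Measurable (embW : (Fin (q + 1) → ℝ) × (ℤ → (Fin d → ℝ)) → ZP d) := by
  refine measurable_pi_lambda _ fun s => Measurable.prodMk ?_ (by fun_prop)
  split_ifs <;> fun_prop

lemma trW_trW (l u l' u' : ℤ) (z : ZP d) :
    trW l u (trW l' u' z) = trW (max l l') (min u u') z := by
  funext s
  simp only [trW, max_le_iff, le_min_iff]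
  ext1
  · by_cases h1 : l ≤ s ∧ s ≤ u <;> by_cases h2 : l' ≤ s ∧ s ≤ u' <;> simp [h1, h2] <;>
      (intros; exfalso; omega)
  · rfl

lemma zshift_trW (l u : ℤ) (z : ZP d) : zshift (trW l u z) = trW (l - 1) (u - 1) (zshift z) := by
  funext s
  simp only [trW, zshift]
  ext1
  · simp only [sub_le_iff_le_add, le_sub_iff_add_le]
  · rfl

lemma zshift_iter_trW (n : ℕ) (l u : ℤ) (z : ZP d) :
    zshift^[n] (trW l u z) = trW (l - n) (u - n) (zshift^[n] z) := by
  induction n with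
  | zero => simp
  | succ n ih =>
    rw [Function.iterate_succ_apply', ih, zshift_trW, Function.iterate_succ_apply']
    push_cast
    congr 1 <;> ring

variable {a : Fin (q + 1) → (Fin d → ℝ) → (Fin (q + 1) → ℝ) → ℝ}

lemma psiT_trW {t l u : ℤ} (hl : l ≤ t - 1 - q) (hu : t - 1 ≤ u) (z : ZP d) :
    psiT a t (trW l u z) = psiT a t z := by
  have : ∀ i : Fin (q + 1), (trW l u z (t - 1 - (i : ℕ))).1 = (z (t - 1 - (i : ℕ))).1 := by
    intro i
    have := i.2
    simp only [trW]
    rw [if_pos]; constructor <;> omega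
  simp only [psiT, this]
  rfl

lemma trW_glueT_lt {t l u : ℤ} (hu : u < t) (zv : ZP d × ℝ) :
    trW l u (glueT t zv) = trW l u zv.1 := by
  funext s
  simp only [trW, glueT]
  ext1
  · by_cases h : l ≤ s ∧ s ≤ u
    · have : s ≠ t := by omega
      simp [h, this]
    · simp [h]
  · rfl

lemma trW_glueT {t l : ℤ} (hl : l ≤ t) (z : ZP d) (v : ℝ) :
    trW l t (glueT t (z, v)) = glueT t (trW l (t - 1) z, v) := by
  funext s
  simp only [trW, glueT]
  ext1
  · by_cases h : s = t
    · subst h; simp [hl]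
    · have : s ≤ t ↔ s ≤ t - 1 := by omega
      simp [h, this]
  · rfl

lemma glueT_trW {t l : ℤ} (hl : l ≤ t) (z : ZP d) :
    glueT t (trW l (t - 1) z, (z t).1) = trW l t z := by
  rw [← trW_glueT hl]
  congr 1
  funext s
  simp only [glueT]
  ext1
  · by_cases h : s = t
    · subst h; simp
    · simp [h]
  · rfl

lemma trW_extT {t l : ℤ} (hl : l ≤ t - 1 - q) (z : ZP d) (e : ℝ) :
    trW l t (extT a t (z, e)) = extT a t (trW l (t - 1) z, e) := by
  simp only [extT]
  rw [trW_glueT (by omega), psiT_trW hl le_rfl]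

lemma psiT_zshift (t : ℤ) (z : ZP d) : psiT a t (zshift z) = psiT a (t + 1) z := by
  simp only [psiT, zshift]
  have h : ∀ k : ℤ, t - 1 - k + 1 = t + 1 - 1 - k := fun k => by ring
  simp only [h]
  rw [show t - 1 + 1 = t + 1 - 1 by ring]

lemma zshift_extT (t : ℤ) (z : ZP d) (e : ℝ) :
    zshift (extT a (t + 1) (z, e)) = extT a t (zshift z, e) := by
  simp only [extT, psiT_zshift]
  funext s
  simp only [glueT, zshift, add_left_inj]

lemma psiT_embW (w : (Fin (q + 1) → ℝ) × (ℤ → (Fin d → ℝ))) :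
    psiT a 1 (embW w) = psiFn a w := by
  have : ∀ i : Fin (q + 1), (embW w (1 - 1 - (i : ℕ))).1 = w.1 i := by
    intro i
    have := i.2
    simp only [embW]
    rw [dif_pos (by constructor <;> omega)]
    exact congrArg w.1 (Fin.ext (by simp))
  simp only [psiT, this]
  rfl

lemma trW_step (w : (Fin (q + 1) → ℝ) × (ℤ → (Fin d → ℝ))) (e : ℝ) :
    trW (-q) 0 (zshift (extT a 1 (embW w, e))) = embW (stepFn zshift (psiFn a) w e) := by
  simp only [extT, psiT_embW, stepFn]
  generalize psiFn a w + e = v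
  funext s
  simp only [trW, zshift, glueT, embW]
  ext1
  · by_cases h : -(q : ℤ) ≤ s ∧ s ≤ 0
    · simp only [h, and_self, if_true, dif_pos]
      by_cases h1 : s = 0
      · subst h1; simp; rfl
      · have h2 : ¬ (s + 1 = 1) := by omega
        rw [if_neg h2, dif_pos (by constructor <;> omega)]
        have : (⟨(-s).toNat, by omega⟩ : Fin (q + 1)) =
            (⟨(-(s + 1)).toNat, by omega⟩ : Fin q).succ := by
          ext; simp; omega
        rw [this, putFn_succ]
        rfl
    · simp [h]
  · rfl

variable {f : ℝ → ℝ}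

lemma isProbabilityMeasure_ExtM [IsProbabilityMeasure (noiseM f)]
    (ha : ∀ j, Measurable fun q : (Fin d → ℝ) × (Fin (q + 1) → ℝ) => a j q.1 q.2)
    (t : ℤ) (ρ : Measure (ZP d)) [IsProbabilityMeasure ρ] : IsProbabilityMeasure (ExtM a f t ρ) :=
  Measure.isProbabilityMeasure_map (measurable_extT ha t).aemeasurable

lemma map_ExtM_of_comm [IsProbabilityMeasure (noiseM f)]
    (ha : ∀ j, Measurable fun q : (Fin d → ℝ) × (Fin (q + 1) → ℝ) => a j q.1 q.2)
    {t t' : ℤ} {F G : ZP d → ZP d} (hF : Measurable F) (hG : Measurable G)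
    (h : ∀ z e, F (extT a t (z, e)) = extT a t' (G z, e))
    (ρ : Measure (ZP d)) [IsFiniteMeasure ρ] :
    (ExtM a f t ρ).map F = ExtM a f t' (ρ.map G) := by
  unfold ExtM
  have h1 : (ρ.map G).prod (noiseM f) = (ρ.prod (noiseM f)).map (Prod.map G id) := by
    rw [← Measure.map_prod_map _ _ hG measurable_id, Measure.map_id]
  rw [h1, Measure.map_map hF (measurable_extT ha t),
    Measure.map_map (measurable_extT ha t') (hG.prodMap measurable_id)]
  congr 1
  funext ze
  exact h ze.1 ze.2

lemma map_ExtM_of_fst [IsProbabilityMeasure (noiseM f)]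
    (ha : ∀ j, Measurable fun q : (Fin d → ℝ) × (Fin (q + 1) → ℝ) => a j q.1 q.2)
    {t : ℤ} {F G : ZP d → ZP d} (hF : Measurable F) (hG : Measurable G)
    (h : ∀ ze, F (extT a t ze) = G ze.1)
    (ρ : Measure (ZP d)) [IsFiniteMeasure ρ] :
    (ExtM a f t ρ).map F = ρ.map G := by
  unfold ExtM
  have h1 : ρ = (ρ.prod (noiseM f)).map Prod.fst := by
    rw [← Measure.fst, Measure.fst_prod]
  conv_rhs => rw [h1]
  rw [Measure.map_map hF (measurable_extT ha t), Measure.map_map hG measurable_fst]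
  congr 1
  funext ze
  exact h ze

variable {ν : Measure ((Fin (q + 1) → ℝ) × (ℤ → (Fin d → ℝ)))}

lemma isProbabilityMeasure_Gam [IsProbabilityMeasure (noiseM f)]
    (ha : ∀ j, Measurable fun q : (Fin d → ℝ) × (Fin (q + 1) → ℝ) => a j q.1 q.2)
    [IsProbabilityMeasure ν] (k : ℕ) : IsProbabilityMeasure (Gam a f ν k) := by
  induction k with
  | zero => exact Measure.isProbabilityMeasure_map measurable_embW.aemeasurable
  | succ k ih => exact isProbabilityMeasure_ExtM ha _ _

lemma Gam_trW [IsProbabilityMeasure (noiseM f)]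
    (ha : ∀ j, Measurable fun q : (Fin d → ℝ) × (Fin (q + 1) → ℝ) => a j q.1 q.2)
    [IsProbabilityMeasure ν] (k : ℕ) : (Gam a f ν k).map (trW (-q) k) = Gam a f ν k := by
  induction k with
  | zero =>
    simp only [Gam]
    rw [Measure.map_map (measurable_trW _ _) measurable_embW]
    congr 1
    funext w s
    simp only [trW, embW, Function.comp]
    ext1
    · by_cases h : -(q : ℤ) ≤ s ∧ s ≤ 0
      · simp [h]
      · simp [h]
    · rfl
  | succ k ih =>
    have := isProbabilityMeasure_Gam (f := f) (ν := ν) ha k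
    simp only [Gam]
    push_cast
    rw [map_ExtM_of_comm ha (measurable_trW _ _) (measurable_trW (-q) k) (t' := k + 1), ih]
    intro z e
    rw [trW_extT (by omega)]
    simp

lemma Gam_succ_trW [IsProbabilityMeasure (noiseM f)]
    (ha : ∀ j, Measurable fun q : (Fin d → ℝ) × (Fin (q + 1) → ℝ) => a j q.1 q.2)
    [IsProbabilityMeasure ν] (k : ℕ) : (Gam a f ν (k + 1)).map (trW (-q) k) = Gam a f ν k := by
  have := isProbabilityMeasure_Gam (f := f) (ν := ν) ha k
  rw [← Gam_trW ha k]
  simp only [Gam]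
  rw [map_ExtM_of_fst ha (measurable_trW _ _) (measurable_trW (-q) k)]
  intro ze
  exact trW_glueT_lt (by omega) _

lemma Gam_zshift [IsProbabilityMeasure (noiseM f)]
    (ha : ∀ j, Measurable fun q : (Fin d → ℝ) × (Fin (q + 1) → ℝ) => a j q.1 q.2)
    [IsProbabilityMeasure ν] (hν : Qop zshift (psiFn a) (noiseM f) ν = ν) (k : ℕ) :
    (Gam a f ν (k + 1)).map (fun z => trW (-q) k (zshift z)) = Gam a f ν k := by
  have hθ : Measurable (zshift : (ℤ → (Fin d → ℝ)) → _) := measurable_zshift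
  have hz : Measurable (zshift : ZP d → ZP d) := measurable_zshift
  have hF : ∀ k : ℕ, Measurable (fun z : ZP d => trW (-q) k (zshift z)) := fun k =>
    (measurable_trW (-q) k).comp hz
  induction k with
  | zero =>
    simp only [Gam]
    conv_rhs => rw [← hν]
    unfold Qop ExtM
    have h1 : (ν.map embW).prod (noiseM f) =
        (ν.prod (noiseM f)).map (Prod.map (embW : _ → ZP d) id) := by
      rw [← Measure.map_prod_map _ _ measurable_embW measurable_id, Measure.map_id]
    rw [h1, Measure.map_map (hF 0) (measurable_extT ha _),
      Measure.map_map ((hF 0).comp (measurable_extT ha _)) (measurable_embW.prodMap measurable_id),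
      Measure.map_map measurable_embW (measurable_stepFn hθ (measurable_psiFn ha))]
    congr 1
    funext we
    simp only [Function.comp, Prod.map, id]
    have := trW_step (a := a) we.1 we.2
    simpa using this
  | succ k ih =>
    have := isProbabilityMeasure_Gam (f := f) (ν := ν) ha (k + 1)
    rw [show Gam a f ν (k + 1 + 1) = ExtM a f ((k + 1 : ℕ) + 1) (Gam a f ν (k + 1)) from rfl,
      map_ExtM_of_comm ha (hF (k + 1)) (hF k) (t' := ((k + 1 : ℕ) : ℤ)), ih]
    · simp [Gam]
    · intro z e
      rw [zshift_extT, trW_extT (by push_cast; omega)]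
      simp

lemma Gam_zshift_iter [IsProbabilityMeasure (noiseM f)]
    (ha : ∀ j, Measurable fun q : (Fin d → ℝ) × (Fin (q + 1) → ℝ) => a j q.1 q.2)
    [IsProbabilityMeasure ν] (hν : Qop zshift (psiFn a) (noiseM f) ν = ν) (k i j : ℕ) :
    (Gam a f ν (k + i + j)).map (fun z => trW (-q) k (zshift^[i] z)) = Gam a f ν k := by
  have hz : Measurable (zshift : ZP d → ZP d) := measurable_zshift
  have hA : ∀ (k i : ℕ), Measurable (fun z : ZP d => trW (-q) k (zshift^[i] z)) :=
    fun k i => (measurable_trW _ _).comp (hz.iterate i)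
  have hB : ∀ (k : ℕ), Measurable (fun z : ZP d => trW (-q) k (zshift z)) :=
    fun k => (measurable_trW _ _).comp hz
  induction j generalizing k with
  | zero =>
    induction i generalizing k with
    | zero => exact Gam_trW ha k
    | succ i ih =>
      rw [← ih k]
      conv_rhs => rw [add_zero, ← Gam_zshift ha hν (k + i)]
      rw [Measure.map_map (hA k i) (hB (k + i))]
      have : k + (i + 1) + 0 = k + i + 1 := by ring
      rw [this]
      congr 1
      funext z
      simp only [Function.comp]
      rw [zshift_iter_trW, trW_trW, Function.iterate_succ_apply]
      congr 1
      · omega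
      · push_cast; omega
  | succ j ih =>
    rw [← ih k]
    conv_rhs => rw [← Gam_succ_trW ha (k + i + j)]
    rw [Measure.map_map (hA k i) (measurable_trW _ _)]
    rw [← add_assoc]
    congr 1
    funext z
    simp only [Function.comp]
    rw [zshift_iter_trW, trW_trW]
    congr 1
    · omega
    · push_cast; omega

/-- Measures on the path space are determined by their windows. -/
lemma measure_ext_windows {μ μ' : Measure (ZP d)} [IsFiniteMeasure μ'] (n₀ : ℕ)
    (h : ∀ n : ℕ, n₀ ≤ n → μ.map (trW (-n - q) n) = μ'.map (trW (-n - q) n)) : μ = μ' := by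
  refine IsProjectiveLimit.unique (P := fun I => μ'.map I.restrict) ?_ (fun I => rfl)
  intro I
  obtain ⟨n, hn₀, hn⟩ : ∃ n : ℕ, n₀ ≤ n ∧ ∀ i ∈ I, |i| ≤ n := by
    refine ⟨max n₀ (I.sup Int.natAbs), le_max_left _ _, fun i hi => ?_⟩
    have := Finset.le_sup (f := Int.natAbs) hi
    have h2 := le_max_right n₀ (I.sup Int.natAbs)
    rw [Int.abs_eq_natAbs]
    exact_mod_cast this.trans h2
  have hr : (I.restrict : ZP d → _) = I.restrict ∘ trW (-n - q) n := by
    funext z i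
    have := abs_le.1 (hn i.1 i.2)
    simp only [Function.comp, Finset.restrict, trW]
    rw [if_pos]; constructor <;> omega
  have hm : Measurable (I.restrict : ZP d → _) := Finset.measurable_restrict I
  have key : ∀ κ : Measure (ZP d), κ.map I.restrict = (κ.map (trW (-n - q) n)).map I.restrict := by
    intro κ
    rw [Measure.map_map hm (measurable_trW _ _), ← hr]
  rw [key μ, h n hn₀, ← key μ']

end windows

/-! ### The stationary path measure -/

section pathmeasure

set_option linter.unusedSectionVars false

variable {d q : ℕ} {a : Fin (q + 1) → (Fin d → ℝ) → (Fin (q + 1) → ℝ) → ℝ} {f : ℝ → ℝ}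
  {ν : Measure ((Fin (q + 1) → ℝ) × (ℤ → (Fin d → ℝ)))}

lemma trW_congr {l u l' u' : ℤ} (h : l = l') (h' : u = u') (z : ZP d) :
    trW l u z = trW l' u' z := by rw [h, h']

lemma map_iterate_stationary {α : Type*} [MeasurableSpace α] {T : α → α} (hT : Measurable T)
    {μ : Measure α} (h : μ.map T = μ) (n : ℕ) : μ.map T^[n] = μ :=
  ((MeasurePreserving.mk hT h).iterate n).map_eq

lemma stationary_window {μ : Measure (ZP d)} (hμ : μ.map zshift = μ) (n : ℕ) (l u : ℤ) :
    μ.map (trW (l - n) (u - n)) = (μ.map (trW l u)).map zshift^[n] := by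
  have hz : Measurable (zshift : ZP d → ZP d) := measurable_zshift
  conv_lhs => rw [← map_iterate_stationary hz hμ n]
  rw [Measure.map_map (measurable_trW _ _) (hz.iterate n),
    Measure.map_map (hz.iterate n) (measurable_trW _ _)]
  congr 1
  funext z
  simp only [Function.comp, zshift_iter_trW]

lemma stationary_unique {μ μ' : Measure (ZP d)} [IsFiniteMeasure μ'] (hμ : μ.map zshift = μ)
    (hμ' : μ'.map zshift = μ')
    (h : ∀ k : ℕ, μ.map (trW (-q) k) = μ'.map (trW (-q) k)) : μ = μ' := by
  refine measure_ext_windows (q := q) 0 fun n _ => ?_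
  have e1 : (-n - q : ℤ) = -q - n := by ring
  have e2 : (n : ℤ) = ((2 * n : ℕ) : ℤ) - n := by push_cast; ring
  have key : ∀ κ : Measure (ZP d), κ.map zshift = κ → κ.map (trW (-n - q) n) =
      (κ.map (trW (-q) (2 * n : ℕ))).map zshift^[n] := by
    intro κ hκ
    rw [← stationary_window hκ n]
    congr 1
    funext z
    exact trW_congr e1 e2 z
  rw [key μ hμ, key μ' hμ', h]

lemma exists_path_measure [IsProbabilityMeasure (noiseM f)]
    (ha : ∀ j, Measurable fun q : (Fin d → ℝ) × (Fin (q + 1) → ℝ) => a j q.1 q.2)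
    [IsProbabilityMeasure ν] (hν : Qop zshift (psiFn a) (noiseM f) ν = ν) :
    ∃ μ : Measure (ZP d), IsProbabilityMeasure μ ∧
      ∀ n : ℕ, μ.map (trW (-n - q) n) = (Gam a f ν (2 * n)).map zshift^[n] := by
  have hz : Measurable (zshift : ZP d → ZP d) := measurable_zshift
  have hG : ∀ k, IsProbabilityMeasure (Gam a f ν k) := isProbabilityMeasure_Gam ha
  have hρ : ∀ n : ℕ, IsProbabilityMeasure ((Gam a f ν (2 * n)).map zshift^[n]) := fun n =>
    Measure.isProbabilityMeasure_map (hz.iterate n).aemeasurable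
  have hA : ∀ (k i : ℕ), Measurable (fun z : ZP d => trW (-q) k (zshift^[i] z)) :=
    fun k i => (measurable_trW _ _).comp (hz.iterate i)
  obtain ⟨N, hN, hN1, hN2⟩ := exists_inverse_limit (Z := ZP d)
    (fun n : ℕ => (Gam a f ν (2 * n)).map zshift^[n]) (fun n : ℕ => trW (-n - q) n)
    (fun n => measurable_trW _ _) (by
      intro n
      rw [Measure.map_map (measurable_trW _ _) (hz.iterate _)]
      conv_rhs => rw [← Gam_zshift_iter ha hν (2 * n) 1 1]
      rw [Measure.map_map (hz.iterate _) (hA _ _)]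
      have : 2 * (n + 1) = 2 * n + 1 + 1 := by ring
      rw [this]
      congr 1
      funext z
      simp only [Function.comp]
      rw [zshift_iter_trW, ← Function.iterate_add_apply]
      exact trW_congr (by ring) (by push_cast; ring) _)
  have hN3 : ∀ᵐ x ∂N, ∀ n k : ℕ, trW (-n - q) n (x (n + k)) = x n := by
    filter_upwards [ae_all_iff.2 hN2] with x hx n k
    induction k with
    | zero =>
      rw [add_zero, ← hx n, trW_trW]
      exact trW_congr (by simp) (by simp) _
    | succ k ih =>
      rw [← ih, ← add_assoc, ← hx (n + k), trW_trW]
      exact trW_congr (by push_cast; omega) (by push_cast; omega) _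
  let Φ : (ℕ → ZP d) → ZP d := fun x t => x t.natAbs t
  have hΦ : Measurable Φ := measurable_pi_lambda _ fun t => by
    have : Measurable fun x : ℕ → ZP d => x t.natAbs := measurable_pi_apply _
    exact (measurable_pi_apply t).comp this
  refine ⟨N.map Φ, Measure.isProbabilityMeasure_map hΦ.aemeasurable, fun n => ?_⟩
  rw [Measure.map_map (measurable_trW _ _) hΦ, ← hN1 n]
  refine Measure.map_congr ?_
  filter_upwards [hN3] with x hx
  funext t
  simp only [Function.comp, Φ]
  rcases le_total t.natAbs n with h | h
  · obtain ⟨k, rfl⟩ := Nat.exists_eq_add_of_le h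
    have h1 := congrFun (hx t.natAbs k) t
    rw [← hx (t.natAbs + k) 0]
    simp only [trW, add_zero] at h1 ⊢
    rw [← h1]
    rw [if_pos (show -(t.natAbs : ℤ) - q ≤ t ∧ t ≤ t.natAbs by omega)]
  · obtain ⟨k, hk⟩ := Nat.exists_eq_add_of_le h
    rw [← hx n k, ← hk]
    rfl

lemma exists_stationary_path_measure [IsProbabilityMeasure (noiseM f)]
    (ha : ∀ j, Measurable fun q : (Fin d → ℝ) × (Fin (q + 1) → ℝ) => a j q.1 q.2)
    [IsProbabilityMeasure ν] (hν : Qop zshift (psiFn a) (noiseM f) ν = ν) :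
    ∃ μ : Measure (ZP d), IsProbabilityMeasure μ ∧ μ.map zshift = μ ∧
      ∀ k : ℕ, μ.map (trW (-q) k) = Gam a f ν k := by
  obtain ⟨μ, hμ, hW⟩ := exists_path_measure ha hν
  have hz : Measurable (zshift : ZP d → ZP d) := measurable_zshift
  have hA : ∀ (k i : ℕ), Measurable (fun z : ZP d => trW (-q) k (zshift^[i] z)) :=
    fun k i => (measurable_trW _ _).comp (hz.iterate i)
  refine ⟨μ, hμ, ?_, fun k => ?_⟩
  · refine measure_ext_windows (q := q) 0 fun n _ => ?_
    rw [hW n, Measure.map_map (measurable_trW _ _) hz]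
    have h1 : (trW (-n - q) n ∘ zshift : ZP d → ZP d) =
        (zshift ∘ trW (-n - q + 1) (n + 1)) ∘ trW (-(n + 1 : ℕ) - q) (n + 1 : ℕ) := by
      funext z
      simp only [Function.comp, trW_trW, zshift_trW]
      exact trW_congr (by push_cast; omega) (by push_cast; omega) _
    rw [h1, ← Measure.map_map (hz.comp (measurable_trW _ _)) (measurable_trW _ _), hW (n + 1),
      Measure.map_map (hz.comp (measurable_trW _ _)) (hz.iterate _)]
    conv_rhs => rw [← Gam_zshift_iter ha hν (2 * n) 2 0]
    rw [Measure.map_map (hz.iterate _) (hA _ _)]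
    have : 2 * (n + 1) = 2 * n + 2 + 0 := by ring
    rw [this]
    congr 1
    funext z
    simp only [Function.comp]
    rw [zshift_trW, zshift_iter_trW, ← Function.iterate_add_apply,
      ← Function.iterate_succ_apply' zshift]
    exact trW_congr (by ring) (by push_cast; ring) _
  · have h1 : (trW (-q) k : ZP d → ZP d) = trW (-q) k ∘ trW (-k - q) k := by
      funext z
      simp only [Function.comp, trW_trW]
      exact trW_congr (by omega) (by omega) _
    rw [h1, ← Measure.map_map (measurable_trW _ _) (measurable_trW _ _), hW k,
      Measure.map_map (measurable_trW _ _) (hz.iterate _)]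
    have := Gam_zshift_iter (f := f) ha hν k k 0
    rw [show 2 * k = k + k + 0 by ring]
    exact this

end pathmeasure

/-! ### Characterization of solutions -/

section charac

set_option linter.unusedSectionVars false

variable {d q : ℕ} {a : Fin (q + 1) → (Fin d → ℝ) → (Fin (q + 1) → ℝ) → ℝ} {f : ℝ → ℝ}
  {ν : Measure ((Fin (q + 1) → ℝ) × (ℤ → (Fin d → ℝ)))}

/-- Keep the chain only strictly before time `t`. -/
def kT (t : ℤ) (z : ZP d) : ZP d := fun s => (if s < t then (z s).1 else 0, (z s).2)

lemma measurable_kT (t : ℤ) : Measurable (kT t : ZP d → ZP d) := by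
  refine measurable_pi_lambda _ fun s => Measurable.prodMk ?_ (by fun_prop)
  split_ifs <;> fun_prop

lemma kT_kT (t : ℤ) (z : ZP d) : kT t (kT t z) = kT t z := by
  funext s
  simp only [kT]
  by_cases h : s < t <;> simp [h]

lemma kT_kT_succ (t : ℤ) (z : ZP d) : kT t (kT (t + 1) z) = kT t z := by
  funext s
  simp only [kT]
  by_cases h : s < t
  · have : s < t + 1 := by omega
    simp [h, this]
  · simp [h]

lemma trW_kT {l u t : ℤ} (h : u < t) (z : ZP d) : trW l u (kT t z) = trW l u z := by
  funext s
  simp only [trW, kT]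
  ext1
  · by_cases h1 : l ≤ s ∧ s ≤ u
    · have : s < t := by omega
      simp [h1, this]
    · simp [h1]
  · rfl

lemma trW_kT' {l u t : ℤ} (h : t ≤ u) (z : ZP d) : trW l u (kT (t + 1) z) = trW l t z := by
  funext s
  simp only [trW, kT]
  ext1
  · by_cases h2 : s ≤ t
    · have h3 : s < t + 1 := by omega
      have h4 : s ≤ u := by omega
      simp [h2, h3, h4]
    · have h3 : ¬ s < t + 1 := by omega
      simp [h2, h3]
  · rfl

lemma psiT_kT (t : ℤ) (z : ZP d) : psiT a t (kT t z) = psiT a t z := by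
  rw [← psiT_trW (l := t - 1 - q) (u := t - 1) le_rfl le_rfl, trW_kT (by omega),
    psiT_trW le_rfl le_rfl]

lemma glueT_kT (t : ℤ) (z : ZP d) : glueT t (kT t z, (z t).1) = kT (t + 1) z := by
  funext s
  simp only [glueT, kT]
  ext1
  · by_cases h : s = t
    · subst h; simp
    · have : s < t + 1 ↔ s < t := by omega
      simp [h, this]
  · rfl

lemma kT_extT (t : ℤ) (z : ZP d) (e : ℝ) :
    kT (t + 1) (extT a t (z, e)) = extT a t (kT t z, e) := by
  simp only [extT, psiT_kT]
  funext s
  simp only [glueT, kT]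
  ext1
  · by_cases h : s = t
    · subst h; simp
    · have : s < t + 1 ↔ s < t := by omega
      simp [h, this]
  · rfl

lemma kT_extT_same (t : ℤ) (ze : ZP d × ℝ) : kT t (extT a t ze) = kT t ze.1 := by
  simp only [extT]
  funext s
  simp only [glueT, kT]
  ext1
  · by_cases h : s = t
    · subst h; simp
    · simp [h]
  · rfl

lemma measurableSet_histSigma {t : ℤ} {H : Set (ZP d)}
    (hH : MeasurableSet[histSigma ℝ (Fin d → ℝ) t] H) :
    MeasurableSet H ∧ kT t ⁻¹' H = H := by
  obtain ⟨S, hS, rfl⟩ := hH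
  constructor
  · refine hS.preimage ?_
    fun_prop
  · ext z
    simp only [Set.mem_preimage, kT]
    have : (fun s : {s : ℤ // s < t} => if (s : ℤ) < t then (z s.1).1 else 0) =
      fun s : {s : ℤ // s < t} => (z s.1).1 := by
      funext s; simp [s.2]
    rw [this]

lemma measurableSet_histSigma_kT (t : ℤ) {B : Set (ZP d)} (hB : MeasurableSet B) :
    MeasurableSet[histSigma ℝ (Fin d → ℝ) t] (kT t ⁻¹' B) := by
  let h : (ℤ → (Fin d → ℝ)) × ({s : ℤ // s < t} → ℝ) → ZP d := fun w s =>
    (if hs : s < t then w.2 ⟨s, hs⟩ else 0, w.1 s)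
  have hh : Measurable h := by
    refine measurable_pi_lambda _ fun s => Measurable.prodMk ?_ (by fun_prop)
    split_ifs <;> fun_prop
  refine ⟨h ⁻¹' B, hB.preimage hh, ?_⟩
  rw [← Set.preimage_comp]
  congr 1

lemma histSigma_le (t : ℤ) :
    histSigma ℝ (Fin d → ℝ) t ≤ (inferInstance : MeasurableSpace (ZP d)) :=
  fun _ hH => (measurableSet_histSigma hH).1

/-- The transition kernel. -/
def KT (a : Fin (q + 1) → (Fin d → ℝ) → (Fin (q + 1) → ℝ) → ℝ) (f : ℝ → ℝ) (t : ℤ)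
    (A : Set ℝ) (z : ZP d) : ℝ≥0∞ := noiseM f ((fun e => psiT a t z + e) ⁻¹' A)

lemma KT_le [IsProbabilityMeasure (noiseM f)] (t : ℤ) (A : Set ℝ) (z : ZP d) :
    KT a f t A z ≤ 1 := prob_le_one

lemma measurable_KT [IsProbabilityMeasure (noiseM f)]
    (ha : ∀ j, Measurable fun q : (Fin d → ℝ) × (Fin (q + 1) → ℝ) => a j q.1 q.2) (t : ℤ)
    {A : Set ℝ} (hA : MeasurableSet A) : Measurable (KT a f t A) := by
  have h := measurable_psiT ha t
  have h2 : MeasurableSet ((fun ze : ZP d × ℝ => psiT a t ze.1 + ze.2) ⁻¹' A) :=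
    hA.preimage (by fun_prop)
  exact measurable_measure_prodMk_left h2

lemma KT_kT (t : ℤ) (A : Set ℝ) (z : ZP d) : KT a f t A (kT t z) = KT a f t A z := by
  simp only [KT, psiT_kT]

/-- Integrated form of the conditional distribution requirement. -/
def SolSet (a : Fin (q + 1) → (Fin d → ℝ) → (Fin (q + 1) → ℝ) → ℝ) (f : ℝ → ℝ)
    (μ : Measure (ZP d)) : Prop :=
  ∀ (t : ℤ) (A : Set ℝ), MeasurableSet A → ∀ H : Set (ZP d),
    MeasurableSet[histSigma ℝ (Fin d → ℝ) t] H →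
    μ (H ∩ {z | (z t).1 ∈ A}) = ∫⁻ z in H, KT a f t A z ∂μ

/-- One-step form. -/
def SolM (a : Fin (q + 1) → (Fin d → ℝ) → (Fin (q + 1) → ℝ) → ℝ) (f : ℝ → ℝ)
    (μ : Measure (ZP d)) : Prop :=
  ∀ t : ℤ, μ.map (kT (t + 1)) = ExtM a f t (μ.map (kT t))

lemma SolM_of_SolSet [IsProbabilityMeasure (noiseM f)]
    (ha : ∀ j, Measurable fun q : (Fin d → ℝ) × (Fin (q + 1) → ℝ) => a j q.1 q.2)
    {μ : Measure (ZP d)} [IsFiniteMeasure μ] (h : SolSet a f μ) : SolM a f μ := by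
  intro t
  have hψ := measurable_psiT ha t
  have hy : Measurable (fun z : ZP d => (kT t z, (z t).1)) :=
    (measurable_kT t).prodMk (by fun_prop)
  have hr : Measurable (fun ze : ZP d × ℝ => (ze.1, psiT a t ze.1 + ze.2)) := by fun_prop
  have key : μ.map (fun z : ZP d => (kT t z, (z t).1)) =
      ((μ.map (kT t)).prod (noiseM f)).map (fun ze => (ze.1, psiT a t ze.1 + ze.2)) := by
    refine Measure.ext_prod fun {B A} hB hA => ?_
    rw [Measure.map_apply hy (hB.prod hA), Measure.map_apply hr (hB.prod hA),
      Measure.prod_apply ((hB.prod hA).preimage hr)]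
    have e1 : (fun z : ZP d => (kT t z, (z t).1)) ⁻¹' (B ×ˢ A) =
      kT t ⁻¹' B ∩ {z | (z t).1 ∈ A} := rfl
    rw [e1, h t A hA _ (measurableSet_histSigma_kT t hB)]
    have e2 : (fun z : ZP d => noiseM f (Prod.mk z ⁻¹'
        ((fun ze : ZP d × ℝ => (ze.1, psiT a t ze.1 + ze.2)) ⁻¹' (B ×ˢ A)))) =
        B.indicator (KT a f t A) := by
      funext z
      by_cases hz : z ∈ B
      · rw [Set.indicator_of_mem hz]
        simp only [KT]
        congr 1
        ext e
        simp [hz]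
      · rw [Set.indicator_of_notMem hz]
        convert measure_empty (μ := noiseM f)
        ext e
        simp [hz]
    rw [e2, lintegral_indicator hB, Measure.restrict_map (measurable_kT t) hB,
      lintegral_map (measurable_KT ha t hA) (measurable_kT t)]
    simp only [KT_kT]
  unfold ExtM
  have e3 : (extT a t : ZP d × ℝ → ZP d) =
    glueT t ∘ fun ze => (ze.1, psiT a t ze.1 + ze.2) := rfl
  rw [e3, ← Measure.map_map (measurable_glueT t) hr, ← key,
    Measure.map_map (measurable_glueT t) hy]
  congr 1
  funext z
  exact (glueT_kT t z).symm

lemma SolSet_of_SolM [IsProbabilityMeasure (noiseM f)]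
    (ha : ∀ j, Measurable fun q : (Fin d → ℝ) × (Fin (q + 1) → ℝ) => a j q.1 q.2)
    {μ : Measure (ZP d)} [IsFiniteMeasure μ] (h : SolM a f μ) : SolSet a f μ := by
  intro t A hA H hH
  obtain ⟨hHm, hHk⟩ := measurableSet_histSigma hH
  have hψ := measurable_psiT ha t
  have hAt : MeasurableSet {z : ZP d | (z t).1 ∈ A} := hA.preimage (by fun_prop)
  have e0 : H ∩ {z : ZP d | (z t).1 ∈ A} =
      kT (t + 1) ⁻¹' (kT t ⁻¹' H ∩ {z | (z t).1 ∈ A}) := by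
    ext z
    simp only [Set.mem_inter_iff, Set.mem_preimage, kT_kT_succ, Set.mem_setOf_eq]
    rw [← Set.mem_preimage (f := kT t), hHk]
    simp [kT]
  have hS : MeasurableSet (kT t ⁻¹' H ∩ {z : ZP d | (z t).1 ∈ A}) :=
    (hHm.preimage (measurable_kT t)).inter hAt
  rw [e0, ← Measure.map_apply (measurable_kT _) hS, h t]
  unfold ExtM
  rw [Measure.map_apply (measurable_extT ha t) hS,
    Measure.prod_apply (hS.preimage (measurable_extT ha t))]
  have e2 : (fun z : ZP d => noiseM f (Prod.mk z ⁻¹' (extT a t ⁻¹'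
      (kT t ⁻¹' H ∩ {z : ZP d | (z t).1 ∈ A})))) = H.indicator (KT a f t A) := by
    funext z
    have h1 : ∀ e, (extT a t (z, e) t).1 = psiT a t z + e := by
      intro e; simp [extT, glueT]
    by_cases hz : z ∈ H
    · rw [Set.indicator_of_mem hz]
      simp only [KT]
      congr 1
      ext e
      simp only [Set.mem_preimage, Set.mem_inter_iff, kT_extT_same, Set.mem_setOf_eq, h1]
      rw [← Set.mem_preimage (f := kT t), hHk]
      simp [hz]
    · rw [Set.indicator_of_notMem hz]
      convert measure_empty (μ := noiseM f)
      ext e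
      simp only [Set.mem_preimage, Set.mem_inter_iff, kT_extT_same, Set.mem_setOf_eq, h1]
      rw [← Set.mem_preimage (f := kT t), hHk]
      simp [hz]
  rw [e2, lintegral_indicator hHm, Measure.restrict_map (measurable_kT t) hHm,
      lintegral_map (measurable_KT ha t hA) (measurable_kT t)]
  simp only [KT_kT, hHk]

lemma SolM_window [IsProbabilityMeasure (noiseM f)]
    (ha : ∀ j, Measurable fun q : (Fin d → ℝ) × (Fin (q + 1) → ℝ) => a j q.1 q.2)
    {μ : Measure (ZP d)} [IsFiniteMeasure μ] (h : SolM a f μ) {l t : ℤ} (hl : l ≤ t - 1 - q) :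
    μ.map (trW l t) = ExtM a f t (μ.map (trW l (t - 1))) := by
  have h1 : (trW l t : ZP d → ZP d) = trW l t ∘ kT (t + 1) := by
    funext z; exact (trW_kT (by omega) z).symm
  rw [h1, ← Measure.map_map (measurable_trW _ _) (measurable_kT _), h t,
    map_ExtM_of_comm ha (measurable_trW _ _) (measurable_trW l (t - 1))
      (fun z e => trW_extT hl z e), Measure.map_map (measurable_trW _ _) (measurable_kT _)]
  congr 2
  funext z
  exact trW_kT (by omega) z

lemma SolM_of_window [IsProbabilityMeasure (noiseM f)]
    (ha : ∀ j, Measurable fun q : (Fin d → ℝ) × (Fin (q + 1) → ℝ) => a j q.1 q.2)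
    {μ : Measure (ZP d)} [IsProbabilityMeasure μ]
    (h : ∀ (n : ℕ) (t : ℤ), 1 ≤ t + n →
      μ.map (trW (-n - q) t) = ExtM a f t (μ.map (trW (-n - q) (t - 1)))) : SolM a f μ := by
  intro t
  have := Measure.isProbabilityMeasure_map (μ := μ) (measurable_kT t).aemeasurable
  have := isProbabilityMeasure_ExtM (f := f) ha t (μ.map (kT t))
  rw [← map_ExtM_of_comm ha (measurable_kT (t + 1)) (measurable_kT t)
    (fun z e => kT_extT t z e)]
  have := isProbabilityMeasure_ExtM (f := f) ha t μ
  have := Measure.isProbabilityMeasure_map (μ := ExtM a f t μ) (measurable_kT (t + 1)).aemeasurable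
  refine measure_ext_windows (q := q) (t.natAbs + 1) fun n hn => ?_
  rw [Measure.map_map (measurable_trW _ _) (measurable_kT _),
    Measure.map_map (measurable_trW _ _) (measurable_kT _)]
  have h1 : (trW (-n - q) n ∘ kT (t + 1) : ZP d → ZP d) = trW (-n - q) t := by
    funext z; exact trW_kT' (by omega) z
  rw [h1, map_ExtM_of_comm ha (measurable_trW _ _) (measurable_trW (-n - q) (t - 1))
    (fun z e => trW_extT (by omega) z e)]
  exact h n t (by omega)

lemma zshift_iter_extT (n : ℕ) (t : ℤ) (z : ZP d) (e : ℝ) :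
    zshift^[n] (extT a (t + n) (z, e)) = extT a t (zshift^[n] z, e) := by
  induction n generalizing t with
  | zero => simp
  | succ n ih =>
    rw [Function.iterate_succ_apply', Function.iterate_succ_apply', ← zshift_extT, ← ih]
    congr 3
    push_cast
    ring

lemma SolM_of_Gam [IsProbabilityMeasure (noiseM f)]
    (ha : ∀ j, Measurable fun q : (Fin d → ℝ) × (Fin (q + 1) → ℝ) => a j q.1 q.2)
    [IsProbabilityMeasure ν]
    {μ : Measure (ZP d)} [IsProbabilityMeasure μ] (hμ : μ.map zshift = μ)
    (hG : ∀ k : ℕ, μ.map (trW (-q) k) = Gam a f ν k) : SolM a f μ := by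
  have hz : Measurable (zshift : ZP d → ZP d) := measurable_zshift
  refine SolM_of_window ha fun n t ht => ?_
  obtain ⟨k, hk⟩ : ∃ k : ℕ, t + n = k + 1 := ⟨(t + n - 1).toNat, by omega⟩
  have e1 := stationary_window hμ n (-q) (k + 1 : ℕ)
  have e2 := stationary_window hμ n (-q) k
  rw [hG] at e1 e2
  have hGk := isProbabilityMeasure_Gam (f := f) (ν := ν) ha k
  have h1 : (-n - q : ℤ) = -q - n := by ring
  have h2 : t = ((k + 1 : ℕ) : ℤ) - n := by push_cast; omega
  have h3 : t - 1 = k - n := by omega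
  rw [h3, h1, e2]
  conv_lhs => rw [h2, e1]
  simp only [Gam]
  rw [map_ExtM_of_comm ha (hz.iterate n) (hz.iterate n) (t' := t)]
  intro z e
  rw [← zshift_iter_extT, hk]

end charac

/-! ### Uniqueness and equivalence with the conditional expectation formulation -/

section uniq

set_option linter.unusedSectionVars false

variable {d q : ℕ} {a : Fin (q + 1) → (Fin d → ℝ) → (Fin (q + 1) → ℝ) → ℝ} {f : ℝ → ℝ}
  {ν : Measure ((Fin (q + 1) → ℝ) × (ℤ → (Fin d → ℝ)))}

/-- The state at time `0`. -/
def stW (z : ZP d) : (Fin (q + 1) → ℝ) × (ℤ → (Fin d → ℝ)) :=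
  (fun i => (z (-(i : ℕ))).1, fun s => (z s).2)

lemma measurable_stW : Measurable (stW : ZP d → (Fin (q + 1) → ℝ) × (ℤ → (Fin d → ℝ))) := by
  unfold stW; fun_prop

lemma embW_stW (z : ZP d) : embW (q := q) (stW z) = trW (-q) 0 z := by
  funext s
  simp only [embW, stW, trW]
  ext1
  · by_cases h : -(q : ℤ) ≤ s ∧ s ≤ 0
    · simp only [h, and_self, dif_pos, if_true]
      congr 2
      omega
    · simp [h]
  · rfl

lemma stW_embW (w : (Fin (q + 1) → ℝ) × (ℤ → (Fin d → ℝ))) : stW (embW w) = w := by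
  ext1
  · funext i
    have := i.2
    simp only [embW, stW]
    rw [dif_pos (by constructor <;> omega)]
    exact congrArg w.1 (Fin.ext (by simp))
  · rfl

lemma stW_trW (z : ZP d) : (stW (trW (-q) 0 z) : (Fin (q + 1) → ℝ) × (ℤ → (Fin d → ℝ))) = stW z := by
  rw [← embW_stW, stW_embW]

lemma Gam_of_SolM (hf : Measurable f) (hfpos : ∀ u, 0 < f u) [IsProbabilityMeasure (noiseM f)]
    (ha : ∀ j, Measurable fun q : (Fin d → ℝ) × (Fin (q + 1) → ℝ) => a j q.1 q.2)
    [IsProbabilityMeasure ν] (hν : Qop zshift (psiFn a) (noiseM f) ν = ν)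
    {μ : Measure (ZP d)} [IsProbabilityMeasure μ] (hμ : μ.map zshift = μ)
    (hX : μ.map (fun z => fun t => (z t).2) = ν.map Prod.snd)
    (hsol : SolM a f μ) (k : ℕ) : μ.map (trW (-q) k) = Gam a f ν k := by
  have hθ : Measurable (zshift : (ℤ → (Fin d → ℝ)) → _) := measurable_zshift
  have hz : Measurable (zshift : ZP d → ZP d) := measurable_zshift
  have hst : Measurable (stW : ZP d → (Fin (q + 1) → ℝ) × (ℤ → (Fin d → ℝ))) := measurable_stW
  have hstep : ∀ k : ℕ, μ.map (trW (-q) (k + 1 : ℕ)) =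
      ExtM a f (k + 1) (μ.map (trW (-q) k)) := by
    intro k
    have := SolM_window ha hsol (l := -q) (t := (k + 1 : ℕ)) (by push_cast; omega)
    rw [this]
    push_cast
    simp
  induction k with
  | succ k ih => rw [hstep, ih]; rfl
  | zero =>
    have hprob := Measure.isProbabilityMeasure_map (μ := μ) hst.aemeasurable
    have hfix : Qop zshift (psiFn a) (noiseM f) (μ.map stW) = μ.map stW := by
      have e1 : μ.map stW = (μ.map (trW (-q) (0 + 1 : ℕ))).map
          ((stW : ZP d → (Fin (q + 1) → ℝ) × (ℤ → (Fin d → ℝ))) ∘ zshift) := by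
        conv_lhs => rw [← hμ]
        rw [Measure.map_map hst hz, Measure.map_map (hst.comp hz) (measurable_trW _ _)]
        congr 1
        funext z
        simp only [Function.comp]
        rw [← stW_trW (zshift z), ← stW_trW (zshift (trW _ _ z)), zshift_trW, trW_trW]
        congr 1
        exact trW_congr (by omega) (by push_cast; omega) _
      conv_rhs => rw [e1, hstep 0]
      unfold Qop ExtM
      have h1 : (μ.map stW).prod (noiseM f) = (μ.prod (noiseM f)).map
          (Prod.map (stW : ZP d → (Fin (q + 1) → ℝ) × (ℤ → (Fin d → ℝ))) id) := by
        rw [← Measure.map_prod_map _ _ hst measurable_id, Measure.map_id]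
      have h2 : (μ.map (trW (-q) (0 : ℕ))).prod (noiseM f) = (μ.prod (noiseM f)).map
          (Prod.map (trW (-q) (0 : ℕ)) id) := by
        rw [← Measure.map_prod_map _ _ (measurable_trW _ _) measurable_id, Measure.map_id]
      rw [h1, h2, Measure.map_map (measurable_stepFn hθ (measurable_psiFn ha))
          (hst.prodMap measurable_id),
        Measure.map_map (hst.comp hz) (measurable_extT ha _),
        Measure.map_map ((hst.comp hz).comp (measurable_extT ha _))
          ((measurable_trW _ _).prodMap measurable_id)]
      congr 1
      funext ze
      simp only [Function.comp, Prod.map, id]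
      have h3 := trW_step (a := a) (stW ze.1) ze.2
      rw [embW_stW] at h3
      have h4 := congrArg (stW (q := q)) h3
      rw [stW_trW, stW_embW] at h4
      rw [← h4]
      simp
    have hsnd : (μ.map (stW (q := q))).map Prod.snd = ν.map Prod.snd := by
      rw [← hX, Measure.map_map measurable_snd hst]
      rfl
    have := Qop_invariant_unique hf hfpos hθ (measurable_psiFn ha) hfix hν hsnd
    simp only [Gam]
    rw [← this, Measure.map_map measurable_embW hst]
    congr 1
    funext z
    simp [Function.comp, embW_stW]

lemma KT_eq (hf : Measurable f) (t : ℤ) {A : Set ℝ} (hA : MeasurableSet A) (z : ZP d) :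
    ∫⁻ v in A, ENNReal.ofReal (f (v - psiT a t z)) = KT a f t A z := by
  unfold KT noiseM
  rw [withDensity_apply _ (hA.preimage (by fun_prop)), ← lintegral_indicator hA,
    ← lintegral_indicator (hA.preimage (by fun_prop)),
    ← lintegral_add_right_eq_self _ (psiT a t z)]
  congr 1
  funext v
  by_cases h : v + psiT a t z ∈ A
  · rw [Set.indicator_of_mem h, Set.indicator_of_mem (by simpa [add_comm] using h)]
    simp
  · rw [Set.indicator_of_notMem h, Set.indicator_of_notMem (by simpa [add_comm] using h)]

lemma measurable_KT_hist [IsProbabilityMeasure (noiseM f)]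
    (ha : ∀ j, Measurable fun q : (Fin d → ℝ) × (Fin (q + 1) → ℝ) => a j q.1 q.2) (t : ℤ)
    {A : Set ℝ} (hA : MeasurableSet A) :
    Measurable[histSigma ℝ (Fin d → ℝ) t] (KT a f t A) := by
  intro S hS
  have h1 : KT a f t A ⁻¹' S = kT t ⁻¹' (KT a f t A ⁻¹' S) := by
    ext z
    simp [KT_kT]
  rw [h1]
  exact measurableSet_histSigma_kT t ((measurable_KT ha t hA) hS)

lemma isFCARSolution_iff (hf : Measurable f) [IsProbabilityMeasure (noiseM f)]
    (ha : ∀ j, Measurable fun q : (Fin d → ℝ) × (Fin (q + 1) → ℝ) => a j q.1 q.2)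
    {μ : Measure (ZP d)} [IsProbabilityMeasure μ] : IsFCARSolution a f μ ↔ SolSet a f μ := by
  have hm : ∀ t, histSigma ℝ (Fin d → ℝ) t ≤ (inferInstance : MeasurableSpace (ZP d)) :=
    histSigma_le
  have hAm : ∀ (t : ℤ) {A : Set ℝ}, MeasurableSet A → MeasurableSet {z : ZP d | (z t).1 ∈ A} :=
    fun t A hA => hA.preimage (by fun_prop)
  have hK : ∀ (t : ℤ) {A : Set ℝ}, MeasurableSet A →
      (fun z : ZP d => (∫⁻ v in A, ENNReal.ofReal (f (v - ∑ j : Fin (q + 1),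
        a j ((z (t - 1)).2) (fun i : Fin (q + 1) => (z (t - 1 - (i : ℕ))).1) *
          (z (t - 1 - (j : ℕ))).1))).toReal) = fun z => (KT a f t A z).toReal := by
    intro t A hA
    funext z
    rw [← KT_eq hf t hA]
    rfl
  have hKi : ∀ (t : ℤ) {A : Set ℝ}, MeasurableSet A →
      Integrable (fun z => (KT a f t A z).toReal) μ := by
    intro t A hA
    refine Integrable.of_bound (measurable_KT ha t hA).ennreal_toReal.aestronglyMeasurable 1
      (Eventually.of_forall fun z => ?_)
    rw [Real.norm_of_nonneg ENNReal.toReal_nonneg]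
    exact ENNReal.toReal_le_of_le_ofReal zero_le_one (by simpa using KT_le t A z)
  have hKint : ∀ (t : ℤ) {A : Set ℝ}, MeasurableSet A → ∀ H : Set (ZP d),
      ∫ z in H, (KT a f t A z).toReal ∂μ = (∫⁻ z in H, KT a f t A z ∂μ).toReal := by
    intro t A hA H
    refine integral_toReal (measurable_KT ha t hA).aemeasurable (Eventually.of_forall fun z => ?_)
    exact (KT_le t A z).trans_lt ENNReal.one_lt_top
  have hKfin : ∀ (t : ℤ) (A : Set ℝ) (H : Set (ZP d)), ∫⁻ z in H, KT a f t A z ∂μ ≠ ∞ := by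
    intro t A H
    refine ne_top_of_le_ne_top (measure_ne_top μ H) ?_
    calc ∫⁻ z in H, KT a f t A z ∂μ ≤ ∫⁻ z in H, 1 ∂μ := lintegral_mono fun z => KT_le t A z
      _ = μ H := by simp
  have hind : ∀ (t : ℤ) {A : Set ℝ}, MeasurableSet A → ∀ H : Set (ZP d), MeasurableSet H →
      ∫ z in H, ({z : ZP d | (z t).1 ∈ A}).indicator (fun _ => (1 : ℝ)) z ∂μ =
        (μ (H ∩ {z | (z t).1 ∈ A})).toReal := by
    intro t A hA H hH
    rw [integral_indicator (hAm t hA), integral_const, Measure.restrict_restrict (hAm t hA)]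
    simp [Set.inter_comm, Measure.real]
  have hii : ∀ (t : ℤ) {A : Set ℝ}, MeasurableSet A →
      Integrable (({z : ZP d | (z t).1 ∈ A}).indicator (fun _ => (1 : ℝ))) μ :=
    fun t A hA => (integrable_const _).indicator (hAm t hA)
  constructor
  · intro h t A hA H hH
    have h1 := h t A hA
    rw [hK t hA] at h1
    have h2 := setIntegral_condExp (hm t) (hii t hA) hH
    rw [hind t hA H (hm t _ hH), setIntegral_congr_ae (hm t _ hH)
      (h1.mono fun z hz _ => hz), hKint t hA H] at h2
    exact ((ENNReal.toReal_eq_toReal_iff' (hKfin t A H) (measure_ne_top _ _)).1 h2).symm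
  · intro h t A hA
    rw [hK t hA]
    symm
    refine ae_eq_condExp_of_forall_setIntegral_eq (hm t) (hii t hA)
      (fun s _ _ => (hKi t hA).integrableOn) (fun s hs _ => ?_) ?_
    · rw [hind t hA s (hm t _ hs), hKint t hA s, h t A hA s hs]
    · exact (measurable_KT_hist ha t hA).ennreal_toReal.stronglyMeasurable.aestronglyMeasurable

end uniq

/-! ### Ergodicity -/

section ergod

set_option linter.unusedSectionVars false

variable {d q : ℕ} {a : Fin (q + 1) → (Fin d → ℝ) → (Fin (q + 1) → ℝ) → ℝ} {f : ℝ → ℝ}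
  {ν : Measure ((Fin (q + 1) → ℝ) × (ℤ → (Fin d → ℝ)))}

lemma kT_comp {t t' : ℤ} (h : t ≤ t') (z : ZP d) : kT t (kT t' z) = kT t z := by
  funext s
  simp only [kT]
  by_cases h1 : s < t
  · have : s < t' := by omega
    simp [h1, this]
  · simp [h1]

lemma zback_iter_kT (j : ℕ) (t : ℤ) (z : ZP d) :
    zback^[j] (kT t z) = kT (t + j) (zback^[j] z) := by
  funext s
  simp only [zback_iter, kT, sub_lt_iff_lt_add]

lemma approx_hist {μ : Measure (ZP d)} [IsProbabilityMeasure μ] (hμ : μ.map zshift = μ)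
    {A : Set (ZP d)} (hA : MeasurableSet A) (hinv : zshift ⁻¹' A = A) (t : ℤ) {ε : ℝ}
    (hε : 0 < ε) : ∃ C, MeasurableSet[histSigma ℝ (Fin d → ℝ) t] C ∧
      μ (symmDiff A C) < ENNReal.ofReal ε := by
  let 𝒜 : Set (Set (ZP d)) := {C | MeasurableSet C ∧ ∃ N : ℕ, kT N ⁻¹' C = C}
  have hmono : ∀ {C : Set (ZP d)} {t t' : ℤ}, t ≤ t' → kT t ⁻¹' C = C → kT t' ⁻¹' C = C := by
    intro C t t' h hC
    conv_lhs => rw [← hC]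
    ext z
    rw [Set.mem_preimage, Set.mem_preimage, kT_comp h, ← Set.mem_preimage, hC]
  have halg : IsSetAlgebra 𝒜 := by
    refine ⟨⟨MeasurableSet.empty, 0, rfl⟩, ?_, ?_⟩
    · rintro C ⟨hC, N, hN⟩
      exact ⟨hC.compl, N, by rw [Set.preimage_compl, hN]⟩
    · rintro C D ⟨hC, N, hN⟩ ⟨hD, M, hM⟩
      refine ⟨hC.union hD, max N M, ?_⟩
      rw [Set.preimage_union, hmono (by simp) hN, hmono (by simp) hM]
  have hgen : (inferInstance : MeasurableSpace (ZP d)) = MeasurableSpace.generateFrom 𝒜 := by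
    refine le_antisymm ?_ (MeasurableSpace.generateFrom_le fun C hC => hC.1)
    refine iSup_le fun s => ?_
    rintro _ ⟨S, hS, rfl⟩
    refine MeasurableSpace.measurableSet_generateFrom
      ⟨hS.preimage (measurable_pi_apply s), s.toNat + 1, ?_⟩
    ext z
    have : s < ((s.toNat + 1 : ℕ) : ℤ) := by omega
    simp only [Set.mem_preimage, kT]
    simp only [this, if_true]
  obtain ⟨C, ⟨hC, N, hN⟩, hlt⟩ := (Measure.MeasureDense.of_generateFrom_isSetAlgebra_finite
    μ halg hgen).approx A hA (measure_ne_top _ _) ε hε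
  let j : ℕ := (N - t).toNat
  have hb : Measurable (zback : ZP d → ZP d) := measurable_zback
  have hbm := map_iterate_stationary hb (map_zback_eq hμ) j
  have hAb1 : zback ⁻¹' A = A := by
    conv_lhs => rw [← hinv]
    ext z
    simp [zshift_zback]
  have hAb : ∀ j : ℕ, zback^[j] ⁻¹' A = A := by
    intro j
    induction j with
    | zero => rfl
    | succ j ih => rw [Function.iterate_succ, Set.preimage_comp, ih, hAb1]
  refine ⟨zback^[j] ⁻¹' C, ?_, ?_⟩
  · have h1 : kT t ⁻¹' (zback^[j] ⁻¹' C) = zback^[j] ⁻¹' C := by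
      ext z
      rw [Set.mem_preimage, Set.mem_preimage, zback_iter_kT, ← Set.mem_preimage,
        hmono (by omega) hN, Set.mem_preimage]
    rw [← h1]
    exact measurableSet_histSigma_kT t (hC.preimage (hb.iterate j))
  · refine lt_of_eq_of_lt ?_ hlt
    conv_lhs => rw [← hAb j, ← Set.preimage_symmDiff]
    rw [← Measure.map_apply (hb.iterate j) (hA.symmDiff hC), hbm]

lemma SolSet_restrict [IsProbabilityMeasure (noiseM f)]
    {μ : Measure (ZP d)} [IsProbabilityMeasure μ] (hμ : μ.map zshift = μ) (h : SolSet a f μ)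
    {A : Set (ZP d)} (hA : MeasurableSet A) (hinv : zshift ⁻¹' A = A) :
    SolSet a f (μ.restrict A) := by
  intro t B hB H hH
  obtain ⟨hHm, -⟩ := measurableSet_histSigma hH
  have hBt : MeasurableSet {z : ZP d | (z t).1 ∈ B} := hB.preimage (by fun_prop)
  rw [Measure.restrict_apply (hHm.inter hBt), Measure.restrict_restrict hHm]
  have hKle : ∀ S : Set (ZP d), ∫⁻ z in S, KT a f t B z ∂μ ≤ μ S := by
    intro S
    calc ∫⁻ z in S, KT a f t B z ∂μ ≤ ∫⁻ z in S, 1 ∂μ := lintegral_mono fun z => KT_le t B z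
      _ = μ S := by simp
  have hsub : ∀ {S T U : Set (ZP d)}, S ⊆ T ∪ U →
      ∫⁻ z in S, KT a f t B z ∂μ ≤ ∫⁻ z in T, KT a f t B z ∂μ + μ U := by
    intro S T U hS
    calc ∫⁻ z in S, KT a f t B z ∂μ ≤ ∫⁻ z in T ∪ U, KT a f t B z ∂μ :=
          lintegral_mono_set hS
      _ ≤ ∫⁻ z in T, KT a f t B z ∂μ + ∫⁻ z in U, KT a f t B z ∂μ := lintegral_union_le _ _ _
      _ ≤ _ := by gcongr; exact hKle U
  have hfin : ∀ ε : NNReal, 0 < ε → ∃ C : Set (ZP d),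
      MeasurableSet[histSigma ℝ (Fin d → ℝ) t] C ∧ μ (symmDiff A C) ≤ ε / 2 := by
    intro ε hε
    obtain ⟨C, hC, hlt⟩ := approx_hist hμ hA hinv t (ε := ε / 2) (by positivity)
    refine ⟨C, hC, hlt.le.trans (le_of_eq ?_)⟩
    rw [ENNReal.ofReal_div_of_pos (by norm_num)]
    simp
  apply le_antisymm
  · refine ENNReal.le_of_forall_pos_le_add fun ε hε _ => ?_
    obtain ⟨C, hC, hlt⟩ := hfin ε hε
    calc μ (H ∩ {z | (z t).1 ∈ B} ∩ A)
        ≤ μ ((H ∩ C) ∩ {z | (z t).1 ∈ B} ∪ symmDiff A C) := by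
          refine measure_mono ?_
          rintro z ⟨⟨h1, h2⟩, h3⟩
          by_cases hz : z ∈ C
          · exact Or.inl ⟨⟨h1, hz⟩, h2⟩
          · exact Or.inr (Or.inl ⟨h3, hz⟩)
      _ ≤ μ ((H ∩ C) ∩ {z | (z t).1 ∈ B}) + μ (symmDiff A C) := measure_union_le _ _
      _ = ∫⁻ z in H ∩ C, KT a f t B z ∂μ + μ (symmDiff A C) := by
          rw [h t B hB (H ∩ C) (MeasurableSet.inter hH hC)]
      _ ≤ (∫⁻ z in H ∩ A, KT a f t B z ∂μ + μ (symmDiff A C)) + μ (symmDiff A C) := by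
          gcongr
          refine hsub ?_
          rintro z ⟨h1, h2⟩
          by_cases hz : z ∈ A
          · exact Or.inl ⟨h1, hz⟩
          · exact Or.inr (Or.inr ⟨h2, hz⟩)
      _ ≤ (∫⁻ z in H ∩ A, KT a f t B z ∂μ + ε / 2) + ε / 2 := by gcongr
      _ = _ := by rw [add_assoc, ENNReal.add_halves]
  · refine ENNReal.le_of_forall_pos_le_add fun ε hε _ => ?_
    obtain ⟨C, hC, hlt⟩ := hfin ε hε
    calc ∫⁻ z in H ∩ A, KT a f t B z ∂μ
        ≤ ∫⁻ z in H ∩ C, KT a f t B z ∂μ + μ (symmDiff A C) := by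
          refine hsub ?_
          rintro z ⟨h1, h2⟩
          by_cases hz : z ∈ C
          · exact Or.inl ⟨h1, hz⟩
          · exact Or.inr (Or.inl ⟨h2, hz⟩)
      _ = μ ((H ∩ C) ∩ {z | (z t).1 ∈ B}) + μ (symmDiff A C) := by
          rw [h t B hB (H ∩ C) (MeasurableSet.inter hH hC)]
      _ ≤ μ (H ∩ {z | (z t).1 ∈ B} ∩ A ∪ symmDiff A C) + μ (symmDiff A C) := by
          gcongr
          rintro z ⟨⟨h1, h2⟩, h3⟩
          by_cases hz : z ∈ A
          · exact Or.inl ⟨⟨h1, h3⟩, hz⟩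
          · exact Or.inr (Or.inr ⟨h2, hz⟩)
      _ ≤ (μ (H ∩ {z | (z t).1 ∈ B} ∩ A) + μ (symmDiff A C)) + μ (symmDiff A C) := by
          gcongr; exact measure_union_le _ _
      _ ≤ (μ (H ∩ {z | (z t).1 ∈ B} ∩ A) + ε / 2) + ε / 2 := by gcongr
      _ = _ := by rw [add_assoc, ENNReal.add_halves]

lemma SolSet_smul {μ : Measure (ZP d)} (h : SolSet a f μ) (c : ℝ≥0∞) : SolSet a f (c • μ) := by
  intro t B hB H hH
  rw [Measure.smul_apply, h t B hB H hH, Measure.restrict_smul, lintegral_smul_measure]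

lemma ergodic_of_unique [IsProbabilityMeasure (noiseM f)]
    {m : Measure (ℤ → (Fin d → ℝ))} [IsProbabilityMeasure m] (hm : Ergodic zshift m)
    {μ : Measure (ZP d)} [IsProbabilityMeasure μ] (hμ : μ.map zshift = μ)
    (hX : μ.map (fun z => fun t => (z t).2) = m) (h : SolSet a f μ)
    (huniq : ∀ μ' : Measure (ZP d), IsProbabilityMeasure μ' → μ'.map zshift = μ' →
      μ'.map (fun z => fun t => (z t).2) = m → SolSet a f μ' → μ' = μ) :
    Ergodic zshift μ := by
  have hz : Measurable (zshift : ZP d → ZP d) := measurable_zshift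
  have hθ : Measurable (zshift : (ℤ → (Fin d → ℝ)) → _) := measurable_zshift
  have hpr : Measurable (fun z : ZP d => fun t => (z t).2) := by fun_prop
  have hmp : MeasurePreserving (zshift : ZP d → ZP d) μ μ := ⟨hz, hμ⟩
  refine ⟨hmp, ⟨fun {A} hA hinv => ?_⟩⟩
  by_cases h0 : μ A = 0
  · rw [eventuallyConst_set']
    left
    rwa [ae_eq_empty]
  let μ' : Measure (ZP d) := (μ A)⁻¹ • μ.restrict A
  have hμ'p : IsProbabilityMeasure μ' := by
    constructor
    simp only [μ', Measure.smul_apply, Measure.restrict_apply_univ, smul_eq_mul]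
    exact ENNReal.inv_mul_cancel h0 (measure_ne_top _ _)
  have hμ's : μ'.map zshift = μ' := by
    simp only [μ', Measure.map_smul]
    congr 1
    have := (hmp.restrict_preimage hA).map_eq
    rwa [hinv] at this
  have hac : μ' ≪ μ := (Measure.smul_absolutelyContinuous).trans
    Measure.restrict_le_self.absolutelyContinuous
  have hX' : μ'.map (fun z => fun t => (z t).2) = m := by
    have := Measure.isProbabilityMeasure_map (μ := μ') hpr.aemeasurable
    refine hm.eq_of_absolutelyContinuous ⟨hθ, ?_⟩ ?_
    · conv_rhs => rw [← hμ's]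
      rw [Measure.map_map hθ hpr, Measure.map_map hpr hz]
      rfl
    · rw [← hX]
      exact hac.map hpr
  have heq := huniq μ' hμ'p hμ's hX' (SolSet_smul (SolSet_restrict hμ h hA hinv) _)
  rw [eventuallyConst_set']
  right
  rw [ae_eq_univ, ← heq]
  simp only [μ', Measure.smul_apply, Measure.restrict_apply hA.compl]
  simp

end ergod

theorem functional_coefficient_AR_stationary_ergodic_solution
    {d p : ℕ} (hp : 0 < p)
    {Ω : Type*} [MeasurableSpace Ω] (Pr : Measure Ω) [IsProbabilityMeasure Pr]
    (X : ℤ → Ω → (Fin d → ℝ)) (hX : ∀ t, Measurable (X t))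
    -- the environment is stationary
    (hstat : (Pr.map fun ω => fun t => X t ω).map zshift = Pr.map fun ω => fun t => X t ω)
    -- the environment is mixing
    (hmix : ∀ A B : Set (ℤ → (Fin d → ℝ)), MeasurableSet A → MeasurableSet B →
      Tendsto (fun n : ℕ => (Pr.map fun ω => fun t => X t ω) (A ∩ zshift^[n] ⁻¹' B)) atTop
        (nhds (((Pr.map fun ω => fun t => X t ω) A) * ((Pr.map fun ω => fun t => X t ω) B))))
    -- the coefficient functions and their envelopes
    (a : Fin p → (Fin d → ℝ) → (Fin p → ℝ) → ℝ)
    (ha : ∀ j, Measurable fun q : (Fin d → ℝ) × (Fin p → ℝ) => a j q.1 q.2)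
    (bfun : Fin p → (Fin d → ℝ) → ℝ) (hbfun : ∀ j, Measurable (bfun j))
    (hbsup : ∀ (j : Fin p) (x : Fin d → ℝ),
      IsLUB (Set.range fun y : Fin p → ℝ => |a j x y|) (bfun j x))
    -- the noise density: positive, lower-bounded on compact sets, integrable with finite mean
    (f : ℝ → ℝ) (hf : Measurable f) (hfpos : ∀ u, 0 < f u)
    (hfdens : ∫⁻ u, ENNReal.ofReal (f u) = 1)
    (hflow : ∀ R > (0 : ℝ), ∃ c > (0 : ℝ), ∀ u : ℝ, |u| ≤ R → c ≤ f u)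
    (hmoment : ∫⁻ u, ENNReal.ofReal (|u| * f u) < ∞)
    -- negativity of the top Lyapunov exponent
    -- γ(X) = inf_{n ≥ 1} n⁻¹ 𝔼[log ‖A(X_{-1}) ⋯ A(X_{-n})‖] < 0, allowing the value -∞
    (hlyap : ∃ n : ℕ, 0 < n ∧
      ∫⁻ ω, ENNReal.ofReal (Real.log (matNorm
          (((List.range n).map fun i => companionMat bfun (X (-(i : ℤ) - 1) ω)).prod))) ∂Pr <
        ∫⁻ ω, ENNReal.ofReal (-Real.log (matNorm
          (((List.range n).map fun i => companionMat bfun (X (-(i : ℤ) - 1) ω)).prod))) ∂Pr) :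
    -- there is a unique stationary solution, and it is ergodic
    ∃ μ : Measure (ℤ → ℝ × (Fin d → ℝ)),
      (IsProbabilityMeasure μ ∧ μ.map zshift = μ ∧
        μ.map (fun z => fun t => (z t).2) = Pr.map (fun ω => fun t => X t ω) ∧
        IsFCARSolution a f μ ∧ Ergodic zshift μ) ∧
      ∀ μ' : Measure (ℤ → ℝ × (Fin d → ℝ)),
        IsProbabilityMeasure μ' → μ'.map zshift = μ' →
        μ'.map (fun z => fun t => (z t).2) = Pr.map (fun ω => fun t => X t ω) →
        IsFCARSolution a f μ' → μ' = μ := by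
  obtain ⟨q, rfl⟩ : ∃ q, p = q + 1 := ⟨p - 1, by omega⟩
  have hXm : Measurable (fun ω => fun t => X t ω) := measurable_pi_lambda _ hX
  set m := Pr.map fun ω => fun t => X t ω with hm_def
  have hmp : IsProbabilityMeasure m := Measure.isProbabilityMeasure_map hXm.aemeasurable
  have hnoise : IsProbabilityMeasure (noiseM f) := by
    constructor
    simp only [noiseM]
    rw [withDensity_apply _ MeasurableSet.univ, Measure.restrict_univ, hfdens]
  have hab : ∀ j x y, |a j x y| ≤ bfun j x := fun j x y => (hbsup j x).1 ⟨y, rfl⟩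
  obtain ⟨n, hn, hlt⟩ := hlyap
  have hL : Measurable fun x : ℤ → (Fin d → ℝ) => Real.log (matNorm (matP bfun n x)) :=
    Real.measurable_log.comp (Finset.measurable_sum _ fun i _ => Finset.measurable_sum _ fun j _ =>
      (measurable_matP hbfun n i j).abs)
  have hlt' : ∫⁻ x, ENNReal.ofReal (Real.log (matNorm (matP bfun n x))) ∂m <
      ∫⁻ x, ENNReal.ofReal (-Real.log (matNorm (matP bfun n x))) ∂m := by
    have hL' : Measurable fun x : ℤ → (Fin d → ℝ) => -Real.log (matNorm (matP bfun n x)) := hL.neg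
    rw [hm_def, lintegral_map hL.ennreal_ofReal hXm, lintegral_map hL'.ennreal_ofReal hXm]
    have hmat : ∀ ω, matP bfun n (fun t => X t ω) =
        (((List.range n).map fun i => companionMat bfun (X (-(i : ℤ) - 1) ω)).prod) := by
      intro ω
      simp [matP, Function.comp_def]
    simp only [hmat]
    exact hlt
  obtain ⟨ν, hνp, hν, hνX⟩ := exists_chain_invariant hf hfpos hfdens hmoment hstat hmix ha hbfun
    hab hn hlt'
  obtain ⟨μ, hμp, hμ, hG⟩ := exists_stationary_path_measure ha hν
  have hpr : Measurable (fun z : ZP d => fun t => (z t).2) := by fun_prop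
  have hμX : μ.map (fun z => fun t => (z t).2) = m := by
    have h1 : (fun z : ZP d => fun t => (z t).2) =
        (fun z : ZP d => fun t => (z t).2) ∘ trW (-q) (0 : ℕ) := rfl
    rw [h1, ← Measure.map_map hpr (measurable_trW _ _), hG 0]
    simp only [Gam]
    rw [Measure.map_map hpr measurable_embW, ← hνX]
    rfl
  have hsol : SolSet a f μ := SolSet_of_SolM ha (SolM_of_Gam ha hμ hG)
  have huniq : ∀ μ' : Measure (ZP d), IsProbabilityMeasure μ' → μ'.map zshift = μ' →
      μ'.map (fun z => fun t => (z t).2) = m → SolSet a f μ' → μ' = μ := by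
    intro μ' hp' hs' hX' hsol'
    refine stationary_unique (q := q) hs' hμ fun k => ?_
    rw [hG k]
    exact Gam_of_SolM hf hfpos ha hν hs' (hX'.trans hνX.symm) (SolM_of_SolSet ha hsol') k
  refine ⟨μ, ⟨hμp, hμ, hμX, (isFCARSolution_iff hf ha).2 hsol,
    ergodic_of_unique (ergodic_zshift_of_mixing hstat hmix) hμ hμX hsol huniq⟩, ?_⟩
  intro μ' hp' hs' hX' hsol'
  exact huniq μ' hp' hs' hX' ((isFCARSolution_iff hf ha).1 hsol')

end
end

section
/- Let (X_t)_{t∈ℤ} be a stationary F-valued process and λ, b : F → [0,∞) measurable with b(x) ≥ 1 for all x. If the long-time contractivity condition limsup_n 𝔼[b(X_0) ∏_{t=1}^n λ(X_t)]^{1/n} < 1 holds, then limsup_n (∏_{i=1}^n λ(X_{-i}))^{1/n} < 1 almost surely. -/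
open MeasureTheory ProbabilityTheory Filter
open scoped ENNReal

noncomputable section

theorem zshift_iterate {α : Type*} (k : ℕ) (x : ℤ → α) (t : ℤ) :
    (zshift^[k] x) t = x (t + k) := by
  induction k generalizing x with
  | zero => simp
  | succ k ih =>
    rw [Function.iterate_succ_apply, ih]
    simp only [zshift]
    congr 1
    push_cast
    ring

theorem lyapunov_condition_of_long_time_contractivity
    {F : Type*} [MeasurableSpace F] [TopologicalSpace F] [PolishSpace F] [BorelSpace F]
    {Ω : Type*} [MeasurableSpace Ω] (Pr : Measure Ω) [IsProbabilityMeasure Pr]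
    (X : ℤ → Ω → F) (hX : ∀ t, Measurable (X t))
    -- the process X is stationary
    (hstat : (Pr.map fun ω => fun t => X t ω).map zshift = Pr.map fun ω => fun t => X t ω)
    (lam b : F → ℝ) (hlam : Measurable lam) (hb : Measurable b)
    (hlam0 : ∀ x, 0 ≤ lam x) (hb0 : ∀ x, 0 ≤ b x) (hb1 : ∀ x, 1 ≤ b x)
    -- the long-time contractivity condition of Lovas and Rásonyi
    (hcontr : atTop.limsup (fun n : ℕ =>
      (∫⁻ ω, ENNReal.ofReal (b (X 0 ω) * ∏ t ∈ Finset.range n, lam (X ((t : ℤ) + 1) ω)) ∂Pr) ^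
        ((n : ℝ)⁻¹)) < 1) :
    ∀ᵐ ω ∂Pr, atTop.limsup
      (fun n : ℕ => (∏ i ∈ Finset.range n, lam (X (-(i : ℤ) - 1) ω)) ^ ((n : ℝ)⁻¹)) < 1 := by
  have hpath : Measurable (fun ω => fun t => X t ω) := measurable_pi_lambda _ hX
  have hsh : Measurable (zshift : (ℤ → F) → (ℤ → F)) :=
    measurable_pi_lambda _ fun t => measurable_pi_apply (t + 1)
  have hmp : MeasurePreserving zshift (Pr.map fun ω => fun t => X t ω)
      (Pr.map fun ω => fun t => X t ω) := ⟨hsh, hstat⟩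
  have hE : ∀ n : ℕ, ∫⁻ ω, ENNReal.ofReal (∏ i ∈ Finset.range n, lam (X (-(i : ℤ) - 1) ω)) ∂Pr
      ≤ ∫⁻ ω, ENNReal.ofReal
        (b (X 0 ω) * ∏ t ∈ Finset.range n, lam (X ((t : ℤ) + 1) ω)) ∂Pr := by
    intro n
    let G : (ℤ → F) → ℝ≥0∞ := fun x =>
      ENNReal.ofReal (∏ i ∈ Finset.range n, lam (x (-(i : ℤ) - 1)))
    have hG : Measurable G := by
      apply ENNReal.measurable_ofReal.comp
      exact Finset.measurable_fun_prod _ fun i _ => hlam.comp (measurable_pi_apply _)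
    have h1 := (hmp.iterate (n + 1)).lintegral_comp hG
    rw [lintegral_map hG hpath,
      lintegral_map (f := fun a => G (zshift^[n + 1] a))
        (hG.comp (hmp.iterate (n + 1)).measurable) hpath] at h1
    change _ = ∫⁻ ω, ENNReal.ofReal (∏ i ∈ Finset.range n, lam (X (-(i : ℤ) - 1) ω)) ∂Pr at h1
    rw [← h1]
    apply lintegral_mono
    intro ω
    apply ENNReal.ofReal_le_ofReal
    have h2 : ∏ i ∈ Finset.range n, lam ((zshift^[n + 1] fun t => X t ω) (-(i : ℤ) - 1))
        = ∏ t ∈ Finset.range n, lam (X ((t : ℤ) + 1) ω) := by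
      rw [← Finset.prod_range_reflect]
      apply Finset.prod_congr rfl
      intro i hi
      rw [zshift_iterate]
      have := Finset.mem_range.1 hi
      congr 2
      omega
    rw [h2]
    exact le_mul_of_one_le_left (Finset.prod_nonneg fun _ _ => hlam0 _) (hb1 _)
  obtain ⟨r, hr, hr1⟩ := exists_between hcontr
  obtain ⟨s, hrs, hs1⟩ := exists_between hr1
  have hs0 : s ≠ 0 := (lt_of_le_of_lt bot_le hrs).ne'
  have hst : s ≠ ∞ := (hs1.trans ENNReal.one_lt_top).ne
  have hev := eventually_lt_of_limsup_lt hr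
  obtain ⟨N, hN⟩ := eventually_atTop.1 hev
  let M := max N 1
  let P : ℕ → Ω → ℝ≥0∞ := fun n ω =>
    ENNReal.ofReal (∏ i ∈ Finset.range n, lam (X (-(i : ℤ) - 1) ω))
  have hPm : ∀ n, Measurable (P n) := fun n =>
    ENNReal.measurable_ofReal.comp
      (Finset.measurable_fun_prod _ fun i _ => hlam.comp (hX _))
  have hbound : ∀ n, Pr {ω | s ^ (n + M) ≤ P (n + M) ω} ≤ (r / s) ^ n := by
    intro n
    have hn1 : 1 ≤ n + M := le_trans (le_max_right N 1) (Nat.le_add_left _ _)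
    have hnN : N ≤ n + M := le_trans (le_max_left N 1) (Nat.le_add_left _ _)
    have hlt := hN _ hnN
    have hint : ∫⁻ ω, P (n + M) ω ∂Pr ≤ r ^ (n + M) := by
      refine (hE _).trans ?_
      have := (ENNReal.rpow_inv_le_iff (z := ((n + M : ℕ) : ℝ)) (by positivity)).1 hlt.le
      rwa [ENNReal.rpow_natCast] at this
    have hrs1 : r / s ≤ 1 := ENNReal.div_le_of_le_mul (by simpa using hrs.le)
    calc Pr {ω | s ^ (n + M) ≤ P (n + M) ω}
        ≤ (∫⁻ ω, P (n + M) ω ∂Pr) / s ^ (n + M) :=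
          meas_ge_le_lintegral_div (hPm _).aemeasurable (pow_ne_zero _ hs0)
            (ENNReal.pow_ne_top hst)
      _ ≤ r ^ (n + M) / s ^ (n + M) := ENNReal.div_le_div_right hint _
      _ = (r / s) ^ (n + M) := by
          rw [div_eq_mul_inv, div_eq_mul_inv, mul_pow, ENNReal.inv_pow]
      _ ≤ (r / s) ^ n := pow_le_pow_right_of_le_one' hrs1 (Nat.le_add_right _ _)
  have hsum : ∑' n, Pr {ω | s ^ (n + M) ≤ P (n + M) ω} ≠ ∞ := by
    refine ne_top_of_le_ne_top ?_ (ENNReal.tsum_le_tsum hbound)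
    rw [ENNReal.tsum_geometric]
    apply ENNReal.inv_ne_top.2
    apply (tsub_pos_of_lt _).ne'
    exact (ENNReal.div_lt_iff (Or.inl hs0) (Or.inl hst)).2 (by simpa using hrs)
  filter_upwards [ae_eventually_notMem hsum] with ω hω
  have hs1' : s.toReal < 1 := by
    simpa using (ENNReal.toReal_lt_toReal hst ENNReal.one_ne_top).2 hs1
  refine lt_of_le_of_lt ?_ hs1'
  have hnn : ∀ n : ℕ, 0 ≤ ∏ i ∈ Finset.range n, lam (X (-(i : ℤ) - 1) ω) :=
    fun n => Finset.prod_nonneg fun _ _ => hlam0 _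
  apply limsup_le_of_le
  · exact IsCoboundedUnder.of_frequently_ge (a := 0)
      (Frequently.of_forall fun n => Real.rpow_nonneg (hnn n) _)
  · obtain ⟨K, hK⟩ := eventually_atTop.1 hω
    filter_upwards [eventually_ge_atTop (K + M)] with n hn
    have hn1 : 1 ≤ n := le_trans (le_max_right N 1) (by omega)
    have h := hK (n - M) (by omega)
    rw [show n - M + M = n by omega] at h
    replace h := not_le.1 h
    have h3 : ∏ i ∈ Finset.range n, lam (X (-(i : ℤ) - 1) ω) ≤ s.toReal ^ n := by
      rw [← ENNReal.toReal_pow]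
      exact (ENNReal.ofReal_le_iff_le_toReal (ENNReal.pow_ne_top hst)).1 h.le
    rw [Real.rpow_inv_le_iff_of_pos (hnn n) ENNReal.toReal_nonneg (by positivity),
      Real.rpow_natCast]
    exact h3

end
end

section
/- Let (Ω,𝓕,ℙ) be a probability space, (𝓗_i)_{i∈ℕ} a filtration and (W_i)_{i∈ℕ} an adapted sequence of nonnegative integrable random variables with W_0 constant equal to x. Let C ≥ 1 be a real number, set η = 2/(2 − 1/C) > 1, and let R ≥ 2C(2C+1). Assume the drift condition 𝔼[W_{i+1} | 𝓗_i] ≤ (1 − 1/C) W_i + 2C a.s. for every i ∈ ℕ, and define the hitting time ρ_1 = inf{i ≥ 0 : W_i ≤ R}. If x > R, then ρ_1 < ∞ a.s. and 𝔼[η^{ρ_1}] ≤ x. -/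
open MeasureTheory ProbabilityTheory Filter
open scoped ENNReal

noncomputable section

lemma drift_step
    {Ω : Type*} [m0 : MeasurableSpace Ω] (Pr : Measure Ω) [IsProbabilityMeasure Pr]
    (ℱ : Filtration ℕ m0) (W : ℕ → Ω → ℝ)
    (hnonneg : ∀ i ω, 0 ≤ W i ω) (hint : ∀ i, Integrable (W i) Pr)
    (C R : ℝ) (hC : 1 ≤ C) (hR : 2 * C * (2 * C + 1) ≤ R)
    (hdrift : ∀ i : ℕ, Pr[W (i + 1) | ℱ i] ≤ᵐ[Pr] fun ω => (1 - 1 / C) * W i ω + 2 * C)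
    (A : ℕ → Set Ω) (hA : ∀ i, MeasurableSet[ℱ i] (A i)) (hanti : ∀ i, A (i + 1) ⊆ A i)
    (hAR : ∀ i, ∀ ω ∈ A i, R < W i ω) (i : ℕ) :
    ∫ ω in A (i + 1), W (i + 1) ω ∂Pr + Pr.real (A i) ≤
      (1 - 1 / (2 * C)) * ∫ ω in A i, W i ω ∂Pr := by
  have hA' : MeasurableSet (A i) := ℱ.le i _ (hA i)
  have h1 : ∫ ω in A (i + 1), W (i + 1) ω ∂Pr ≤ ∫ ω in A i, W (i + 1) ω ∂Pr :=
    setIntegral_mono_set (hint _).integrableOn (ae_of_all _ fun ω => hnonneg _ ω)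
      (hanti i).eventuallyLE
  have h2 : ∫ ω in A i, W (i + 1) ω ∂Pr = ∫ ω in A i, (Pr[W (i + 1) | ℱ i]) ω ∂Pr :=
    (setIntegral_condExp (ℱ.le i) (hint _) (hA i)).symm
  have hI : Integrable (fun ω => (1 - 1 / (2 * C)) * W i ω - 1) Pr :=
    ((hint i).const_mul _).sub (integrable_const _)
  have h3 : ∫ ω in A i, (Pr[W (i + 1) | ℱ i]) ω ∂Pr ≤
      ∫ ω in A i, ((1 - 1 / (2 * C)) * W i ω - 1) ∂Pr := by
    refine setIntegral_mono_on_ae integrable_condExp.integrableOn hI.integrableOn hA' ?_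
    filter_upwards [hdrift i] with ω hω hm
    refine hω.trans ?_
    have := hAR i ω hm
    have hC0 : 0 < C := by linarith
    have h4 : 2 * C + 1 ≤ W i ω / (2 * C) := by
      rw [le_div_iff₀ (by positivity)]; nlinarith
    have h5 : (1 - 1 / C) * W i ω = (1 - 1 / (2 * C)) * W i ω - W i ω / (2 * C) := by
      field_simp; ring
    linarith
  have h4 : ∫ ω in A i, ((1 - 1 / (2 * C)) * W i ω - 1) ∂Pr =
      (1 - 1 / (2 * C)) * ∫ ω in A i, W i ω ∂Pr - Pr.real (A i) := by
    rw [integral_sub ((hint i).const_mul _).integrableOn (integrable_const _),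
      integral_const_mul]
    simp
  linarith

theorem hitting_time_exponential_moment
    {Ω : Type*} [m0 : MeasurableSpace Ω] (Pr : Measure Ω) [IsProbabilityMeasure Pr]
    (ℱ : Filtration ℕ m0) (W : ℕ → Ω → ℝ) (hadapt : Adapted ℱ W)
    (hnonneg : ∀ i ω, 0 ≤ W i ω) (hint : ∀ i, Integrable (W i) Pr)
    (x C R : ℝ) (hC : 1 ≤ C) (hR : 2 * C * (2 * C + 1) ≤ R)
    (hW0 : ∀ ω, W 0 ω = x)
    -- the Foster–Lyapunov drift condition
    (hdrift : ∀ i : ℕ, Pr[W (i + 1) | ℱ i] ≤ᵐ[Pr] fun ω => (1 - 1 / C) * W i ω + 2 * C)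
    (hx : R < x) :
    -- the hitting time ρ₁ = inf {i ≥ 0 : W_i ≤ R} is a.s. finite and 𝔼[η^{ρ₁}] ≤ x,
    -- with η = 2/(2 − 1/C)
    (∀ᵐ ω ∂Pr, ∃ i : ℕ, W i ω ≤ R) ∧
    ∫⁻ ω, ENNReal.ofReal ((2 / (2 - 1 / C)) ^ sInf {i : ℕ | W i ω ≤ R}) ∂Pr ≤
      ENNReal.ofReal x := by
  set A : ℕ → Set Ω := fun i => {ω | ∀ j ≤ i, R < W j ω} with hAdef
  have hA : ∀ i, MeasurableSet[ℱ i] (A i) := by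
    intro i
    have : A i = ⋂ j ∈ Set.Iic i, {ω | R < W j ω} := by
      ext ω; simp [hAdef]
    rw [this]
    refine MeasurableSet.biInter (Set.to_countable _) fun j hj => ?_
    exact ℱ.mono hj _ (hadapt j measurableSet_Ioi)
  have hA' : ∀ i, MeasurableSet (A i) := fun i => ℱ.le i _ (hA i)
  have step := drift_step Pr ℱ W hnonneg hint C R hC hR hdrift A hA
    (fun i ω h j hj => h j (by omega)) (fun i ω h => h i le_rfl)
  have hC0 : 0 < C := by linarith
  set a : ℕ → ℝ := fun i => ∫ ω in A i, W i ω ∂Pr with ha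
  have ha0 : ∀ i, 0 ≤ a i := fun i => integral_nonneg fun ω => hnonneg i ω
  have hax : a 0 = x := by
    have : A 0 = Set.univ := by
      ext ω; simp [hAdef, hW0, hx]
    simp [ha, this, hW0]
  have hq : 1 / (2 * C) ≤ 1 / 2 := by
    apply one_div_le_one_div_of_le <;> linarith
  have hq0 : 0 < 1 / (2 * C) := by positivity
  set q : ℝ := 1 - 1 / (2 * C) with hqdef
  have hqpos : 0 < q := by linarith
  have hηq : 2 / (2 - 1 / C) = q⁻¹ := by
    have : 2 - 1 / C = 2 * q := by rw [hqdef]; field_simp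
    rw [this]; field_simp
  rw [hηq]
  set η : ℝ := q⁻¹ with hη
  have hqη : η * q = 1 := by rw [hη]; field_simp
  have hη0 : 0 < η := by positivity
  have hη1 : 1 < η := by rw [hη]; exact (one_lt_inv₀ hqpos).2 (by linarith)
  have hx6 : 6 ≤ x := by nlinarith
  have hsum : ∀ n, ∑ i ∈ Finset.range n, η ^ (i + 1) * Pr.real (A i) + η ^ n * a n ≤ x := by
    intro n
    induction n with
    | zero => simp [hax]
    | succ n ih =>
      rw [Finset.sum_range_succ]
      have h1 := mul_le_mul_of_nonneg_left (step n) (pow_nonneg hη0.le (n + 1))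
      have h2 : η ^ (n + 1) * (q * a n) = η ^ n * a n := by
        rw [pow_succ]; linear_combination η ^ n * a n * hqη
      have h3 : η ^ (n + 1) * (a (n + 1) + Pr.real (A n)) ≤ η ^ (n + 1) * (q * a n) := h1
      linarith
  constructor
  · have hz : Pr (⋂ i, A i) = 0 := by
      have hle : ∀ n, Pr.real (⋂ i, A i) ≤ x * q ^ (n + 1) := by
        intro n
        have h1 : Pr.real (⋂ i, A i) ≤ Pr.real (A n) :=
          measureReal_mono (Set.iInter_subset _ n)
        have h2 := hsum (n + 1)
        have h3 : η ^ (n + 1) * Pr.real (A n) ≤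
            ∑ i ∈ Finset.range (n + 1), η ^ (i + 1) * Pr.real (A i) :=
          Finset.single_le_sum (f := fun i => η ^ (i + 1) * Pr.real (A i))
            (fun i _ => by positivity) (by simp)
        have h4 : 0 ≤ η ^ (n + 1) * a (n + 1) := mul_nonneg (by positivity) (ha0 _)
        have h5 : η ^ (n + 1) * Pr.real (A n) ≤ x := by linarith
        have h6 := mul_le_mul_of_nonneg_right h5 (pow_nonneg hqpos.le (n + 1))
        have h7 : η ^ (n + 1) * q ^ (n + 1) = 1 := by rw [← mul_pow, hqη, one_pow]
        have h8 : η ^ (n + 1) * Pr.real (A n) * q ^ (n + 1) = Pr.real (A n) := by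
          linear_combination Pr.real (A n) * h7
        linarith
      have hlim : Tendsto (fun n : ℕ => x * q ^ (n + 1)) atTop (nhds (x * 0)) :=
        ((tendsto_add_atTop_iff_nat 1).2
          (tendsto_pow_atTop_nhds_zero_of_lt_one hqpos.le (by linarith))).const_mul x
      have h9 : Pr.real (⋂ i, A i) ≤ 0 := by
        have := ge_of_tendsto' hlim hle
        simpa using this
      have h10 : Pr.real (⋂ i, A i) = 0 := le_antisymm h9 measureReal_nonneg
      exact (measureReal_eq_zero_iff).1 h10
    rw [ae_iff]
    refine measure_mono_null ?_ hz
    intro ω hω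
    simp only [Set.mem_ofPred_eq, not_exists, not_le] at hω
    simp only [Set.mem_iInter]
    exact fun i j _ => hω j
  · have hd : ∀ i : ℕ, 0 ≤ η ^ (i + 1) - η ^ i := fun i =>
      sub_nonneg.2 (pow_le_pow_right₀ hη1.le (Nat.le_succ i))
    have hpt : ∀ ω, ENNReal.ofReal (η ^ sInf {i : ℕ | W i ω ≤ R}) ≤
        1 + ∑' i : ℕ, (A i).indicator (fun _ => ENNReal.ofReal (η ^ (i + 1) - η ^ i)) ω := by
      intro ω
      set r := sInf {i : ℕ | W i ω ≤ R} with hr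
      have hmem : ∀ i ∈ Finset.range r, ω ∈ A i := by
        intro i hi j hj
        have : j ∉ {i : ℕ | W i ω ≤ R} :=
          Nat.notMem_of_lt_sInf (lt_of_le_of_lt hj (Finset.mem_range.1 hi))
        simpa using this
      calc ENNReal.ofReal (η ^ r)
          = ENNReal.ofReal (1 + ∑ i ∈ Finset.range r, (η ^ (i + 1) - η ^ i)) := by
            rw [Finset.sum_range_sub (fun i => η ^ i)]; simp
        _ = 1 + ∑ i ∈ Finset.range r, ENNReal.ofReal (η ^ (i + 1) - η ^ i) := by
            rw [ENNReal.ofReal_add zero_le_one (Finset.sum_nonneg fun i _ => hd i),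
              ENNReal.ofReal_sum_of_nonneg fun i _ => hd i, ENNReal.ofReal_one]
        _ = 1 + ∑ i ∈ Finset.range r,
              (A i).indicator (fun _ => ENNReal.ofReal (η ^ (i + 1) - η ^ i)) ω := by
            congr 1
            exact Finset.sum_congr rfl fun i hi => by rw [Set.indicator_of_mem (hmem i hi)]
        _ ≤ _ := by
            gcongr
            exact ENNReal.sum_le_tsum _
    refine (lintegral_mono hpt).trans ?_
    rw [lintegral_add_left measurable_const,
      lintegral_tsum fun i => (measurable_const.indicator (hA' i)).aemeasurable]
    simp only [lintegral_const, measure_univ, mul_one]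
    have hb : ∑' i : ℕ, ∫⁻ ω, (A i).indicator
        (fun _ => ENNReal.ofReal (η ^ (i + 1) - η ^ i)) ω ∂Pr ≤ ENNReal.ofReal (x - 1) := by
      refine ENNReal.tsum_le_of_sum_range_le fun n => ?_
      have : ∀ i, ∫⁻ ω, (A i).indicator
          (fun _ => ENNReal.ofReal (η ^ (i + 1) - η ^ i)) ω ∂Pr =
          ENNReal.ofReal ((η ^ (i + 1) - η ^ i) * Pr.real (A i)) := by
        intro i
        rw [lintegral_indicator (hA' i), setLIntegral_const, ENNReal.ofReal_mul (hd i),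
          ofReal_measureReal]
      simp only [this]
      rw [← ENNReal.ofReal_sum_of_nonneg fun i _ => mul_nonneg (hd i) measureReal_nonneg]
      apply ENNReal.ofReal_le_ofReal
      have h1 : ∑ i ∈ Finset.range n, (η ^ (i + 1) - η ^ i) * Pr.real (A i) =
          (1 - q) * ∑ i ∈ Finset.range n, η ^ (i + 1) * Pr.real (A i) := by
        rw [Finset.mul_sum]
        refine Finset.sum_congr rfl fun i _ => ?_
        rw [pow_succ]
        linear_combination η ^ i * Pr.real (A i) * hqη
      have h2 : 0 ≤ η ^ n * a n := mul_nonneg (by positivity) (ha0 _)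
      have h3 := hsum n
      rw [h1]
      have h4 : (1 - q) * ∑ i ∈ Finset.range n, η ^ (i + 1) * Pr.real (A i) ≤ (1 - q) * x :=
        mul_le_mul_of_nonneg_left (by linarith) (by linarith)
      nlinarith
    calc _ ≤ ENNReal.ofReal 1 + ENNReal.ofReal (x - 1) := by
          rw [ENNReal.ofReal_one]; gcongr
      _ = ENNReal.ofReal x := by
          rw [← ENNReal.ofReal_add zero_le_one (by linarith)]; congr 1; ring

end
end
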